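/- Let π ∈ ℤ[ρ] be a primary prime with p = π·π̄ and let χ̃_π be the associated Hecke character of weight one. Then the root number satisfies: C(χ̃_π) = χ_π(3)·π̃^{−1}·π̃̄ if p ≡ 7 (mod 18); C(χ̃_π) = χ̄_π(3)·π̃^{−1}·π̃̄ if p ≡ 13 (mod 18); and C(χ̃_π) = −χ_π(3)·π̃^{−1}·π̃̄ if p ≡ 1 (mod 18), where π̃̄ denotes the complex conjugate of the canonical cubic root π̃. -/

import Mathlib

open Complex BigOperators

noncomputable section

/-- `ρ = e^{2πi/3}`, a primitive cube root of unity. -/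
def ρ3 : ℂ := Complex.exp (2 * Real.pi * Complex.I / 3)

/-- The ring of Eisenstein integers `ℤ[ρ]`, realized as a subring of `ℂ`. -/
def O3 : Subring ℂ := Subring.closure {ρ3}

/-- `√−3 = i·√3`. -/
def sqrtm3 : ℂ := Complex.I * (Real.sqrt 3 : ℝ)

/-- The congruence `a ≡ b (mod c)` in `ℤ[ρ]`. -/
def ECong (a b c : ℂ) : Prop := ∃ d ∈ O3, a - b = c * d

/-- `a` and `b` are coprime in `ℤ[ρ]`. -/
def ECoprime (a b : ℂ) : Prop := ∃ u ∈ O3, ∃ v ∈ O3, u * a + v * b = 1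

/-- The real period `ϖ₁ = ∫₀¹ (1−x³)^{−2/3} dx`. -/
def varpi1 : ℝ := ∫ x in (0:ℝ)..(1:ℝ), (1 - x ^ 3) ^ (-(2:ℝ)/3)

/-- The points of the period lattice `ϖ₁·ℤ[ρ]`. -/
def ω3 (m : ℤ × ℤ) : ℂ := (varpi1 : ℂ) * ((m.1 : ℂ) + (m.2 : ℂ) * ρ3)

/-- The Weierstrass `℘`-function of the period lattice `ϖ₁·ℤ[ρ]`
(so that `℘′² = 4℘³ − 27`). -/
def wp3 (u : ℂ) : ℂ :=
  (u ^ 2)⁻¹ + ∑' m : ℤ × ℤ, if m = 0 then 0 else (((u - ω3 m) ^ 2)⁻¹ - ((ω3 m) ^ 2)⁻¹)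

/-- The derivative `℘′` of the Weierstrass `℘`-function of `ϖ₁·ℤ[ρ]`. -/
def wp3' (u : ℂ) : ℂ := ∑' m : ℤ × ℤ, (-2) * ((u - ω3 m) ^ 3)⁻¹

/-- The Weierstrass `ζ`-function of the period lattice `ϖ₁·ℤ[ρ]`. -/
def wzeta3 (u : ℂ) : ℂ :=
  u⁻¹ + ∑' m : ℤ × ℤ, if m = 0 then 0 else ((u - ω3 m)⁻¹ + (ω3 m)⁻¹ + u * ((ω3 m) ^ 2)⁻¹)

/-- The non-analytic doubly periodic function `Z(u) = ζ(ϖ₁u) − (2π/(√3·ϖ₁))·ū`. -/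
def Z3 (u : ℂ) : ℂ :=
  wzeta3 ((varpi1 : ℂ) * u) -
    ((2 * Real.pi / (Real.sqrt 3 * varpi1) : ℝ) : ℂ) * (starRingEnd ℂ) u

/-- The elliptic function `φ(u) = 6℘(ϖ₁u)/(9+℘′(ϖ₁u))` of period lattice `ℤ[ρ]`. -/
def phi3 (u : ℂ) : ℂ := 6 * wp3 ((varpi1 : ℂ) * u) / (9 + wp3' ((varpi1 : ℂ) * u))

/-- The elliptic function `ψ(u) = (9−℘′(ϖ₁u))/(9+℘′(ϖ₁u))` of period lattice `ℤ[ρ]`. -/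
def psi3 (u : ℂ) : ℂ := (9 - wp3' ((varpi1 : ℂ) * u)) / (9 + wp3' ((varpi1 : ℂ) * u))

/-- A residue class character modulo `β` on `ℤ[ρ]`. -/
structure IsResChar3 (β : ℂ) (χ : ℂ → ℂ) : Prop where
  periodic : ∀ a ∈ O3, ∀ b ∈ O3, ECong a b β → χ a = χ b
  map_mul : ∀ a ∈ O3, ∀ b ∈ O3, χ (a * b) = χ a * χ b
  map_one : χ 1 = 1
  vanish : ∀ a ∈ O3, ¬ ECoprime a β → χ a = 0

/-- The cubic residue character `χ_π = (·/π)₃` modulo a prime `π` with `p = π·π̄`: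
`χ_π(ν)³ = 1` and `χ_π(ν) ≡ ν^{(p−1)/3} (mod π)`. -/
structure IsCubicChar (π : ℂ) (p : ℕ) (χ : ℂ → ℂ) : Prop where
  resChar : IsResChar3 π χ
  cube : ∀ ν ∈ O3, ECoprime ν π → χ ν ^ 3 = 1
  euler : ∀ ν ∈ O3, ECoprime ν π → ECong (χ ν) (ν ^ ((p - 1) / 3)) π

/-- The elliptic Gauss sum `G_π(χ, f) = (1/3)·Σ_{ν ∈ (ℤ[ρ]/(π))^×} χ(ν)·f(ν/π)`,
computed via the integer representatives `1, …, p−1` of `(ℤ[ρ]/(π))^× ≅ (ℤ/p)^×`. -/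
def EGS3 (p : ℕ) (χ f : ℂ → ℂ) (π : ℂ) : ℂ :=
  (1/3 : ℂ) * ∑ r ∈ Finset.Icc 1 (p - 1), χ (r : ℂ) * f ((r : ℂ) / π)

/-- `S` is a third set of `(ℤ[ρ]/(π))^×`, i.e. `(ℤ[ρ]/(π))^× = S ∪ ρS ∪ ρ̄S`. -/
def IsThirdSet (π : ℂ) (S : Finset ℂ) : Prop :=
  (∀ ν ∈ S, ν ∈ O3 ∧ ECoprime ν π) ∧
  (∀ a ∈ O3, ECoprime a π →
    ∃ ν ∈ S, ∃ ε ∈ ({1, ρ3, ρ3 ^ 2} : Set ℂ), ECong a (ε * ν) π) ∧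
  (∀ ν ∈ S, ∀ μ ∈ S, ∀ ε ∈ ({1, ρ3, ρ3 ^ 2} : Set ℂ), ∀ ε' ∈ ({1, ρ3, ρ3 ^ 2} : Set ℂ),
    ECong (ε * ν) (ε' * μ) π → ν = μ ∧ ε = ε')

/-- `γ(S)` is the cube root of unity with `γ(S) ≡ −∏_{ν∈S} ν (mod π)`. -/
def IsGamma3 (π : ℂ) (S : Finset ℂ) (γ : ℂ) : Prop :=
  γ ^ 3 = 1 ∧ ECong γ (-(∏ ν ∈ S, ν)) π

/-- `L` is the value at `s = 1` of the analytic continuation of the Hecke `L`-series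
`L(s, χ̃) = Σ_𝔞 χ̃(𝔞)·N𝔞^{−s} = (1/6)·Σ_{ν ∈ ℤ[ρ]} χ₁(ν)·ν̄·|ν|^{−2s}` attached to the
weight-one Hecke character `χ̃((ν)) = χ₁(ν)·ν̄` of `ℚ(ρ)`. -/
def IsLValue3 (χ₁ : ℂ → ℂ) (L : ℂ) : Prop :=
  ∃ F : ℂ → ℂ, DifferentiableOn ℂ F {s : ℂ | 0 < s.re} ∧
    (∀ s : ℂ, 3/2 < s.re →
      F s = (1/6 : ℂ) *
        ∑' ν : O3, χ₁ (ν : ℂ) * (starRingEnd ℂ) (ν : ℂ) *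
          ((Complex.normSq (ν : ℂ) : ℂ) ^ (-s))) ∧
    F 1 = L

/-- `T` is a complete residue system modulo `β` in `ℤ[ρ]`. -/
def IsCRS3 (β : ℂ) (T : Finset ℂ) : Prop :=
  (∀ a ∈ T, a ∈ O3) ∧ (∀ a ∈ T, ∀ b ∈ T, ECong a b β → a = b) ∧
  (∀ z ∈ O3, ∃ a ∈ T, ECong z a β)

/-- `e^{2πi·S(z)}` where `S(a + b·ρ̄) = a`, i.e. `2πi·S(z) = (2π/√3)·(zρ − z̄ρ̄)`. -/
def eS3 (z : ℂ) : ℂ :=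
  Complex.exp (((2 * Real.pi / Real.sqrt 3 : ℝ) : ℂ) *
    (z * ρ3 - (starRingEnd ℂ) z * (starRingEnd ℂ) ρ3))

/-- `χ₀`: the character mod `3` giving the natural isomorphism `(ℤ[ρ]/(3))^× ≅ W`,
i.e. `χ₀(ν) = ε` for `ν ≡ ε (mod 3)`, `ε ∈ W = {±1, ±ρ, ±ρ̄}`. -/
def IsChi0₃ (χ₀ : ℂ → ℂ) : Prop :=
  IsResChar3 3 χ₀ ∧ ∀ ε ∈ ({1, -1, ρ3, -ρ3, ρ3 ^ 2, -ρ3 ^ 2} : Set ℂ), χ₀ ε = ε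

/-- `χ₀′`: the character mod `√−3` giving `(ℤ[ρ]/(√−3))^× ≅ {±1}`,
i.e. `χ₀′(ν) = δ` for `ν ≡ δ (mod √−3)`, `δ ∈ {±1}`. -/
def IsChi0'₃ (χ₀' : ℂ → ℂ) : Prop :=
  IsResChar3 sqrtm3 χ₀' ∧ χ₀' (-1) = -1

/-- The classical cubic (Kummer) Gauss sum `G₃(π) = Σ_{r=1}^{p−1} (r/π)₃·e^{2πir/p}`. -/
def G3sum (p : ℕ) (χ : ℂ → ℂ) : ℂ :=
  ∑ r ∈ Finset.Icc 1 (p - 1), χ (r : ℂ) * Complex.exp (2 * Real.pi * Complex.I * (r : ℂ) / (p : ℂ))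

set_option linter.unusedSectionVars false

lemma rho3_eq : ρ3 = -1/2 + (Real.sqrt 3 / 2 : ℝ) * I := by
  have h : (2 * Real.pi * I / 3 : ℂ) = ((Real.pi - Real.pi / 3 : ℝ) : ℂ) * I := by
    push_cast; ring
  rw [ρ3, h, exp_mul_I, ← ofReal_cos, ← ofReal_sin, Real.cos_pi_sub, Real.sin_pi_sub,
    Real.cos_pi_div_three, Real.sin_pi_div_three]
  push_cast; ring

lemma sq3 : ((Real.sqrt 3 : ℝ) : ℂ) ^ 2 = 3 := by
  rw [← ofReal_pow, Real.sq_sqrt (by norm_num)]; norm_num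

lemma rho3_sq : ρ3 ^ 2 = -1 - ρ3 := by
  rw [rho3_eq]; push_cast
  linear_combination (I ^ 2 / 4) * sq3 + (3 / 4 : ℂ) * I_sq

lemma rho3_sum : 1 + ρ3 + ρ3 ^ 2 = 0 := by rw [rho3_sq]; ring

lemma rho3_cube : ρ3 ^ 3 = 1 := by
  linear_combination (ρ3 - 1) * rho3_sum

lemma rho3_ne_zero : ρ3 ≠ 0 := exp_ne_zero _

lemma rho3_im : ρ3.im = Real.sqrt 3 / 2 := by rw [rho3_eq]; simp

lemma rho3_re : ρ3.re = -1/2 := by rw [rho3_eq]; simp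

lemma rho3_im_pos : 0 < ρ3.im := by rw [rho3_im]; positivity

lemma rho3_ne_one : ρ3 ≠ 1 := fun h => by
  have := rho3_im_pos; rw [h] at this; simp at this

lemma conj_rho3 : (starRingEnd ℂ) ρ3 = ρ3 ^ 2 := by
  rw [rho3_sq]
  apply Complex.ext
  · simp [rho3_re]; norm_num
  · simp

lemma sqrtm3_eq : sqrtm3 = ρ3 - ρ3 ^ 2 := by
  rw [rho3_sq, rho3_eq, sqrtm3]; push_cast; ring

lemma sqrtm3_eq' : sqrtm3 = 1 + 2 * ρ3 := by rw [sqrtm3_eq, rho3_sq]; ring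

lemma sqrtm3_sq : sqrtm3 ^ 2 = -3 := by
  rw [sqrtm3_eq']; linear_combination 4 * rho3_sum

lemma sqrtm3_ne_zero : sqrtm3 ≠ 0 := fun h => by
  have := sqrtm3_sq; rw [h] at this; norm_num at this

lemma conj_sqrtm3 : (starRingEnd ℂ) sqrtm3 = -sqrtm3 := by
  simp [sqrtm3]

lemma rho3_mem : ρ3 ∈ O3 := Subring.subset_closure rfl

lemma mem_O3 {z : ℂ} : z ∈ O3 ↔ ∃ a b : ℤ, z = a + b * ρ3 := by
  constructor
  · intro h
    refine Subring.closure_induction (p := fun z _ => ∃ a b : ℤ, z = a + b * ρ3)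
      ?_ ?_ ?_ ?_ ?_ ?_ h
    · rintro x rfl; exact ⟨0, 1, by simp⟩
    · exact ⟨0, 0, by simp⟩
    · exact ⟨1, 0, by simp⟩
    · rintro x y _ _ ⟨a, b, rfl⟩ ⟨c, d, rfl⟩
      exact ⟨a + c, b + d, by push_cast; ring⟩
    · rintro x _ ⟨a, b, rfl⟩
      exact ⟨-a, -b, by push_cast; ring⟩
    · rintro x y _ _ ⟨a, b, rfl⟩ ⟨c, d, rfl⟩
      exact ⟨a * c - b * d, a * d + b * c - b * d, by
        push_cast; linear_combination (b * d : ℂ) * rho3_sq⟩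
  · rintro ⟨a, b, rfl⟩
    exact O3.add_mem (intCast_mem _ _) (O3.mul_mem (intCast_mem _ _) rho3_mem)

lemma rho3_coord_im (a b : ℝ) : ((a : ℂ) + b * ρ3).im = b * (Real.sqrt 3 / 2) := by
  simp [rho3_im]

lemma rho3_coord_inj {a b c d : ℝ} (h : (a : ℂ) + b * ρ3 = c + d * ρ3) : a = c ∧ b = d := by
  have h2 := congrArg Complex.im h
  rw [rho3_coord_im, rho3_coord_im] at h2
  have hb : b = d := mul_right_cancel₀ (by positivity) h2
  subst hb
  exact ⟨by exact_mod_cast add_right_cancel h, rfl⟩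

lemma int_coord_inj {a b c d : ℤ} (h : (a : ℂ) + b * ρ3 = c + d * ρ3) : a = c ∧ b = d := by
  have := rho3_coord_inj (a := a) (b := b) (c := c) (d := d) (by push_cast; exact h)
  exact_mod_cast this

lemma exists_rho3_coord (z : ℂ) : ∃ a b : ℝ, z = a + b * ρ3 := by
  refine ⟨z.re + z.im / Real.sqrt 3, 2 * z.im / Real.sqrt 3, ?_⟩
  have h3 : (Real.sqrt 3) ≠ 0 := by positivity
  apply Complex.ext
  · simp [rho3_re]; field_simp; ring
  · simp [rho3_im]; field_simp

lemma conj_mem_O3 {z : ℂ} (h : z ∈ O3) : (starRingEnd ℂ) z ∈ O3 := by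
  obtain ⟨a, b, rfl⟩ := mem_O3.1 h
  refine mem_O3.2 ⟨a - b, -b, ?_⟩
  simp [conj_rho3, rho3_sq]; ring

lemma rho3_mul_mem {z : ℂ} : ρ3 * z ∈ O3 ↔ z ∈ O3 := by
  refine ⟨fun h => ?_, fun h => O3.mul_mem rho3_mem h⟩
  have : z = ρ3 * (ρ3 * (ρ3 * z)) := by linear_combination -z * rho3_cube
  rw [this]
  exact O3.mul_mem rho3_mem (O3.mul_mem rho3_mem h)

lemma integrable_varpi : IntervalIntegrable (fun x : ℝ => (1 - x ^ 3) ^ (-(2:ℝ)/3))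
    MeasureTheory.volume 0 1 := by
  have h1 : IntervalIntegrable (fun x : ℝ => (1 - x) ^ (-(2:ℝ)/3)) MeasureTheory.volume 0 1 := by
    have := (intervalIntegral.intervalIntegrable_rpow' (a := 0) (b := 1)
      (r := -(2:ℝ)/3) (by norm_num)).comp_sub_left 1
    simpa using this.symm
  refine h1.mono_fun' ?_ ?_
  · apply Measurable.aestronglyMeasurable; fun_prop
  · rw [Filter.EventuallyLE, MeasureTheory.ae_restrict_iff' measurableSet_uIoc]
    have h1 : ∀ᵐ x : ℝ, x ≠ 1 := by
      simp [MeasureTheory.ae_iff, MeasureTheory.measure_singleton]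
    filter_upwards [h1] with x hx1 hx
    rw [Set.uIoc_of_le (by norm_num)] at hx
    have hx2 : x < 1 := lt_of_le_of_ne hx.2 hx1
    have h3 : 1 - x ≤ 1 - x ^ 3 := by
      nlinarith [mul_nonneg hx.1.le hx.1.le, hx.1, mul_nonneg hx.1.le (sub_nonneg.2 hx.2), mul_nonneg (mul_nonneg hx.1.le (sub_nonneg.2 hx.2)) hx.1.le]
    rw [Real.norm_of_nonneg (Real.rpow_nonneg (by linarith) _)]
    exact Real.rpow_le_rpow_of_nonpos (by linarith) h3 (by norm_num)

lemma varpi1_pos : 0 < varpi1 := by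
  rw [varpi1]
  apply intervalIntegral.intervalIntegral_pos_of_pos_on integrable_varpi _ (by norm_num)
  intro x hx
  apply Real.rpow_pos_of_pos
  have : x ^ 3 < 1 := pow_lt_one₀ hx.1.le hx.2 (by norm_num)
  linarith

lemma varpi1_ne : (varpi1 : ℂ) ≠ 0 := by exact_mod_cast varpi1_pos.ne'

/-- The period pair `(ϖ₁, ϖ₁ρ)`. -/
def LP : PeriodPair where
  ω₁ := varpi1
  ω₂ := varpi1 * ρ3
  indep := by
    rw [LinearIndependent.pair_iff]
    intro s t h
    simp only [real_smul] at h
    have h2 : (s : ℂ) + t * ρ3 = (0 : ℝ) + (0 : ℝ) * ρ3 := by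
      apply mul_left_cancel₀ varpi1_ne
      push_cast; linear_combination h
    exact rho3_coord_inj h2

lemma mem_LP {z : ℂ} : (varpi1 : ℂ) * z ∈ LP.lattice ↔ z ∈ O3 := by
  rw [PeriodPair.mem_lattice, mem_O3]
  simp only [LP]
  refine exists_congr fun m => exists_congr fun n => ?_
  rw [← (mul_right_injective₀ varpi1_ne).eq_iff (a := z)]
  constructor <;> intro h <;> linear_combination -h

lemma latticeEquiv_omega (m : ℤ × ℤ) : ((LP.latticeEquivProd.symm m : LP.lattice) : ℂ) = ω3 m := by
  rw [PeriodPair.latticeEquiv_symm_apply]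
  simp only [ω3, LP]; ring

lemma wp3_eq (u : ℂ) : wp3 u = LP.weierstrassP u := by
  have h := (LP.latticeEquivProd.symm.toEquiv.hasSum_iff).2 (LP.hasSum_weierstrassP u)
  have h2 : HasSum (fun m : ℤ × ℤ => 1 / (u - ω3 m) ^ 2 - 1 / (ω3 m) ^ 2) (LP.weierstrassP u) := by
    convert h using 2 with m
    simp only [Function.comp, LinearEquiv.coe_toEquiv, latticeEquiv_omega]
  have h3 := h2.update 0 0
  rw [wp3]
  have h4 : Function.update (fun m : ℤ × ℤ => 1 / (u - ω3 m) ^ 2 - 1 / (ω3 m) ^ 2) 0 0 =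
    fun m : ℤ × ℤ => if m = 0 then 0 else (((u - ω3 m) ^ 2)⁻¹ - ((ω3 m) ^ 2)⁻¹) := by
    funext m
    by_cases hm : m = 0
    · simp [hm]
    · simp [hm]
  rw [h4] at h3
  rw [h3.tsum_eq]
  simp [ω3]

lemma wp3'_eq (u : ℂ) : wp3' u = LP.derivWeierstrassP u := by
  rw [wp3', PeriodPair.derivWeierstrassP, ← LP.latticeEquivProd.symm.toEquiv.tsum_eq, ← tsum_neg]
  refine tsum_congr fun m => ?_
  simp only [LinearEquiv.coe_toEquiv, latticeEquiv_omega]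
  rw [div_eq_mul_inv]; ring

/-- `X(u) = ℘(ϖ₁u)`. -/
def EX (u : ℂ) : ℂ := LP.weierstrassP (varpi1 * u)

/-- `W(u) = ℘′(ϖ₁u)`. -/
def EW (u : ℂ) : ℂ := LP.derivWeierstrassP (varpi1 * u)

lemma phi3_eq (u : ℂ) : phi3 u = 6 * EX u / (9 + EW u) := by
  rw [phi3, wp3_eq, wp3'_eq]; rfl

lemma EX_add {l : ℂ} (hl : l ∈ O3) (u : ℂ) : EX (u + l) = EX u := by
  rw [EX, mul_add]
  exact LP.weierstrassP_add_coe _ ⟨_, mem_LP.2 hl⟩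

lemma EW_add {l : ℂ} (hl : l ∈ O3) (u : ℂ) : EW (u + l) = EW u := by
  rw [EW, mul_add]
  exact LP.derivWeierstrassP_add_coe _ ⟨_, mem_LP.2 hl⟩

lemma EX_neg (u : ℂ) : EX (-u) = EX u := by simp [EX]

lemma EW_neg (u : ℂ) : EW (-u) = -EW u := by simp [EW]

/-- Multiplication by `ρ` on the period lattice. -/
def rhoLattice : LP.lattice ≃ LP.lattice where
  toFun l := ⟨ρ3 * l, by
    obtain ⟨l, hl⟩ := l
    have : l = varpi1 * (l / varpi1) := by have h0 := varpi1_ne; field_simp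
    rw [this, mem_LP] at hl
    have : ρ3 * l = varpi1 * (ρ3 * (l / varpi1)) := by have h0 := varpi1_ne; field_simp
    simp only
    rw [this, mem_LP]
    exact rho3_mul_mem.2 hl⟩
  invFun l := ⟨ρ3 ^ 2 * l, by
    obtain ⟨l, hl⟩ := l
    have : l = varpi1 * (l / varpi1) := by have h0 := varpi1_ne; field_simp
    rw [this, mem_LP] at hl
    have : ρ3 ^ 2 * l = varpi1 * (ρ3 * (ρ3 * (l / varpi1))) := by have h0 := varpi1_ne; field_simp
    simp only
    rw [this, mem_LP]
    exact rho3_mul_mem.2 (rho3_mul_mem.2 hl)⟩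
  left_inv l := by
    ext; simp only; rw [← mul_assoc, ← pow_succ, rho3_cube, one_mul]
  right_inv l := by
    ext; simp only; rw [← mul_assoc, ← pow_succ', rho3_cube, one_mul]

lemma EX_rho (u : ℂ) : EX (ρ3 * u) = ρ3 * EX u := by
  rw [EX, EX, PeriodPair.weierstrassP, PeriodPair.weierstrassP, ← rhoLattice.tsum_eq, ← tsum_mul_left]
  refine tsum_congr fun l => ?_
  have h : (varpi1 * (ρ3 * u) - (rhoLattice l : ℂ)) = ρ3 * (varpi1 * u - l) := by
    simp only [rhoLattice, Equiv.coe_fn_mk]; ring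
  have h2 : (rhoLattice l : ℂ) = ρ3 * l := rfl
  have h3 : (ρ3 ^ 2)⁻¹ = ρ3 := by
    have h0 := rho3_ne_zero
    field_simp
    linear_combination -rho3_cube
  rw [h, h2, mul_pow, mul_pow, one_div, one_div, mul_inv, mul_inv, h3]
  ring

lemma EW_rho (u : ℂ) : EW (ρ3 * u) = EW u := by
  rw [EW, EW, PeriodPair.derivWeierstrassP, PeriodPair.derivWeierstrassP, ← rhoLattice.tsum_eq]
  congr 1
  refine tsum_congr fun l => ?_
  have h : (varpi1 * (ρ3 * u) - (rhoLattice l : ℂ)) = ρ3 * (varpi1 * u - l) := by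
    simp only [rhoLattice, Equiv.coe_fn_mk]; ring
  rw [h, mul_pow, rho3_cube, one_mul]

lemma LP_g₂ : LP.g₂ = 0 := by
  have : LP.G 4 = 0 := by
    have h : LP.G 4 = (ρ3 ^ 4)⁻¹ * LP.G 4 := by
      conv_lhs => rw [PeriodPair.G, ← rhoLattice.tsum_eq]
      rw [PeriodPair.G, ← tsum_mul_left]
      refine tsum_congr fun l => ?_
      have h2 : (rhoLattice l : ℂ) = ρ3 * l := rfl
      rw [h2, mul_pow, mul_inv]
    have h4 : ρ3 ^ 4 = ρ3 := by linear_combination ρ3 * rho3_cube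
    rw [h4] at h
    by_contra h0
    have : (ρ3)⁻¹ = 1 := by
      apply mul_right_cancel₀ h0; rw [← h, one_mul]
    exact rho3_ne_one (inv_eq_one.1 this)
  simp [PeriodPair.g₂, this]

lemma EW_sq {u : ℂ} (hu : u ∉ O3) : EW u ^ 2 = 4 * EX u ^ 3 - LP.g₃ := by
  have h := LP.derivWeierstrassP_sq (varpi1 * u) (by rwa [mem_LP])
  rw [LP_g₂, zero_mul, sub_zero] at h
  exact h

lemma isClosed_O3 : IsClosed (O3 : Set ℂ) := by
  have : (O3 : Set ℂ) = (fun u : ℂ => (varpi1 : ℂ) * u) ⁻¹' (LP.lattice : Set ℂ) := by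
    ext z; simp [mem_LP]
  rw [this]
  exact LP.isClosed_lattice.preimage (by fun_prop)

lemma isOpen_compl_O3 : IsOpen ((O3 : Set ℂ)ᶜ) := isClosed_O3.isOpen_compl

lemma countable_O3 : (O3 : Set ℂ).Countable := by
  have : (O3 : Set ℂ) ⊆ Set.range (fun m : ℤ × ℤ => (m.1 : ℂ) + m.2 * ρ3) := by
    intro z hz
    obtain ⟨a, b, rfl⟩ := mem_O3.1 hz
    exact ⟨(a, b), rfl⟩
  exact (Set.countable_range _).mono this

lemma hasDerivAt_EX {u : ℂ} (hu : u ∉ O3) : HasDerivAt EX (varpi1 * EW u) u := by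
  have h1 : HasDerivAt LP.weierstrassP (LP.derivWeierstrassP (varpi1 * u)) (varpi1 * u) := by
    rw [← LP.deriv_weierstrassP]
    apply DifferentiableAt.hasDerivAt
    exact (LP.differentiableOn_weierstrassP).differentiableAt
      (LP.isClosed_lattice.isOpen_compl.mem_nhds (by simpa [mem_LP] using hu))
  have h2 : HasDerivAt (fun u : ℂ => (varpi1 : ℂ) * u) varpi1 u := by
    simpa using (hasDerivAt_id u).const_mul (varpi1 : ℂ)
  have := h1.comp u h2
  rw [mul_comm]; exact this

lemma differentiableAt_EW {u : ℂ} (hu : u ∉ O3) : DifferentiableAt ℂ EW u := by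
  have h1 : DifferentiableAt ℂ LP.derivWeierstrassP (varpi1 * u) :=
    (LP.differentiableOn_derivWeierstrassP).differentiableAt
      (LP.isClosed_lattice.isOpen_compl.mem_nhds (by simpa [mem_LP] using hu))
  exact h1.comp u (by fun_prop)

/-- The regular part of `X` at `0`. -/
lemma exists_EX_expansion : ∃ h : ℂ → ℂ, AnalyticAt ℂ h 0 ∧ h 0 = 0 ∧
    ∀ u, EX u = h u + 1 / (varpi1 * u) ^ 2 := by
  refine ⟨fun u => LP.weierstrassPExcept 0 (varpi1 * u), ?_, by simp, ?_⟩
  · have h1 := LP.analyticAt_weierstrassPExcept 0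
    have h1' : AnalyticAt ℂ (LP.weierstrassPExcept 0) ((fun u : ℂ => (varpi1 : ℂ) * u) 0) := by
      simpa using h1
    exact AnalyticAt.comp h1' (by fun_prop)
  · intro u
    have := LP.weierstrassPExcept_add (0 : LP.lattice) (varpi1 * u)
    simp at this
    rw [EX, ← this]; simp

lemma dense_compl_of_countable {S : Set ℂ} (hS : S.Countable) : Dense Sᶜ :=
  hS.dense_compl ℝ

lemma countable_coset {c : ℂ} (hc : c ≠ 0) (b : ℂ) : {z : ℂ | c * (z - b) ∈ O3}.Countable := by
  have : Function.Injective (fun z : ℂ => c * (z - b)) := fun x y h =>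
    sub_left_injective (mul_left_cancel₀ hc h)
  exact countable_O3.preimage this

lemma isClosed_coset (c b : ℂ) : IsClosed {z : ℂ | c * (z - b) ∈ O3} :=
  isClosed_O3.preimage (f := fun z : ℂ => c * (z - b)) (by fun_prop)

lemma norm_ge_one_of_mem_O3 {z : ℂ} (hz : z ∈ O3) (h0 : z ≠ 0) : 1 ≤ ‖z‖ := by
  obtain ⟨a, b, rfl⟩ := mem_O3.1 hz
  have h1 : normSq ((a : ℂ) + b * ρ3) = ((a ^ 2 - a * b + b ^ 2 : ℤ) : ℝ) := by
    rw [normSq_apply]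
    simp [rho3_re, rho3_im]
    nlinarith [Real.sq_sqrt (show (0:ℝ) ≤ 3 by norm_num)]
  have h2 : 0 < normSq ((a : ℂ) + b * ρ3) := normSq_pos.2 h0
  rw [h1] at h2
  have h3 : (1 : ℤ) ≤ a ^ 2 - a * b + b ^ 2 := by
    have : 0 < a ^ 2 - a * b + b ^ 2 := by exact_mod_cast h2
    omega
  have h4 : (1 : ℝ) ≤ ‖(a : ℂ) + b * ρ3‖ ^ 2 := by
    rw [← normSq_eq_norm_sq, h1]; exact_mod_cast h3
  nlinarith [norm_nonneg ((a : ℂ) + b * ρ3)]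

/-- Near any point, the only possible element of a lattice coset is the point itself. -/
lemma eventually_notMem_coset {c : ℂ} (hc : c ≠ 0) (b z : ℂ) :
    ∀ᶠ w in nhdsWithin z {z}ᶜ, w ∉ {z : ℂ | c * (z - b) ∈ O3} := by
  by_cases hz : c * (z - b) ∈ O3
  · have : ∀ᶠ w in nhds z, ‖c * (w - z)‖ < 1 := by
      have hc : Continuous fun w => ‖c * (w - z)‖ := by fun_prop
      have := hc.tendsto z
      simp only [sub_self, mul_zero, norm_zero] at this
      exact this.eventually_lt_const one_pos
    filter_upwards [nhdsWithin_le_nhds this, self_mem_nhdsWithin] with w hw hne hmem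
    have h1 : c * (w - z) ∈ O3 := by
      have := O3.sub_mem hmem hz
      have e : c * (w - z) = c * (w - b) - c * (z - b) := by ring
      rw [e]; exact this
    have h2 := norm_ge_one_of_mem_O3 h1 (mul_ne_zero hc (sub_ne_zero.2 hne))
    linarith
  · exact nhdsWithin_le_nhds ((isClosed_coset c b).isOpen_compl.mem_nhds hz)

/-- Liouville's theorem for functions with at most simple removable singularities along a lattice
coset, whose absolute value is periodic. -/
theorem liouville_coset {c b : ℂ} (hc : c ≠ 0) (F : ℂ → ℂ)
    (hd : ∀ z, c * (z - b) ∉ O3 → DifferentiableAt ℂ F z)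
    (hper : ∀ z, c * (z - b) ∉ O3 → ∀ l ∈ O3, ‖F (z + l / c)‖ = ‖F z‖)
    (hlim : Filter.Tendsto (fun z => (z - b) * F z) (nhdsWithin b {b}ᶜ) (nhds 0)) :
    ∃ k, ∀ z, c * (z - b) ∉ O3 → F z = k := by
  set S : Set ℂ := {z : ℂ | c * (z - b) ∈ O3} with hS
  have hSd : Dense Sᶜ := dense_compl_of_countable (countable_coset hc b)
  have hbd : ∃ C, ∀ᶠ z in nhdsWithin b {b}ᶜ, ‖F z‖ ≤ C := by
    obtain ⟨U, hU, hUS⟩ := (Filter.eventually_iff_exists_mem.1 (eventually_notMem_coset hc b b))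
    obtain ⟨V, hV, hVU⟩ := mem_nhdsWithin_iff_exists_mem_nhds_inter.1 hU
    have hdV : DifferentiableOn ℂ F (V \ {b}) := fun z hz =>
      (hd z (hUS z (hVU ⟨hz.1, hz.2⟩))).differentiableWithinAt
    have ho : (fun z => F z - F b) =o[nhdsWithin b {b}ᶜ] fun z => (z - b)⁻¹ := by
      rw [Asymptotics.isLittleO_iff_tendsto']
      · have h2 : Filter.Tendsto (fun z => (z - b) * F z - (z - b) * F b)
            (nhdsWithin b {b}ᶜ) (nhds (0 - (b - b) * F b)) := by
          apply hlim.sub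
          apply (Continuous.tendsto (by fun_prop) b).mono_left nhdsWithin_le_nhds
        simp only [sub_self, zero_mul] at h2
        refine h2.congr fun z => ?_
        rw [div_inv_eq_mul]; ring
      · filter_upwards [self_mem_nhdsWithin] with z hz h0
        exact absurd (inv_eq_zero.1 h0) (sub_ne_zero.2 hz)
    have h3 := Complex.differentiableOn_update_limUnder_of_isLittleO hV hdV ho
    have h4 := (h3.differentiableAt hV).continuousAt.norm
    have h5 : ∀ᶠ z in nhds b, ‖Function.update F b ((nhdsWithin b {b}ᶜ).limUnder F) z‖ <
        ‖Function.update F b ((nhdsWithin b {b}ᶜ).limUnder F) b‖ + 1 :=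
      h4.eventually_lt_const (by simp)
    refine ⟨‖Function.update F b ((nhdsWithin b {b}ᶜ).limUnder F) b‖ + 1, ?_⟩
    filter_upwards [nhdsWithin_le_nhds h5, self_mem_nhdsWithin] with z hz hne
    rw [Function.update_of_ne hne] at hz
    exact hz.le
  obtain ⟨C, hC⟩ := hbd
  set G : ℂ → ℂ := fun z => (nhdsWithin z {z}ᶜ).limUnder F with hG
  have hGF : ∀ z ∉ S, G z = F z := fun z hz =>
    ((hd z hz).continuousAt.tendsto.mono_left nhdsWithin_le_nhds).limUnder_eq
  have hGd : Differentiable ℂ G := by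
    intro z
    have hev := eventually_notMem_coset hc b z
    by_cases hz : z ∈ S
    · have hbdz : ∀ᶠ w in nhdsWithin z {z}ᶜ, ‖F w‖ ≤ C := by
        have ht : Filter.Tendsto (fun w => w - (z - b)) (nhdsWithin z {z}ᶜ) (nhdsWithin b {b}ᶜ) := by
          apply tendsto_nhdsWithin_iff.2 ⟨?_, ?_⟩
          · have : Filter.Tendsto (fun w => w - (z - b)) (nhds z) (nhds (z - (z - b))) :=
              Continuous.tendsto (by fun_prop) z
            rw [sub_sub_cancel] at this
            exact this.mono_left nhdsWithin_le_nhds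
          · filter_upwards [self_mem_nhdsWithin] with w hw h0
            apply hw
            have h0' : w - (z - b) = b := h0
            show w = z
            linear_combination h0'
        filter_upwards [ht.eventually hC, hev] with w hw hwS
        have h6 : w - (z - b) ∉ S := fun h => hwS (by
          have := O3.add_mem h hz
          show c * (w - b) ∈ O3
          have e : c * (w - b) = c * (w - (z - b) - b) + c * (z - b) := by ring
          rw [e]; exact this)
        have := hper _ h6 _ hz
        rw [← this] at hw
        have e : w - (z - b) + c * (z - b) / c = w := by field_simp; ring
        rwa [e] at hw
      obtain ⟨U, hU, hUS⟩ := Filter.eventually_iff_exists_mem.1 (hev.and hbdz)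
      obtain ⟨V, hV, hVU⟩ := mem_nhdsWithin_iff_exists_mem_nhds_inter.1 hU
      have hdV : DifferentiableOn ℂ F (V \ {z}) := fun w hw =>
        (hd w (hUS w (hVU ⟨hw.1, hw.2⟩)).1).differentiableWithinAt
      have hb : BddAbove (norm ∘ F '' (V \ {z})) := by
        refine ⟨C, ?_⟩
        rintro _ ⟨w, hw, rfl⟩
        exact (hUS w (hVU ⟨hw.1, hw.2⟩)).2
      have h3 := (Complex.differentiableOn_update_limUnder_of_bddAbove hV hdV hb).differentiableAt hV
      refine h3.congr_of_eventuallyEq ?_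
      filter_upwards [hV] with w hw
      by_cases hwz : w = z
      · subst hwz; simp [hG]
      · rw [Function.update_of_ne hwz]
        exact hGF w (hUS w (hVU ⟨hw, hwz⟩)).1
    · refine (hd z hz).congr_of_eventuallyEq ?_
      filter_upwards [(isClosed_coset c b).isOpen_compl.mem_nhds hz] with w hw
      exact hGF w hw
  have hGper : ∀ l ∈ O3, ∀ z, ‖G (z + l / c)‖ = ‖G z‖ := by
    intro l hl
    have h1 : Continuous fun z => ‖G (z + l / c)‖ := by
      have := hGd.continuous; fun_prop
    have h2 : Continuous fun z => ‖G z‖ := hGd.continuous.norm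
    have := Continuous.ext_on hSd h1 h2 (fun z hz => by
      have h6 : z + l / c ∉ S := fun h => hz (by
        have := O3.sub_mem h hl
        show c * (z - b) ∈ O3
        have e : c * (z - b) = c * (z + l / c - b) - l := by field_simp; ring
        rw [e]; exact this)

      rw [hGF z hz, hGF _ h6, hper z hz l hl])
    exact fun z => congrFun this z
  have hcomp := IsZLattice.isCompact_range_of_periodic LP.lattice
    (fun w : ℂ => ‖G (w / (varpi1 * c))‖) (by
      have := hGd.continuous; fun_prop) (by
      intro z w hw
      have h0 := varpi1_ne
      have e : w = varpi1 * (w / varpi1) := by field_simp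
      rw [e, mem_LP] at hw
      have e2 : (z + w) / (varpi1 * c) = z / (varpi1 * c) + (w / varpi1) / c := by field_simp
      show ‖G ((z + w) / (varpi1 * c))‖ = ‖G (z / (varpi1 * c))‖
      rw [e2]
      exact hGper _ hw _)
  have hbound : Bornology.IsBounded (Set.range G) := by
    obtain ⟨M, hM⟩ := hcomp.bddAbove
    refine isBounded_iff_forall_norm_le.2 ⟨M, ?_⟩
    rintro _ ⟨z, rfl⟩
    have h0 := varpi1_ne
    have e2 : z * (varpi1 * c) / (varpi1 * c) = z := by field_simp
    refine hM ⟨z * (varpi1 * c), ?_⟩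
    show ‖G (z * (varpi1 * c) / (varpi1 * c))‖ = ‖G z‖
    rw [e2]
  refine ⟨G 0, fun z hz => ?_⟩
  rw [← hGF z hz]
  exact hGd.apply_eq_apply_of_bounded hbound z 0

lemma isPreconnected_compl_of_countable {S : Set ℂ} (hS : S.Countable) : IsPreconnected Sᶜ :=
  (hS.isConnected_compl_of_one_lt_rank (by simp [Complex.rank_real_complex])).isPreconnected

/-- Identity theorem outside a closed countable set. -/
lemma identity_off_countable {S : Set ℂ} (hS : S.Countable) (hc : IsClosed S) {F : ℂ → ℂ}
    (hF : ∀ z ∉ S, DifferentiableAt ℂ F z) {b : ℂ}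
    (hb : ∀ᶠ z in nhdsWithin b {b}ᶜ, F z = 0) : ∀ z ∉ S, F z = 0 := by
  have hd : DifferentiableOn ℂ F Sᶜ := fun z hz => (hF z hz).differentiableWithinAt
  have ha := hd.analyticOnNhd hc.isOpen_compl
  obtain ⟨U, hU, hUS⟩ := Filter.eventually_iff_exists_mem.1 hb
  obtain ⟨V, hV, hbV, hVU⟩ := mem_nhdsWithin.1 hU
  have hne : (V \ {b}).Nonempty := by
    have h1 : Dense ({b}ᶜ : Set ℂ) := dense_compl_of_countable (Set.countable_singleton b)
    exact h1.inter_open_nonempty V hV ⟨b, hbV⟩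
  have hVo : IsOpen (V \ {b}) := hV.sdiff isClosed_singleton
  obtain ⟨z0, hz0, hz0S⟩ := (dense_compl_of_countable hS).inter_open_nonempty _ hVo hne
  exact ha.eqOn_zero_of_preconnected_of_eventuallyEq_zero (isPreconnected_compl_of_countable hS)
    hz0S (Filter.eventually_iff_exists_mem.2 ⟨_, hVo.mem_nhds hz0, fun y hy => hUS y (hVU hy)⟩)

lemma tendsto_sq_mul_EX :
    Filter.Tendsto (fun u => u ^ 2 * EX u) (nhdsWithin 0 {0}ᶜ) (nhds (1 / (varpi1 : ℂ) ^ 2)) := by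
  obtain ⟨h, ha, h0, hh⟩ := exists_EX_expansion
  have h1 : Filter.Tendsto (fun u : ℂ => u ^ 2 * h u + 1 / (varpi1 : ℂ) ^ 2) (nhds 0)
      (nhds (0 ^ 2 * h 0 + 1 / (varpi1 : ℂ) ^ 2)) := by
    have := ha.continuousAt
    have h2 : ContinuousAt (fun u : ℂ => u ^ 2 * h u + 1 / (varpi1 : ℂ) ^ 2) 0 := by fun_prop
    exact h2.tendsto
  rw [zero_pow two_ne_zero, zero_mul, zero_add] at h1
  refine (h1.mono_left nhdsWithin_le_nhds).congr' ?_
  filter_upwards [self_mem_nhdsWithin] with u hu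
  have hu' : u ≠ 0 := hu
  have := varpi1_ne
  rw [hh]; field_simp

lemma tendsto_inv_EX : Filter.Tendsto (fun u => (EX u)⁻¹) (nhdsWithin 0 {0}ᶜ) (nhds 0) := by
  have h1 := tendsto_sq_mul_EX.inv₀ (one_div_ne_zero (pow_ne_zero 2 varpi1_ne))
  have h2 : Filter.Tendsto (fun u : ℂ => u ^ 2) (nhdsWithin 0 {0}ᶜ) (nhds 0) := by
    have : Filter.Tendsto (fun u : ℂ => u ^ 2) (nhds 0) (nhds (0 ^ 2)) :=
      Continuous.tendsto (by fun_prop) 0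
    rw [zero_pow two_ne_zero] at this
    exact this.mono_left nhdsWithin_le_nhds
  have h3 := h2.mul h1
  rw [zero_mul] at h3
  refine h3.congr' ?_
  filter_upwards [self_mem_nhdsWithin] with u hu
  have hu' : u ≠ 0 := hu
  field_simp

lemma eventually_norm_EX_gt (M : ℝ) : ∀ᶠ u in nhdsWithin 0 {0}ᶜ, M < ‖EX u‖ := by
  have h1 : ∀ᶠ u in nhdsWithin (0:ℂ) {0}ᶜ, EX u ≠ 0 := by
    have := (tendsto_sq_mul_EX.eventually_ne (one_div_ne_zero (pow_ne_zero 2 varpi1_ne))).mono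
      (fun u hu => right_ne_zero_of_mul hu)
    exact this
  have h2 : ∀ᶠ u in nhdsWithin (0:ℂ) {0}ᶜ, ‖(EX u)⁻¹‖ < (|M| + 1)⁻¹ := by
    have := tendsto_inv_EX.norm
    rw [norm_zero] at this
    exact this.eventually_lt_const (by positivity)
  filter_upwards [h1, h2] with u hu hu2
  rw [norm_inv, inv_lt_inv₀ (by positivity) (by positivity)] at hu2
  linarith [le_abs_self M]

lemma eventually_EX_ne (x : ℂ) : ∀ᶠ u in nhdsWithin 0 {0}ᶜ, EX u ≠ x := by
  filter_upwards [eventually_norm_EX_gt ‖x‖] with u hu h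
  rw [h] at hu; exact lt_irrefl _ hu

lemma eventually_notMem_O3 (z : ℂ) : ∀ᶠ w in nhdsWithin z {z}ᶜ, w ∉ O3 := by
  simpa using eventually_notMem_coset one_ne_zero 0 z

lemma eventually_EW_ne_zero : ∀ᶠ u in nhdsWithin 0 {0}ᶜ, EW u ≠ 0 := by
  filter_upwards [eventually_norm_EX_gt (1 + ‖LP.g₃‖), eventually_notMem_O3 0] with u hu hu2 h
  have h1 := EW_sq hu2
  rw [h] at h1
  have h2 : LP.g₃ = 4 * EX u ^ 3 := by linear_combination h1
  have h3 : ‖LP.g₃‖ = 4 * ‖EX u‖ ^ 3 := by rw [h2]; simp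
  have h5 : 1 < ‖EX u‖ := by linarith [norm_nonneg LP.g₃]
  have h6 : ‖EX u‖ ≤ ‖EX u‖ ^ 3 := le_self_pow₀ h5.le (by norm_num)
  linarith

lemma hasDerivAt_EW {u : ℂ} (hu : u ∉ O3) : HasDerivAt EW (6 * varpi1 * EX u ^ 2) u := by
  have hEW : DifferentiableOn ℂ EW (O3 : Set ℂ)ᶜ := fun z hz =>
    (differentiableAt_EW hz).differentiableWithinAt
  have h1 : ∀ z ∉ O3, EW z * (deriv EW z - 6 * varpi1 * EX z ^ 2) = 0 := by
    intro z hz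
    have e1 : HasDerivAt (fun z => EW z ^ 2) (2 * EW z * deriv EW z) z :=
      ((differentiableAt_EW hz).hasDerivAt.pow 2).congr_deriv (by norm_num)
    have e2 : HasDerivAt (fun z => 4 * EX z ^ 3 - LP.g₃) (4 * (3 * EX z ^ 2 * (varpi1 * EW z))) z :=
      ((((hasDerivAt_EX hz).pow 3).const_mul 4).sub_const LP.g₃).congr_deriv (by norm_num)
    have e3 : (fun z => EW z ^ 2) =ᶠ[nhds z] fun z => 4 * EX z ^ 3 - LP.g₃ := by
      filter_upwards [isOpen_compl_O3.mem_nhds hz] with w hw using EW_sq hw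
    have e4 := e1.unique (e2.congr_of_eventuallyEq e3)
    linear_combination e4 / 2
  have h2 := identity_off_countable (S := O3) countable_O3 isClosed_O3
    (F := fun z => deriv EW z - 6 * varpi1 * EX z ^ 2) (b := 0) (fun z hz => by
      have d1 := (hEW.deriv isOpen_compl_O3).differentiableAt (isOpen_compl_O3.mem_nhds hz)
      have d2 := (hasDerivAt_EX hz).differentiableAt
      fun_prop) (by
      filter_upwards [eventually_EW_ne_zero, eventually_notMem_O3 0] with z hz hz2
      exact (mul_eq_zero.1 (h1 z hz2)).resolve_left hz) u hu
  have := (differentiableAt_EW hu).hasDerivAt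
  rwa [sub_eq_zero.1 h2] at this

/-- The addition theorem for `℘`, without denominators. -/
theorem EX_add_formula {u v : ℂ} (hu : u ∉ O3) (hv : v ∉ O3) (huv : u + v ∉ O3) :
    2 * EX (u + v) * (EX u - EX v) ^ 2 =
      2 * EX u ^ 2 * EX v + 2 * EX u * EX v ^ 2 - LP.g₃ - EW u * EW v := by
  set s := u + v with hs
  set A : ℂ → ℂ := fun z => EX z - EX (s - z) with hA
  set N : ℂ → ℂ := fun z => 2 * EX z ^ 2 * EX (s - z) + 2 * EX z * EX (s - z) ^ 2 - LP.g₃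
    - EW z * EW (s - z) with hN
  set S : Set ℂ := (O3 : Set ℂ) ∪ {z | s - z ∈ O3} with hS
  have hSc : S.Countable := countable_O3.union (countable_O3.preimage (sub_right_injective (b := s)))
  have hScl : IsClosed S := isClosed_O3.union (isClosed_O3.preimage (f := fun z : ℂ => s - z) (by fun_prop))
  have dX : ∀ z ∉ S, HasDerivAt (fun z => EX (s - z)) (-(varpi1 * EW (s - z))) z := by
    intro z hz
    have h1 : s - z ∉ O3 := fun h => hz (Or.inr h)
    simpa using (hasDerivAt_EX h1).comp_const_sub s z
  have dW : ∀ z ∉ S, HasDerivAt (fun z => EW (s - z)) (-(6 * varpi1 * EX (s - z) ^ 2)) z := by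
    intro z hz
    have h1 : s - z ∉ O3 := fun h => hz (Or.inr h)
    simpa using (hasDerivAt_EW h1).comp_const_sub s z
  have dA : ∀ z ∉ S, HasDerivAt A (varpi1 * (EW z + EW (s - z))) z := by
    intro z hz
    have h1 : z ∉ O3 := fun h => hz (Or.inl h)
    exact ((hasDerivAt_EX h1).sub (dX z hz)).congr_deriv (by ring)
  have dN : ∀ z ∉ S, ∃ N', HasDerivAt N N' z ∧ N' * A z = 2 * N z * (varpi1 * (EW z + EW (s - z))) := by
    intro z hz
    have h1 : z ∉ O3 := fun h => hz (Or.inl h)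
    have h2 : s - z ∉ O3 := fun h => hz (Or.inr h)
    have e1 := ((((hasDerivAt_EX h1).pow 2).const_mul 2).mul (dX z hz)).add
      (((hasDerivAt_EX h1).const_mul 2).mul ((dX z hz).pow 2))
    have e2 := (e1.sub_const LP.g₃).sub ((hasDerivAt_EW h1).mul (dW z hz))
    refine ⟨_, e2, ?_⟩
    have q1 := EW_sq h1
    have q2 := EW_sq h2
    simp only [hA, hN, Pi.pow_apply, Nat.cast_ofNat]
    generalize EX z = x at *
    generalize EX (s - z) = y at *
    generalize EW z = w at *
    generalize EW (s - z) = t at *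
    norm_num
    linear_combination (2 * varpi1 * t) * q1 + (2 * varpi1 * w) * q2
  have hs0 : Filter.Tendsto (fun z => s - z) (nhdsWithin 0 {0}ᶜ) (nhds s) := by
    have : Filter.Tendsto (fun z => s - z) (nhds 0) (nhds (s - 0)) :=
      Continuous.tendsto (by fun_prop) 0
    rw [sub_zero] at this
    exact this.mono_left nhdsWithin_le_nhds
  have hX2 : Filter.Tendsto (fun z => EX (s - z)) (nhdsWithin 0 {0}ᶜ) (nhds (EX s)) :=
    (hasDerivAt_EX huv).continuousAt.tendsto.comp hs0
  have hW2 : Filter.Tendsto (fun z => EW (s - z)) (nhdsWithin 0 {0}ᶜ) (nhds (EW s)) :=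
    (hasDerivAt_EW huv).continuousAt.tendsto.comp hs0
  have hAne : ∀ᶠ z in nhdsWithin 0 {0}ᶜ, A z ≠ 0 := by
    have h1 : ∀ᶠ z in nhdsWithin 0 {0}ᶜ, ‖EX (s - z)‖ < ‖EX s‖ + 1 :=
      hX2.norm.eventually_lt_const (by simp)
    filter_upwards [h1, eventually_norm_EX_gt (‖EX s‖ + 1)] with z hz hz2 h
    rw [sub_eq_zero] at h
    rw [h] at hz2
    linarith
  have hSev : ∀ᶠ z in nhdsWithin 0 {0}ᶜ, z ∉ S := by
    have h1 : ∀ᶠ z in nhdsWithin 0 {0}ᶜ, s - z ∉ O3 :=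
      hs0.eventually (isOpen_compl_O3.mem_nhds huv)
    filter_upwards [eventually_notMem_O3 0, h1] with z hz hz2 h
    exact h.elim hz hz2
  have hlim : Filter.Tendsto (fun z => N z / A z ^ 2) (nhdsWithin 0 {0}ᶜ) (nhds (2 * EX s)) := by
    have hi := tendsto_inv_EX
    have hwx : Filter.Tendsto (fun z => EW z / EX z ^ 2) (nhdsWithin 0 {0}ᶜ) (nhds 0) := by
      rw [tendsto_zero_iff_norm_tendsto_zero]
      have h1 : Filter.Tendsto (fun z => ‖4 * (EX z)⁻¹ - LP.g₃ * (EX z)⁻¹ ^ 4‖)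
          (nhdsWithin 0 {0}ᶜ) (nhds ‖4 * (0:ℂ) - LP.g₃ * 0 ^ 4‖) :=
        ((hi.const_mul 4).sub ((hi.pow 4).const_mul _)).norm
      have h2 := h1.sqrt
      simp only [mul_zero, zero_pow (four_ne_zero), sub_zero, norm_zero, Real.sqrt_zero] at h2
      refine h2.congr' ?_
      filter_upwards [eventually_EX_ne 0, eventually_notMem_O3 0] with z hz hz2
      rw [show 4 * (EX z)⁻¹ - LP.g₃ * (EX z)⁻¹ ^ 4 = (EW z / EX z ^ 2) ^ 2 by
        rw [div_pow, EW_sq hz2]; field_simp]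
      rw [norm_pow, Real.sqrt_sq (norm_nonneg _)]
    have hn : Filter.Tendsto (fun z => 2 * EX (s - z) + 2 * EX (s - z) ^ 2 * (EX z)⁻¹
        - LP.g₃ * (EX z)⁻¹ ^ 2 - EW z / EX z ^ 2 * EW (s - z)) (nhdsWithin 0 {0}ᶜ)
        (nhds (2 * EX s + 2 * EX s ^ 2 * 0 - LP.g₃ * 0 ^ 2 - 0 * EW s)) :=
      (((hX2.const_mul 2).add (((hX2.pow 2).const_mul 2).mul hi)).sub
        ((hi.pow 2).const_mul _)).sub (hwx.mul hW2)
    have hd : Filter.Tendsto (fun z => (1 - EX (s - z) * (EX z)⁻¹) ^ 2) (nhdsWithin 0 {0}ᶜ)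
        (nhds ((1 - EX s * 0) ^ 2)) := ((hX2.mul hi).const_sub 1).pow 2
    have hq := hn.div hd (by simp)
    have e : (2 * EX s + 2 * EX s ^ 2 * 0 - LP.g₃ * 0 ^ 2 - 0 * EW s) / (1 - EX s * 0) ^ 2
        = 2 * EX s := by simp
    rw [e] at hq
    refine hq.congr' ?_
    filter_upwards [eventually_EX_ne 0, hAne] with z hz hz2
    have h3 : (1 - EX (s - z) * (EX z)⁻¹) = A z / EX z := by
      simp only [hA]; field_simp
    rw [Pi.div_apply, h3, div_pow, div_div_eq_mul_div]
    congr 1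
    simp only [hN]; field_simp
  have hconst : ∀ᶠ z in nhdsWithin 0 {0}ᶜ, N z - 2 * EX s * A z ^ 2 = 0 := by
    obtain ⟨U, hU, hUS⟩ := Filter.eventually_iff_exists_mem.1 (hAne.and hSev)
    obtain ⟨V, hV, h0V, hVU⟩ := mem_nhdsWithin.1 hU
    have hne : (V \ {0}).Nonempty := by
      have h1 : Dense ({0}ᶜ : Set ℂ) := dense_compl_of_countable (Set.countable_singleton 0)
      exact h1.inter_open_nonempty V hV ⟨0, h0V⟩
    have hder : ∀ z ∈ V \ {0}, HasDerivAt (fun z => N z / A z ^ 2) 0 z := by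
      intro z hz
      obtain ⟨hz1, hz2⟩ := hUS z (hVU hz)
      obtain ⟨N', hN', hNA⟩ := dN z hz2
      refine (hN'.div ((dA z hz2).pow 2) (pow_ne_zero 2 hz1)).congr_deriv ?_
      rw [div_eq_zero_iff]; left
      norm_num
      linear_combination A z * hNA
    obtain ⟨z0, hz0⟩ := hne
    obtain ⟨r, hr, hrV⟩ := Metric.isOpen_iff.1 (hV.sdiff isClosed_singleton) z0 hz0
    have hloc : ∀ z ∈ Metric.ball z0 r, N z / A z ^ 2 = N z0 / A z0 ^ 2 := fun z hz =>
      Metric.isOpen_ball.is_const_of_deriv_eq_zero (convex_ball z0 r).isPreconnected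
        (fun w hw => (hder w (hrV hw)).differentiableAt.differentiableWithinAt)
        (fun w hw => (hder w (hrV hw)).deriv) hz (Metric.mem_ball_self hr)
    have hglob := identity_off_countable hSc hScl
      (F := fun z => N z - N z0 / A z0 ^ 2 * A z ^ 2) (b := z0)
      (fun z hz => by
        obtain ⟨N', hN', -⟩ := dN z hz
        have d1 := hN'.differentiableAt
        have d2 := (dA z hz).differentiableAt
        fun_prop) (by
        filter_upwards [nhdsWithin_le_nhds (Metric.ball_mem_nhds z0 hr)] with z hz
        have h1 := (hUS z (hVU (hrV hz))).1
        rw [← hloc z hz]; field_simp; ring)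
    have hk : N z0 / A z0 ^ 2 = 2 * EX s := by
      refine tendsto_nhds_unique (tendsto_const_nhds.congr' ?_) hlim
      filter_upwards [hAne, hSev] with z hz hz2
      rw [sub_eq_zero.1 (hglob z hz2)]; field_simp
    filter_upwards [hSev] with z hz
    rw [← hk]; exact hglob z hz
  have := identity_off_countable hSc hScl (F := fun z => N z - 2 * EX s * A z ^ 2) (b := 0)
    (fun z hz => by
      obtain ⟨N', hN', -⟩ := dN z hz
      have d1 := hN'.differentiableAt
      have d2 := (dA z hz).differentiableAt
      fun_prop) hconst u (by
        rintro (h | h)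
        · exact hu h
        · apply hv; simpa [hs] using h)
  simp only [hN, hA, hs, add_sub_cancel_left] at this
  rw [hs]
  linear_combination -this

lemma notMem_O3_of_norm_lt {z : ℂ} (h0 : z ≠ 0) (h : ‖z‖ < 1) : z ∉ O3 := fun hz =>
  absurd (norm_ge_one_of_mem_O3 hz h0) (not_le.2 h)

lemma sqrtm3_mem : sqrtm3 ∈ O3 := by
  rw [sqrtm3_eq]; exact O3.sub_mem rho3_mem (O3.pow_mem rho3_mem 2)

lemma rho3_sq_mul_mem {z : ℂ} : ρ3 ^ 2 * z ∈ O3 ↔ z ∈ O3 := by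
  rw [pow_two, mul_assoc, rho3_mul_mem, rho3_mul_mem]

lemma EX_rho_sq (u : ℂ) : EX (ρ3 ^ 2 * u) = ρ3 ^ 2 * EX u := by
  rw [pow_two, mul_assoc, EX_rho, EX_rho, mul_assoc]

lemma EW_rho_sq (u : ℂ) : EW (ρ3 ^ 2 * u) = EW u := by
  rw [pow_two, mul_assoc, EW_rho, EW_rho]

/-- Multiplication by `√−3`. -/
lemma EX_sqrtm3 {u : ℂ} (hu : u ∉ O3) (h : sqrtm3 * u ∉ O3) :
    3 * EX u ^ 2 * EX (sqrtm3 * u) = LP.g₃ - EX u ^ 3 := by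
  have h1 : ρ3 * u ∉ O3 := fun h => hu (rho3_mul_mem.1 h)
  have h2 : -(ρ3 ^ 2 * u) ∉ O3 := fun h => hu (rho3_sq_mul_mem.1 (neg_mem_iff.1 h))
  have e : ρ3 * u + -(ρ3 ^ 2 * u) = sqrtm3 * u := by rw [sqrtm3_eq]; ring
  have := EX_add_formula h1 h2 (by rwa [e])
  rw [e, EX_neg, EW_neg, EX_rho, EX_rho_sq, EW_rho, EW_rho_sq] at this
  have e1 : (ρ3 * EX u - ρ3 ^ 2 * EX u) ^ 2 = -3 * EX u ^ 2 := by
    rw [← sub_mul, ← sqrtm3_eq, mul_pow, sqrtm3_sq]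
  have e4 : ρ3 ^ 4 = ρ3 := by linear_combination ρ3 * rho3_cube
  have e5 : ρ3 ^ 5 = ρ3 ^ 2 := by linear_combination ρ3 ^ 2 * rho3_cube
  rw [e1] at this
  linear_combination (-1/2 : ℂ) * this - (1/2 : ℂ) * EW_sq hu - EX u ^ 3 * (e4 + e5 + rho3_sum)

/-- The chord relation for the second coordinate. -/
lemma EW_add_chord {u v : ℂ} (hu : u ∉ O3) (hv : v ∉ O3) (huv : u + v ∉ O3) :
    (EX u - EX v) * (EW (u + v) + EW u) + (EW u - EW v) * (EX (u + v) - EX u) = 0 := by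
  have f0 := EX_add_formula hu hv huv
  have f1 := EX_add_formula (u := u + v) (v := -u) huv (by simpa using hu) (by simpa using hv)
  have f2 := EX_add_formula (u := u + v) (v := -v) huv (by simpa using hv) (by simpa using hu)
  rw [show u + v + -u = v by ring, EX_neg, EW_neg] at f1
  rw [show u + v + -v = u by ring, EX_neg, EW_neg] at f2
  have q1 := EW_sq hu
  have q2 := EW_sq hv
  have q3 := EW_sq huv
  generalize EX (u + v) = z at *
  generalize EX u = x at *
  generalize EX v = y at *
  generalize EW (u + v) = r at *
  generalize EW u = s at *
  generalize EW v = t at *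
  generalize LP.g₃ = g at *
  by_cases hxy : x = y
  · subst hxy
    have : (s - t) * (s + t) = 0 := by linear_combination q1 - q2
    rcases mul_eq_zero.1 this with h | h
    · rw [h]; ring
    · have ht : t = -s := by linear_combination h
      subst ht
      have hs : s ^ 2 = 0 := by linear_combination (-1/2 : ℂ) * f0 + (1/2 : ℂ) * q1
      rw [pow_eq_zero_iff two_ne_zero] at hs
      rw [hs]; ring
  have hd : x - y ≠ 0 := sub_ne_zero.2 hxy
  have hs : s * ((x - y) * (r + s) + (s - t) * (z - x)) = 0 := by
    linear_combination (-(x - y)) * f1 + (x - y + z - x) * q1 - (z - x) * f0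
  have ht : t * ((x - y) * (r + s) + (s - t) * (z - x)) = 0 := by
    linear_combination (-(x - y)) * f2 + (x - y + z - x) * f0 - (z - x) * q2
  rcases mul_eq_zero.1 hs with hs0 | hs
  swap
  · exact hs
  rcases mul_eq_zero.1 ht with ht0 | ht
  swap
  · exact ht
  clear hs ht
  subst hs0 ht0
  have hc : (x - y) * (x ^ 2 + x * y + y ^ 2) = 0 := by linear_combination (q2 - q1) / 4
  have hc := (mul_eq_zero.1 hc).resolve_left hd
  have hy0 : y ≠ 0 := by
    rintro rfl
    have : x ^ 2 = 0 := by linear_combination hc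
    rw [pow_eq_zero_iff two_ne_zero] at this
    exact hxy this
  have hx0 : x ≠ 0 := by
    rintro rfl
    have : y ^ 2 = 0 := by linear_combination hc
    rw [pow_eq_zero_iff two_ne_zero] at this
    exact hy0 this
  have hz : (x * y) * (z + x + y) = 0 := by
    linear_combination (-1/6 : ℂ) * f0 + (1/6 : ℂ) * q1 + (1/3 * z + 2/3 * x) * hc
  have hz := (mul_eq_zero.1 hz).resolve_left (mul_ne_zero hx0 hy0)
  have hz : z = -x - y := by linear_combination hz
  have hr : r ^ 2 = 0 := by
    rw [hz] at q3
    linear_combination q3 - q1 + (-8 * x - 4 * y) * hc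
  rw [pow_eq_zero_iff two_ne_zero] at hr
  rw [hr]; ring

lemma LP_g₃_ne_zero : LP.g₃ ≠ 0 := by
  intro hg
  set S : Set ℂ := (O3 : Set ℂ) ∪ {z | sqrtm3 * (z - 0) ∈ O3} with hS
  have hSc : S.Countable := countable_O3.union (countable_coset sqrtm3_ne_zero 0)
  have hScl : IsClosed S := isClosed_O3.union (isClosed_coset sqrtm3 0)
  have hmem : ∀ z ∉ S, z ∉ O3 ∧ sqrtm3 * z ∉ O3 := fun z hz =>
    ⟨fun h => hz (Or.inl h), fun h => hz (Or.inr (by simpa using h))⟩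
  have hev : ∀ b, ∀ᶠ z in nhdsWithin b {b}ᶜ, z ∉ S := fun b => by
    filter_upwards [eventually_notMem_O3 b, eventually_notMem_coset sqrtm3_ne_zero 0 b] with z h1 h2 h
    exact h.elim h1 h2
  have hid := identity_off_countable hSc hScl (F := fun z => 3 * EX (sqrtm3 * z) + EX z) (b := 0)
    (fun z hz => by
      have d1 := (hasDerivAt_EX (hmem z hz).1).differentiableAt
      have d2 : DifferentiableAt ℂ (fun z => EX (sqrtm3 * z)) z :=
        (hasDerivAt_EX (hmem z hz).2).differentiableAt.fun_comp' z (by fun_prop)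
      fun_prop) (by
      filter_upwards [hev 0, eventually_EX_ne 0] with z hz hz2
      have h1 := EX_sqrtm3 (hmem z hz).1 (hmem z hz).2
      rw [hg] at h1
      have : EX z ^ 2 * (3 * EX (sqrtm3 * z) + EX z) = 0 := by linear_combination h1
      exact (mul_eq_zero.1 this).resolve_left (pow_ne_zero 2 hz2))
  set b : ℂ := 1 / sqrtm3 with hb
  have hs : ‖sqrtm3‖ ^ 2 = 3 := by rw [← norm_pow, sqrtm3_sq]; simp
  have hbO : b ∉ O3 := by
    apply notMem_O3_of_norm_lt (one_div_ne_zero sqrtm3_ne_zero)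
    rw [norm_div, norm_one, div_lt_one (norm_pos_iff.2 sqrtm3_ne_zero)]
    nlinarith [norm_nonneg sqrtm3]
  have ht : Filter.Tendsto (fun z => sqrtm3 * z - 1) (nhdsWithin b {b}ᶜ) (nhdsWithin 0 {0}ᶜ) := by
    apply tendsto_nhdsWithin_iff.2 ⟨?_, ?_⟩
    · have : Filter.Tendsto (fun z => sqrtm3 * z - 1) (nhds b) (nhds (sqrtm3 * b - 1)) :=
        Continuous.tendsto (by fun_prop) b
      rw [hb, mul_one_div_cancel sqrtm3_ne_zero, sub_self] at this
      exact this.mono_left nhdsWithin_le_nhds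
    · filter_upwards [self_mem_nhdsWithin] with z hz h
      have h' : sqrtm3 * z - 1 = 0 := h
      apply hz
      show z = b
      rw [hb, eq_div_iff sqrtm3_ne_zero]; linear_combination h'
  have hc : ∀ᶠ z in nhdsWithin b {b}ᶜ, ‖EX z‖ < ‖EX b‖ + 1 :=
    nhdsWithin_le_nhds ((hasDerivAt_EX hbO).continuousAt.norm.eventually_lt_const (by simp))
  have hl := ht.eventually (eventually_norm_EX_gt (‖EX b‖ + 1))
  obtain ⟨z, hz1, hz2, hz3⟩ := ((hev b).and (hc.and hl)).exists
  have h1 := hid z hz1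
  have h2 : EX (sqrtm3 * z - 1) = EX (sqrtm3 * z) := by
    have := EX_add (l := -1) (O3.neg_mem O3.one_mem) (sqrtm3 * z)
    rwa [← sub_eq_add_neg] at this
  rw [h2] at hz3
  have h3 : EX z = -(3 * EX (sqrtm3 * z)) := by linear_combination h1
  rw [h3] at hz2
  rw [norm_neg, norm_mul] at hz2
  norm_num at hz2
  linarith [norm_nonneg (EX (sqrtm3 * z))]

lemma EX_one_div_sqrtm3_aux : ∀ b, b ∉ O3 → sqrtm3 * b ∈ O3 → EX b = 0 := by
  intro b hbO hb
  have ht : Filter.Tendsto (fun z => sqrtm3 * z - sqrtm3 * b) (nhdsWithin b {b}ᶜ)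
      (nhdsWithin 0 {0}ᶜ) := by
    apply tendsto_nhdsWithin_iff.2 ⟨?_, ?_⟩
    · have : Filter.Tendsto (fun z => sqrtm3 * z - sqrtm3 * b) (nhds b)
          (nhds (sqrtm3 * b - sqrtm3 * b)) := Continuous.tendsto (by fun_prop) b
      rw [sub_self] at this
      exact this.mono_left nhdsWithin_le_nhds
    · filter_upwards [self_mem_nhdsWithin] with z hz h
      have h' : sqrtm3 * z - sqrtm3 * b = 0 := h
      exact hz (mul_left_cancel₀ sqrtm3_ne_zero (sub_eq_zero.1 h'))
  have hX : Filter.Tendsto EX (nhdsWithin b {b}ᶜ) (nhds (EX b)) :=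
    (hasDerivAt_EX hbO).continuousAt.tendsto.mono_left nhdsWithin_le_nhds
  have h1 : Filter.Tendsto (fun z => (LP.g₃ - EX z ^ 3) / 3 * (EX (sqrtm3 * z - sqrtm3 * b))⁻¹)
      (nhdsWithin b {b}ᶜ) (nhds ((LP.g₃ - EX b ^ 3) / 3 * 0)) :=
    (((hX.pow 3).const_sub _).div_const 3).mul (tendsto_inv_EX.comp ht)
  rw [mul_zero] at h1
  have h2 := tendsto_nhds_unique (h1.congr' (f₂ := fun z => EX z ^ 2) ?_) (hX.pow 2)
  · exact (pow_eq_zero_iff two_ne_zero).1 h2.symm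
  filter_upwards [ht.eventually (eventually_EX_ne 0), eventually_notMem_coset sqrtm3_ne_zero 0 b,
    nhdsWithin_le_nhds (isOpen_compl_O3.mem_nhds hbO)] with z hz hz2 hz3
  have e : EX (sqrtm3 * z - sqrtm3 * b) = EX (sqrtm3 * z) := by
    have := EX_add (O3.neg_mem hb) (sqrtm3 * z)
    rwa [← sub_eq_add_neg] at this
  rw [e] at hz ⊢
  have := EX_sqrtm3 hz3 (by simpa using hz2)
  rw [← this]; field_simp

/-- Zeros of `℘`. -/
lemma EX_eq_zero_of_mem {b : ℂ} (hb : b ∉ O3) (h : sqrtm3 * b ∈ O3) : EX b = 0 :=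
  EX_one_div_sqrtm3_aux b hb h

/-- `℘` takes each value at most twice. -/
theorem EX_inj {u v : ℂ} (hu : u ∉ O3) (hv : v ∉ O3) (h : EX u = EX v) :
    u + v ∈ O3 ∨ u - v ∈ O3 := by
  by_contra! hc
  obtain ⟨h1, h2⟩ := hc
  have f1 := EX_add_formula hu hv h1
  have f2 := EX_add_formula (v := -v) hu (by simpa using hv) (by rwa [← sub_eq_add_neg])
  rw [EX_neg, EW_neg] at f2
  rw [h] at f1 f2
  have q2 := EW_sq hv
  have hw : EW v ^ 2 = 0 := by linear_combination q2 - (f1 + f2) / 2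
  rw [pow_eq_zero_iff two_ne_zero] at hw
  rw [hw] at q2
  set S : Set ℂ := (O3 : Set ℂ) ∪ {z | 1 * (z - -v) ∈ O3} with hS
  have hmem : ∀ z ∉ S, z ∉ O3 ∧ z + v ∉ O3 := fun z hz =>
    ⟨fun h => hz (Or.inl h), fun h => hz (Or.inr (by simpa using h))⟩
  have hid := identity_off_countable (countable_O3.union (countable_coset one_ne_zero (-v)))
    (isClosed_O3.union (isClosed_coset 1 (-v)))
    (F := fun z => EX (z + v) * (EX z - EX v) - EX v * (EX z + 2 * EX v)) (b := 0)
    (fun z hz => by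
      have d1 := (hasDerivAt_EX (hmem z hz).1).differentiableAt
      have d2 : DifferentiableAt ℂ (fun z => EX (z + v)) z :=
        (hasDerivAt_EX (hmem z hz).2).differentiableAt.fun_comp' z (by fun_prop)
      fun_prop) (by
      have hev : ∀ᶠ z in nhdsWithin 0 {0}ᶜ, z ∉ {z : ℂ | 1 * (z - -v) ∈ O3} :=
        nhdsWithin_le_nhds ((isClosed_coset 1 (-v)).isOpen_compl.mem_nhds (by simpa using hv))
      filter_upwards [eventually_notMem_O3 0, hev, eventually_EX_ne (EX v)] with z hz hz2 hz3
      have f3 := EX_add_formula hz hv (by simpa using hz2)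
      rw [hw] at f3
      have : (EX z - EX v) * (EX (z + v) * (EX z - EX v) - EX v * (EX z + 2 * EX v)) = 0 := by
        linear_combination f3 / 2 - q2 / 2
      exact (mul_eq_zero.1 this).resolve_left (sub_ne_zero.2 hz3)) u (by
        rintro (h | h)
        · exact hu h
        · exact h1 (by simpa using h))
  rw [h] at hid
  have h0 : EX v ^ 2 = 0 := by linear_combination -hid / 3
  rw [pow_eq_zero_iff two_ne_zero] at h0
  rw [h0] at q2
  exact LP_g₃_ne_zero (by linear_combination q2)

/-- Complex conjugation on the period lattice. -/
def conjLattice : LP.lattice ≃ LP.lattice where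
  toFun l := ⟨(starRingEnd ℂ) l, by
    obtain ⟨l, hl⟩ := l
    have h0 := varpi1_ne
    have : l = varpi1 * (l / varpi1) := by field_simp
    rw [this, mem_LP] at hl
    have : (starRingEnd ℂ) l = varpi1 * ((starRingEnd ℂ) (l / varpi1)) := by
      rw [map_div₀, conj_ofReal]; field_simp
    simp only
    rw [this, mem_LP]
    exact conj_mem_O3 hl⟩
  invFun l := ⟨(starRingEnd ℂ) l, by
    obtain ⟨l, hl⟩ := l
    have h0 := varpi1_ne
    have : l = varpi1 * (l / varpi1) := by field_simp
    rw [this, mem_LP] at hl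
    have : (starRingEnd ℂ) l = varpi1 * ((starRingEnd ℂ) (l / varpi1)) := by
      rw [map_div₀, conj_ofReal]; field_simp
    simp only
    rw [this, mem_LP]
    exact conj_mem_O3 hl⟩
  left_inv l := by ext; simp
  right_inv l := by ext; simp

lemma EX_conj (u : ℂ) : EX ((starRingEnd ℂ) u) = (starRingEnd ℂ) (EX u) := by
  rw [EX, EX, PeriodPair.weierstrassP, PeriodPair.weierstrassP, ← conjLattice.tsum_eq, conj_tsum]
  refine tsum_congr fun l => ?_
  have h2 : (conjLattice l : ℂ) = (starRingEnd ℂ) l := rfl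
  rw [h2]; simp

lemma EW_conj (u : ℂ) : EW ((starRingEnd ℂ) u) = (starRingEnd ℂ) (EW u) := by
  rw [EW, EW, PeriodPair.derivWeierstrassP, PeriodPair.derivWeierstrassP, ← conjLattice.tsum_eq,
    map_neg, conj_tsum]
  congr 1
  refine tsum_congr fun l => ?_
  have h2 : (conjLattice l : ℂ) = (starRingEnd ℂ) l := rfl
  rw [h2]; simp [Complex.conj_ofNat]

lemma real_notMem_O3 {t : ℝ} (h0 : t ≠ 0) (h1 : |t| < 1) : (t : ℂ) ∉ O3 :=
  notMem_O3_of_norm_lt (by exact_mod_cast h0) (by simpa using h1)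

/-- `℘` on the real axis. -/
def rX (t : ℝ) : ℝ := (EX t).re

/-- `℘′` on the real axis. -/
def rW (t : ℝ) : ℝ := (EW t).re

lemma EX_ofReal (t : ℝ) : EX t = rX t := by
  have := EX_conj t
  rw [conj_ofReal] at this
  exact (conj_eq_iff_re.1 this.symm).symm

lemma EW_ofReal (t : ℝ) : EW t = rW t := by
  have := EW_conj t
  rw [conj_ofReal] at this
  exact (conj_eq_iff_re.1 this.symm).symm

lemma hasDerivAt_rX {t : ℝ} (h0 : t ≠ 0) (h1 : |t| < 1) : HasDerivAt rX (varpi1 * rW t) t := by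
  have := (hasDerivAt_EX (real_notMem_O3 h0 h1)).real_of_complex
  rw [EW_ofReal, ← ofReal_mul, ofReal_re] at this
  exact this

lemma hasDerivAt_rW {t : ℝ} (h0 : t ≠ 0) (h1 : |t| < 1) :
    HasDerivAt rW (6 * varpi1 * rX t ^ 2) t := by
  have := (hasDerivAt_EW (real_notMem_O3 h0 h1)).real_of_complex
  rw [EX_ofReal] at this
  have h2 : (6 * varpi1 * (rX t : ℂ) ^ 2) = ((6 * varpi1 * rX t ^ 2 : ℝ) : ℂ) := by push_cast; ring
  rw [h2, ofReal_re] at this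
  exact this

lemma sqrtm3_div_three : sqrtm3 * (1 / 3 : ℂ) ∉ O3 := by
  apply notMem_O3_of_norm_lt (mul_ne_zero sqrtm3_ne_zero (by norm_num))
  have hs : ‖sqrtm3‖ ^ 2 = 3 := by rw [← norm_pow, sqrtm3_sq]; simp
  rw [norm_mul]; norm_num
  nlinarith [norm_nonneg sqrtm3]

lemma third_notMem : (1 / 3 : ℂ) ∉ O3 := by
  have := real_notMem_O3 (t := 1 / 3) (by norm_num) (by norm_num [abs_of_pos])
  push_cast at this; exact this

lemma EX_third_cube : EX (1 / 3) ^ 3 = LP.g₃ := by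
  have h := EX_sqrtm3 third_notMem sqrtm3_div_three
  rw [EX_eq_zero_of_mem sqrtm3_div_three] at h
  · linear_combination h
  · have : sqrtm3 * (sqrtm3 * (1 / 3)) = -1 := by linear_combination (1 / 3 : ℂ) * sqrtm3_sq
    rw [this]; exact O3.neg_mem O3.one_mem

lemma rX_third_cube : (rX (1 / 3) : ℂ) ^ 3 = LP.g₃ := by
  rw [← EX_ofReal, ← EX_third_cube]; push_cast; rfl

lemma rW_sq {t : ℝ} (h0 : t ≠ 0) (h1 : |t| < 1) : rW t ^ 2 = 4 * rX t ^ 3 - rX (1 / 3) ^ 3 := by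
  have := EW_sq (real_notMem_O3 h0 h1)
  rw [EX_ofReal, EW_ofReal, ← rX_third_cube] at this
  exact_mod_cast this

lemma rX_third_pos : 0 < rX (1 / 3) := by
  have h := rW_sq (t := 1 / 3) (by norm_num) (by norm_num [abs_of_pos])
  have h0 : rX (1 / 3) ≠ 0 := fun h0 => by
    have := rX_third_cube
    rw [h0] at this
    exact LP_g₃_ne_zero (by rw [← this]; simp)
  by_contra hc
  have h2 : rX (1 / 3) < 0 := lt_of_le_of_ne (not_lt.1 hc) h0
  have h3 : rX (1 / 3) ^ 3 < 0 := Odd.pow_neg (by decide) h2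
  nlinarith [sq_nonneg (rW (1 / 3))]

lemma tendsto_ofReal_punctured : Filter.Tendsto (fun t : ℝ => (t : ℂ)) (nhdsWithin 0 (Set.Ioi 0))
    (nhdsWithin 0 {0}ᶜ) := by
  apply tendsto_nhdsWithin_iff.2 ⟨?_, ?_⟩
  · have : Filter.Tendsto (fun t : ℝ => (t : ℂ)) (nhds 0) (nhds ((0 : ℝ) : ℂ)) :=
      Continuous.tendsto (by fun_prop) 0
    rw [ofReal_zero] at this
    exact this.mono_left nhdsWithin_le_nhds
  · filter_upwards [self_mem_nhdsWithin] with t ht h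
    have h1 : (t : ℂ) = 0 := h
    have h2 : (0 : ℝ) < t := ht
    exact h2.ne' (by exact_mod_cast h1)

lemma eventually_rX_gt (M : ℝ) : ∀ᶠ t in nhdsWithin (0:ℝ) (Set.Ioi 0), M < rX t := by
  have h1 := tendsto_ofReal_punctured.eventually (eventually_norm_EX_gt |M|)
  have h2 := (continuous_re.tendsto _).comp (tendsto_sq_mul_EX.comp tendsto_ofReal_punctured)
  have h3 : (0:ℝ) < (1 / (varpi1 : ℂ) ^ 2).re := by
    have : (1 / (varpi1 : ℂ) ^ 2) = ((1 / varpi1 ^ 2 : ℝ) : ℂ) := by push_cast; rfl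
    rw [this, ofReal_re]
    have := varpi1_pos
    positivity
  filter_upwards [h1, h2.eventually_const_lt h3, self_mem_nhdsWithin] with t ht ht2 ht3
  have ht3 : (0:ℝ) < t := ht3
  simp only [Function.comp_apply] at ht2
  rw [EX_ofReal] at ht ht2
  rw [← ofReal_pow, ← ofReal_mul, ofReal_re] at ht2
  have hx : 0 < rX t := pos_of_mul_pos_right ht2 (by positivity)
  rw [norm_real, Real.norm_eq_abs, abs_of_pos hx] at ht
  linarith [le_abs_self M]

lemma rX_ne_third {t : ℝ} (h0 : 0 < t) (h1 : t < 1 / 3) : rX t ≠ rX (1 / 3) := by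
  intro h
  have hX : EX t = EX ((1 / 3 : ℝ) : ℂ) := by rw [EX_ofReal, EX_ofReal, h]
  rcases EX_inj (real_notMem_O3 h0.ne' (by rw [abs_of_pos h0]; linarith))
    (real_notMem_O3 (by norm_num) (by norm_num [abs_of_pos])) hX with h2 | h2
  · rw [← ofReal_add] at h2
    exact real_notMem_O3 (by linarith) (by rw [abs_of_pos (by linarith)]; linarith) h2
  · rw [← ofReal_sub] at h2
    exact real_notMem_O3 (by linarith) (by rw [abs_of_neg (by linarith)]; linarith) h2

lemma abs_lt_of_mem {t : ℝ} (h : t ∈ Set.Ioc (0:ℝ) (1 / 3)) : t ≠ 0 ∧ |t| < 1 :=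
  ⟨h.1.ne', by rw [abs_of_pos h.1]; linarith [h.2]⟩

lemma continuousOn_rX : ContinuousOn rX (Set.Ioc (0:ℝ) (1 / 3)) := fun t ht =>
  (hasDerivAt_rX (abs_lt_of_mem ht).1 (abs_lt_of_mem ht).2).continuousAt.continuousWithinAt

lemma continuousOn_rW : ContinuousOn rW (Set.Ioc (0:ℝ) (1 / 3)) := fun t ht =>
  (hasDerivAt_rW (abs_lt_of_mem ht).1 (abs_lt_of_mem ht).2).continuousAt.continuousWithinAt

lemma rX_gt_third {t : ℝ} (h0 : 0 < t) (h1 : t < 1 / 3) : rX (1 / 3) < rX t := by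
  by_contra hc
  obtain ⟨e, he, he2⟩ := ((eventually_rX_gt (rX (1 / 3))).and
    (Ioo_mem_nhdsGT h0)).exists
  have hsub : Set.Icc e t ⊆ Set.Ioc (0:ℝ) (1 / 3) := fun x hx =>
    ⟨lt_of_lt_of_le he2.1 hx.1, hx.2.trans h1.le⟩
  obtain ⟨x, hx, hx2⟩ := intermediate_value_Icc' he2.2.le (continuousOn_rX.mono hsub)
    ⟨not_lt.1 hc, he.le⟩
  exact rX_ne_third (hsub hx).1 (hx.2.trans_lt h1) hx2

lemma rW_sq_gt {t : ℝ} (h0 : 0 < t) (h1 : t < 1 / 3) : rW (1 / 3) ^ 2 < rW t ^ 2 := by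
  rw [rW_sq h0.ne' (by rw [abs_of_pos h0]; linarith), rW_sq (by norm_num) (by norm_num [abs_of_pos])]
  have := pow_lt_pow_left₀ (rX_gt_third h0 h1) rX_third_pos.le (n := 3) (by norm_num)
  linarith

lemma rW_lt {t : ℝ} (h0 : 0 < t) (h1 : t < 1 / 3) : rW t < -|rW (1 / 3)| := by
  have hsq := fun {t : ℝ} (h0 : 0 < t) (h1 : t < 1 / 3) => sq_lt_sq.1 (rW_sq_gt h0 h1)
  by_contra hc
  have hpos : 0 < rW t := by
    have := hsq h0 h1
    rcases abs_cases (rW t) with h | h <;> linarith [abs_nonneg (rW (1/3))]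
  obtain ⟨e, he, he2⟩ := ((eventually_rX_gt (rX t)).and (Ioo_mem_nhdsGT h0)).exists
  have hsub : Set.Icc e t ⊆ Set.Ioc (0:ℝ) (1 / 3) := fun x hx =>
    ⟨lt_of_lt_of_le he2.1 hx.1, hx.2.trans h1.le⟩
  have hWpos : ∀ x ∈ Set.Icc e t, 0 < rW x := by
    intro x hx
    by_contra hx2
    obtain ⟨y, hy, hy2⟩ := intermediate_value_Icc hx.2
      (continuousOn_rW.mono ((Set.Icc_subset_Icc_left hx.1).trans hsub)) ⟨not_lt.1 hx2, hpos.le⟩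
    have := hsq (lt_of_lt_of_le he2.1 (hx.1.trans hy.1)) (hy.2.trans_lt h1)
    rw [hy2] at this
    simp at this
    linarith [abs_nonneg (rW (1/3))]
  obtain ⟨c, hc, hc2⟩ := exists_hasDerivAt_eq_slope rX (fun x => varpi1 * rW x) he2.2
    (continuousOn_rX.mono hsub) (fun x hx => by
      have := abs_lt_of_mem (hsub (Set.Ioo_subset_Icc_self hx))
      exact hasDerivAt_rX this.1 this.2)
  have h3 : 0 < varpi1 * rW c := mul_pos varpi1_pos (hWpos c (Set.Ioo_subset_Icc_self hc))
  rw [hc2, div_pos_iff_of_pos_right (by linarith [he2.2])] at h3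
  linarith

lemma rW_third : rW (1 / 3) = -|rW (1 / 3)| ∧ rW (1 / 3) < 0 := by
  have h1 : rW (1 / 3) ≤ -|rW (1 / 3)| := by
    have hc : Filter.Tendsto rW (nhdsWithin (1 / 3) (Set.Iio (1 / 3))) (nhds (rW (1 / 3))) :=
      (hasDerivAt_rW (by norm_num) (by norm_num [abs_of_pos])).continuousAt.tendsto.mono_left
        nhdsWithin_le_nhds
    refine le_of_tendsto hc ?_
    filter_upwards [Ioo_mem_nhdsLT (show (0:ℝ) < 1 / 3 by norm_num)] with t ht
    exact (rW_lt ht.1 ht.2).le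
  have h2 : rW (1 / 3) ≠ 0 := fun h => by
    have := rW_sq (t := 1 / 3) (by norm_num) (by norm_num [abs_of_pos])
    rw [h] at this
    have := pow_pos rX_third_pos 3
    linarith
  have h3 := abs_pos.2 h2
  have h4 := neg_abs_le (rW (1 / 3))
  exact ⟨le_antisymm h1 h4, by linarith⟩

/-- The incomplete integral defining `ϖ₁`. -/
def arcG (y : ℝ) : ℝ := ∫ x in (0:ℝ)..y, (1 - x ^ 3) ^ (-(2:ℝ)/3)

lemma continuousOn_arcG : ContinuousOn arcG (Set.Icc 0 1) := by
  have := intervalIntegral.continuousOn_primitive_interval' integrable_varpi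
    (a := 0) Set.left_mem_uIcc
  rwa [Set.uIcc_of_le zero_le_one] at this

lemma hasDerivAt_arcG {y : ℝ} (h0 : 0 < y) (h1 : y < 1) :
    HasDerivAt arcG ((1 - y ^ 3) ^ (-(2:ℝ)/3)) y := by
  refine intervalIntegral.integral_hasDerivAt_right ?_ ?_ ?_
  · exact integrable_varpi.mono_set (by
      rw [Set.uIcc_of_le h0.le, Set.uIcc_of_le zero_le_one]; exact Set.Icc_subset_Icc_right h1.le)
  · refine Measurable.stronglyMeasurable ?_ |>.stronglyMeasurableAtFilter
    fun_prop
  · have : 1 - y ^ 3 ≠ 0 := by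
      have : y ^ 3 < 1 := pow_lt_one₀ h0.le h1 (by norm_num)
      linarith
    exact ContinuousAt.rpow_const (by fun_prop) (Or.inl this)

/-- The substitution carrying `℘` on the real axis to the variable of the period integral. -/
def arcS (t : ℝ) : ℝ := 2 * |rW (1 / 3)| / rX (1 / 3) * (rX t / (|rW (1 / 3)| - rW t))

lemma rW_third_sq : |rW (1 / 3)| ^ 2 = 3 * rX (1 / 3) ^ 3 := by
  rw [sq_abs, rW_sq (by norm_num) (by norm_num [abs_of_pos])]; ring

lemma arcS_pos {t : ℝ} (h0 : 0 < t) (h1 : t < 1 / 3) : 0 < arcS t := by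
  have hb : 0 < |rW (1 / 3)| := abs_pos.2 rW_third.2.ne
  have hw := rW_lt h0 h1
  have := rX_gt_third h0 h1
  have := rX_third_pos
  unfold arcS
  have : 0 < |rW (1 / 3)| - rW t := by linarith
  have : 0 < rX t := by linarith
  positivity

lemma one_sub_arcS_cube {t : ℝ} (h0 : 0 < t) (h1 : t < 1 / 3) :
    1 - arcS t ^ 3 = ((-|rW (1 / 3)| - rW t) / (|rW (1 / 3)| - rW t)) ^ 3 := by
  have hb : 0 < |rW (1 / 3)| := abs_pos.2 rW_third.2.ne
  have hw := rW_lt h0 h1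
  have hX := rW_sq h0.ne' (by rw [abs_of_pos h0]; linarith)
  have h3 := rX_third_pos
  have h4 := rW_third_sq
  have h5 : |rW (1 / 3)| - rW t ≠ 0 := by linarith
  unfold arcS
  generalize |rW (1 / 3)| = b at *
  generalize rW t = w at *
  generalize rX t = x at *
  generalize rX (1 / 3) = y at *
  have h6 : x ^ 3 = (w ^ 2 + y ^ 3) / 4 := by linarith
  have h7 : y ^ 3 = b ^ 2 / 3 := by linarith
  have : (2 * b / y * (x / (b - w))) ^ 3 = 8 * b ^ 3 * x ^ 3 / (y ^ 3 * (b - w) ^ 3) := by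
    field_simp; ring
  rw [this, h6, h7]
  field_simp
  ring

lemma arcS_lt_one {t : ℝ} (h0 : 0 < t) (h1 : t < 1 / 3) : arcS t < 1 := by
  have hb : 0 < |rW (1 / 3)| := abs_pos.2 rW_third.2.ne
  have hw := rW_lt h0 h1
  have h2 : 0 < ((-|rW (1 / 3)| - rW t) / (|rW (1 / 3)| - rW t)) ^ 3 := by
    have : 0 < |rW (1 / 3)| - rW t := by linarith
    have : 0 < -|rW (1 / 3)| - rW t := by linarith
    positivity
  rw [← one_sub_arcS_cube h0 h1] at h2
  by_contra hc
  have := one_le_pow₀ (not_lt.1 hc) (n := 3)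
  linarith

lemma hasDerivAt_arcG_arcS {t : ℝ} (h0 : 0 < t) (h1 : t < 1 / 3) :
    HasDerivAt (fun t => arcG (arcS t)) (|rW (1 / 3)| * varpi1 / rX (1 / 3)) t := by
  have hb : 0 < |rW (1 / 3)| := abs_pos.2 rW_third.2.ne
  have hw := rW_lt h0 h1
  have habs : |t| < 1 := by rw [abs_of_pos h0]; linarith
  have hX := rW_sq h0.ne' habs
  have h3 := rX_third_pos
  have h4 := rW_third_sq
  have h5 : |rW (1 / 3)| - rW t ≠ 0 := by linarith
  have hs : HasDerivAt arcS (2 * |rW (1 / 3)| / rX (1 / 3) *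
      ((varpi1 * rW t * (|rW (1 / 3)| - rW t) - rX t * (-(6 * varpi1 * rX t ^ 2))) /
        (|rW (1 / 3)| - rW t) ^ 2)) t :=
    ((hasDerivAt_rX h0.ne' habs).div ((hasDerivAt_rW h0.ne' habs).const_sub _) h5).const_mul _
  have hG := (hasDerivAt_arcG (arcS_pos h0 h1) (arcS_lt_one h0 h1)).comp t hs
  refine hG.congr_deriv ?_
  rw [one_sub_arcS_cube h0 h1]
  have hr : 0 < (-|rW (1 / 3)| - rW t) / (|rW (1 / 3)| - rW t) := by
    have : 0 < |rW (1 / 3)| - rW t := by linarith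
    have : 0 < -|rW (1 / 3)| - rW t := by linarith
    positivity
  rw [← Real.rpow_natCast, ← Real.rpow_mul hr.le]
  have : ((3:ℕ):ℝ) * (-2 / 3) = ((-2 : ℤ) : ℝ) := by norm_num
  rw [this, Real.rpow_intCast, zpow_neg, zpow_ofNat]
  have hne : -|rW (1 / 3)| - rW t ≠ 0 := by linarith
  generalize |rW (1 / 3)| = b at *
  generalize rW t = w at *
  generalize rX t = x at *
  generalize rX (1 / 3) = y at *
  have h6 : varpi1 * w * (b - w) - x * (-(6 * varpi1 * x ^ 2)) = varpi1 * (-b - w) ^ 2 / 2 := by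
    linear_combination (- 3 / 2) * varpi1 * hX - varpi1 / 2 * h4
  rw [h6]
  field_simp

lemma tendsto_arcS_zero :
    Filter.Tendsto arcS (nhdsWithin (0:ℝ) (Set.Ioi 0)) (nhds 0) := by
  have hb : 0 < |rW (1 / 3)| := abs_pos.2 rW_third.2.ne
  have h3 := rX_third_pos
  rw [Metric.tendsto_nhds]
  intro e he
  set c := 2 * |rW (1 / 3)| / rX (1 / 3) with hc
  have hcpos : 0 < c := div_pos (mul_pos two_pos hb) h3
  filter_upwards [eventually_rX_gt (c ^ 2 / e ^ 2), Ioo_mem_nhdsGT (show (0:ℝ) < 1/3 by norm_num)]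
    with t ht ht2
  have hpos := arcS_pos ht2.1 ht2.2
  rw [dist_zero_right, Real.norm_of_nonneg hpos.le]
  have hw := rW_lt ht2.1 ht2.2
  have hx := rX_gt_third ht2.1 ht2.2
  have hX := rW_sq ht2.1.ne' (by rw [abs_of_pos ht2.1]; linarith [ht2.2])
  have hx3 := pow_lt_pow_left₀ hx h3.le (n := 3) (by norm_num)
  have hxp : 0 < rX t := by linarith
  have hden : rX t ^ 3 < (|rW (1 / 3)| - rW t) ^ 2 := by
    have : 0 < rX t ^ 3 := by positivity
    nlinarith [pow_pos h3 3]
  have h7 : arcS t ^ 2 * rX t < c ^ 2 := by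
    have hs : arcS t = c * (rX t / (|rW (1 / 3)| - rW t)) := rfl
    clear_value c
    rw [hs, mul_pow, div_pow, mul_assoc, ← mul_div_right_comm]
    have : rX t ^ 2 * rX t / (|rW (1 / 3)| - rW t) ^ 2 < 1 := by
      rw [div_lt_one (lt_trans (by positivity) hden)]
      linarith [hden]
    nlinarith [pow_pos hcpos 2]
  rw [div_lt_iff₀ (by positivity)] at ht
  by_contra hcon
  have h8 := pow_le_pow_left₀ he.le (not_lt.1 hcon) 2
  nlinarith

lemma tendsto_arcS_one :
    Filter.Tendsto arcS (nhdsWithin (1 / 3) (Set.Iio (1 / 3))) (nhds 1) := by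
  have hb : 0 < |rW (1 / 3)| := abs_pos.2 rW_third.2.ne
  have h3 := rX_third_pos
  have hval : arcS (1 / 3) = 1 := by
    unfold arcS
    generalize rX (1/3) = y at *
    rw [rW_third.1, abs_neg, abs_abs]
    field_simp
    ring
  have hab : |(1 / 3 : ℝ)| < 1 := by norm_num [abs_of_pos]
  have hc : ContinuousAt arcS (1 / 3) := by
    unfold arcS
    refine ContinuousAt.mul continuousAt_const (ContinuousAt.div
      (hasDerivAt_rX (by norm_num) hab).continuousAt
      (continuousAt_const.sub (hasDerivAt_rW (by norm_num) hab).continuousAt) ?_)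
    linarith [rW_third.2]
  have := hc.tendsto
  rw [hval] at this
  exact this.mono_left nhdsWithin_le_nhds

lemma rW_third_eq : |rW (1 / 3)| = 3 * rX (1 / 3) := by
  have h3 := rX_third_pos
  set k := |rW (1 / 3)| * varpi1 / rX (1 / 3) with hk
  have hH : ∀ t ∈ Set.Ioo (0:ℝ) (1 / 3), HasDerivAt (fun t => arcG (arcS t) - k * t) 0 t :=
    fun t ht => ((hasDerivAt_arcG_arcS ht.1 ht.2).sub ((hasDerivAt_id t).const_mul k)).congr_deriv
      (by simp [hk])
  obtain ⟨a, ha⟩ := isOpen_Ioo.exists_is_const_of_deriv_eq_zero isPreconnected_Ioo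
    (fun t ht => (hH t ht).differentiableAt.differentiableWithinAt) (fun t ht => (hH t ht).deriv)
  have hin0 : ∀ᶠ t in nhdsWithin (0:ℝ) (Set.Ioi 0), t ∈ Set.Ioo (0:ℝ) (1 / 3) :=
    Ioo_mem_nhdsGT (by norm_num)
  have hin1 : ∀ᶠ t in nhdsWithin (1 / 3 : ℝ) (Set.Iio (1 / 3)), t ∈ Set.Ioo (0:ℝ) (1 / 3) :=
    Ioo_mem_nhdsLT (by norm_num)
  have hIcc : ∀ t ∈ Set.Ioo (0:ℝ) (1 / 3), arcS t ∈ Set.Icc (0:ℝ) 1 := fun t ht =>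
    ⟨(arcS_pos ht.1 ht.2).le, (arcS_lt_one ht.1 ht.2).le⟩
  have l0 : Filter.Tendsto (fun t => arcG (arcS t) - k * t) (nhdsWithin (0:ℝ) (Set.Ioi 0))
      (nhds (arcG 0 - k * 0)) := by
    refine Filter.Tendsto.sub ?_ ?_
    · exact (continuousOn_arcG 0 (by norm_num)).tendsto.comp
        (tendsto_nhdsWithin_iff.2 ⟨tendsto_arcS_zero, hin0.mono hIcc⟩)
    · exact ((continuous_const.mul continuous_id).tendsto _).mono_left nhdsWithin_le_nhds
  have l1 : Filter.Tendsto (fun t => arcG (arcS t) - k * t)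
      (nhdsWithin (1 / 3 : ℝ) (Set.Iio (1 / 3))) (nhds (arcG 1 - k * (1 / 3))) := by
    refine Filter.Tendsto.sub ?_ ?_
    · exact (continuousOn_arcG 1 (by norm_num)).tendsto.comp
        (tendsto_nhdsWithin_iff.2 ⟨tendsto_arcS_one, hin1.mono hIcc⟩)
    · exact ((continuous_const.mul continuous_id).tendsto _).mono_left nhdsWithin_le_nhds
  have e0 := tendsto_nhds_unique (l0.congr' (hin0.mono fun t ht => ha t ht)) tendsto_const_nhds
  have e1 := tendsto_nhds_unique (l1.congr' (hin1.mono fun t ht => ha t ht)) tendsto_const_nhds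
  have g0 : arcG 0 = 0 := by simp [arcG]
  have g1 : arcG 1 = varpi1 := rfl
  rw [g0] at e0
  rw [g1] at e1
  have hv := varpi1_pos
  have : varpi1 = k * (1 / 3) := by linarith
  rw [hk] at this
  field_simp at this
  linarith

lemma rX_third : rX (1 / 3) = 3 := by
  have h1 := rW_third_sq
  rw [rW_third_eq] at h1
  have h3 := rX_third_pos
  have : rX (1 / 3) ^ 2 * (rX (1 / 3) - 3) = 0 := by linarith
  rcases mul_eq_zero.1 this with h | h
  · exact absurd h (by positivity)
  · linarith

lemma EX_third : EX (1 / 3) = 3 := by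
  have := EX_ofReal (1 / 3)
  rw [rX_third] at this
  push_cast at this
  exact this

lemma EW_third : EW (1 / 3) = -9 := by
  have := EW_ofReal (1 / 3)
  rw [rW_third.1, rW_third_eq, rX_third] at this
  push_cast at this
  rw [this]; norm_num

lemma LP_g₃ : LP.g₃ = 27 := by rw [← EX_third_cube, EX_third]; norm_num

/-- The `√−3`-torsion point `(ρ−1)/3`. -/
def A1 : ℂ := (ρ3 - 1) / 3

lemma sqrtm3_A1 : sqrtm3 * A1 = ρ3 ^ 2 := by
  rw [sqrtm3_eq', A1]; linear_combination (-1 / 3 : ℂ) * rho3_sq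

lemma norm_rho3 : ‖ρ3‖ = 1 := by
  have : ‖ρ3‖ ^ 3 = 1 := by rw [← norm_pow, rho3_cube, norm_one]
  exact (pow_eq_one_iff_of_nonneg (norm_nonneg _) (by norm_num)).1 this

lemma norm_sqrtm3_sq : ‖sqrtm3‖ ^ 2 = 3 := by rw [← norm_pow, sqrtm3_sq]; simp

lemma A1_ne_zero : A1 ≠ 0 := fun h => by
  have := sqrtm3_A1
  rw [h, mul_zero] at this
  exact pow_ne_zero 2 rho3_ne_zero this.symm

lemma A1_notMem : A1 ∉ O3 := by
  apply notMem_O3_of_norm_lt A1_ne_zero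
  have h : ‖sqrtm3‖ * ‖A1‖ = 1 := by rw [← norm_mul, sqrtm3_A1, norm_pow, norm_rho3, one_pow]
  have h2 := norm_sqrtm3_sq
  have h3 : 0 < ‖A1‖ := norm_pos_iff.2 A1_ne_zero
  by_contra hc
  nlinarith [norm_nonneg sqrtm3]

lemma three_A1 : 3 * A1 ∈ O3 := by
  have : 3 * A1 = ρ3 - 1 := by rw [A1]; ring
  rw [this]; exact O3.sub_mem rho3_mem O3.one_mem

lemma EX_A1 : EX A1 = 0 := EX_eq_zero_of_mem A1_notMem (by
  rw [sqrtm3_A1]; exact O3.pow_mem rho3_mem 2)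

lemma EW_sq' {u : ℂ} (hu : u ∉ O3) : EW u ^ 2 = 4 * EX u ^ 3 - 27 := by rw [EW_sq hu, LP_g₃]

lemma EX_neg_third : EX (-1 / 3) = 3 := by rw [neg_div, EX_neg, EX_third]

lemma EW_neg_third : EW (-1 / 3) = 9 := by rw [neg_div, EW_neg, EW_third, neg_neg]

lemma neg_third_notMem : (-1 / 3 : ℂ) ∉ O3 := by
  rw [neg_div, neg_mem_iff]; exact third_notMem

lemma EW_A1 : EW A1 = 3 * sqrtm3 := by
  have hu : ρ3 * (1 / 3) ∉ O3 := fun h => third_notMem (rho3_mul_mem.1 h)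
  have e : ρ3 * (1 / 3) + -1 / 3 = A1 := by rw [A1]; ring
  have h := EW_add_chord hu neg_third_notMem (by rw [e]; exact A1_notMem)
  rw [e, EX_A1, EX_rho, EW_rho, EX_third, EW_third, EX_neg_third, EW_neg_third] at h
  have h1 : ρ3 * 3 - 3 ≠ 0 := by
    intro h; exact rho3_ne_one (by linear_combination h / 3)
  apply mul_left_cancel₀ h1
  rw [sqrtm3_eq']
  linear_combination h - 18 * rho3_sq

/-- Translation of `φ` data by the `√−3`-torsion point. -/
lemma EX_add_A1 {u : ℂ} (hu : u ∉ O3) (h : u + A1 ∉ O3) :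
    2 * EX (u + A1) * EX u ^ 2 = -27 - 3 * sqrtm3 * EW u := by
  have := EX_add_formula hu A1_notMem h
  rw [EX_A1, EW_A1, LP_g₃] at this
  linear_combination this

lemma EW_add_A1 {u : ℂ} (hu : u ∉ O3) (h : u + A1 ∉ O3) :
    EX u * (EW (u + A1) + EW u) + (EW u - 3 * sqrtm3) * (EX (u + A1) - EX u) = 0 := by
  have := EW_add_chord hu A1_notMem h
  rw [EX_A1, EW_A1] at this
  linear_combination this

lemma sqrtm3_mul_sub_mem_of_EX_zero {u : ℂ} (hu : u ∉ O3) (h : EX u = 0) :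
    u + A1 ∈ O3 ∨ u - A1 ∈ O3 := EX_inj hu A1_notMem (by rw [h, EX_A1])

open Classical in
/-- The function `φ`, extended by its value `0` at the lattice points. -/
def PH (u : ℂ) : ℂ := if u ∈ O3 then 0 else 6 * EX u / (9 + EW u)

lemma PH_of_mem {u : ℂ} (hu : u ∈ O3) : PH u = 0 := if_pos hu

lemma PH_of_notMem {u : ℂ} (hu : u ∉ O3) : PH u = 6 * EX u / (9 + EW u) := if_neg hu

lemma phi3_eq_PH {u : ℂ} (hu : u ∉ O3) : phi3 u = PH u := by rw [phi3_eq, PH_of_notMem hu]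

lemma PH_zero : PH 0 = 0 := PH_of_mem O3.zero_mem

lemma PH_add {l : ℂ} (hl : l ∈ O3) (u : ℂ) : PH (u + l) = PH u := by
  by_cases hu : u ∈ O3
  · rw [PH_of_mem hu, PH_of_mem (O3.add_mem hu hl)]
  · have : u + l ∉ O3 := fun h => hu (by simpa using O3.sub_mem h hl)
    rw [PH_of_notMem hu, PH_of_notMem this, EX_add hl, EW_add hl]

lemma PH_rho (u : ℂ) : PH (ρ3 * u) = ρ3 * PH u := by
  by_cases hu : u ∈ O3
  · rw [PH_of_mem hu, PH_of_mem (rho3_mul_mem.2 hu), mul_zero]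
  · rw [PH_of_notMem hu, PH_of_notMem (fun h => hu (rho3_mul_mem.1 h)), EX_rho, EW_rho]; ring

lemma PH_conj (u : ℂ) : PH ((starRingEnd ℂ) u) = (starRingEnd ℂ) (PH u) := by
  by_cases hu : u ∈ O3
  · rw [PH_of_mem hu, PH_of_mem (conj_mem_O3 hu), map_zero]
  · rw [PH_of_notMem hu, PH_of_notMem (fun h => hu (by simpa using conj_mem_O3 h)), EX_conj, EW_conj]
    simp [Complex.conj_ofNat]

lemma PH_add_A1_aux {u : ℂ} (hu : u ∉ O3) (h : u + A1 ∉ O3) : PH (u + A1) = ρ3 ^ 2 * PH u := by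
  rw [PH_of_notMem hu, PH_of_notMem h]
  by_cases hX : EX u = 0
  · have hm : u - A1 ∈ O3 := (sqrtm3_mul_sub_mem_of_EX_zero hu hX).resolve_left h
    have : EX (u + A1) = 0 := by
      have e : u + A1 = -A1 + (u - A1 + 3 * A1) := by ring
      rw [e, EX_add (O3.add_mem hm three_A1), EX_neg, EX_A1]
    rw [hX, this]; simp
  have hX' := EX_add_A1 hu h
  have hW' := EW_add_A1 hu h
  have hW := EW_sq' hu
  have hl := sqrtm3_sq
  have hr : ρ3 = (sqrtm3 - 1) / 2 := by rw [sqrtm3_eq']; ring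
  have hsum : EW u + 3 * sqrtm3 ≠ 0 := by
    intro h0
    have : 4 * EX u ^ 3 = 0 := by linear_combination (EW u - 3 * sqrtm3) * h0 + 9 * hl - hW
    exact hX (by simpa using this)
  set l := sqrtm3
  set X := EX u
  set W := EW u
  set X' := EX (u + A1)
  set W' := EW (u + A1)
  have e1 : X' = (-27 - 3 * l * W) / (2 * X ^ 2) := by
    field_simp; linear_combination hX'
  have e2 : W' = (-W * X - (W - 3 * l) * (X' - X)) / X := by
    field_simp; linear_combination hW'
  have e3 : (9 + W') * (W + 3 * l) = (9 + 3 * l) * (W + 9) := by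
    rw [e2, e1]
    field_simp
    linear_combination (27 + 3 * l * W) * hW - (243 + 27 * l * W + 18 * X ^ 3) * hl
  by_cases h9 : 9 + W = 0
  · have : 9 + W' = 0 := by
      have h0 : (9 + W') * (W + 3 * l) = 0 := by rw [e3]; linear_combination (9 + 3 * l) * h9
      exact (mul_eq_zero.1 h0).resolve_right hsum
    rw [h9, this]; simp
  have h3l : 9 + 3 * l ≠ 0 := by
    intro h0
    have : (12 : ℂ) = 0 := by
      linear_combination (3 - l) / 3 * h0 + hl
    norm_num at this
  have h9' : 9 + W' ≠ 0 := by
    intro h0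
    rw [h0, zero_mul] at e3
    rcases mul_eq_zero.1 e3.symm with h | h
    · exact h3l h
    · exact h9 (by rw [add_comm]; exact h)
  rw [hr, div_eq_iff h9', eq_comm, mul_assoc, div_mul_eq_mul_div, mul_div_assoc', div_eq_iff h9]
  apply mul_right_cancel₀ hsum
  have e4 : 6 * X * (9 + W') * (W + 3 * l) = 6 * X * ((9 + 3 * l) * (W + 9)) := by
    rw [mul_assoc, e3]
  have e5 : X' * (W + 3 * l) = -6 * l * X := by
    apply mul_left_cancel₀ (pow_ne_zero 2 hX)
    linear_combination (W + 3 * l) / 2 * hX' - (3 / 2) * l * hW - (9/2) * W * hl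
  linear_combination ((l - 1) / 2) ^ 2 * e4 - 6 * (9 + W) * e5 + (9 + W) * X * ( 6 * ((9 + 3 * l) / 4 - 3/2)) * hl

lemma PH_A1_add {l : ℂ} (hl : l ∈ O3) : PH (A1 + l) = 0 := by
  rw [PH_add hl, PH_of_notMem A1_notMem, EX_A1]; simp

lemma PH_add_A1 (u : ℂ) : PH (u + A1) = ρ3 ^ 2 * PH u := by
  by_cases hu : u ∈ O3
  · rw [add_comm, PH_A1_add hu, PH_of_mem hu, mul_zero]
  by_cases h : u + A1 ∈ O3
  · rw [PH_of_mem h, PH_of_notMem hu]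
    have e : u = -A1 + (u + A1) := by ring
    rw [e, EX_add h, EX_neg, EX_A1]; simp
  · exact PH_add_A1_aux hu h

lemma sqrtm3_mul_mem {u : ℂ} (h : sqrtm3 * u ∈ O3) : u ∈ O3 ∨ u - A1 ∈ O3 ∨ u + A1 ∈ O3 := by
  by_cases hu : u ∈ O3
  · exact Or.inl hu
  · exact Or.inr ((sqrtm3_mul_sub_mem_of_EX_zero hu (EX_eq_zero_of_mem hu h)).symm)

lemma PH_add_of_sqrtm3_mul_mem {v : ℂ} (h : sqrtm3 * v ∈ O3) :
    ∃ ω : ℂ, ω ^ 3 = 1 ∧ ∀ u, PH (u + v) = ω * PH u := by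
  rcases sqrtm3_mul_mem h with h | h | h
  · exact ⟨1, one_pow 3, fun u => by rw [PH_add h, one_mul]⟩
  · refine ⟨ρ3 ^ 2, by rw [← pow_mul, mul_comm, pow_mul, rho3_cube, one_pow], fun u => ?_⟩
    have : u + v = u + A1 + (v - A1) := by ring
    rw [this, PH_add h, PH_add_A1]
  · refine ⟨ρ3, rho3_cube, fun u => ?_⟩
    have e := PH_add_A1 (u + v)
    have : u + v + A1 = u + (v + A1) := by ring
    rw [this, PH_add h] at e
    rw [e]; linear_combination (-PH (u + v)) * rho3_cube

lemma sqrtm3_sub_third_of_pole {u : ℂ} (hu : u ∉ O3) (h : 9 + EW u = 0) :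
    sqrtm3 * (u - 1 / 3) ∈ O3 := by
  have hW := EW_sq' hu
  have hW9 : EW u = -9 := by linear_combination h
  have hX : EX u ^ 3 = 27 := by rw [hW9] at hW; linear_combination -hW / 4
  have key : ∀ ε : ℂ, ε ∈ O3 → ε ^ 3 = 1 → ε * (1/3) ∉ O3 → EX (ε * (1 / 3)) = EX u →
      EW (ε * (1 / 3)) = -9 → u - ε * (1 / 3) ∈ O3 := by
    intro ε hε _ h1 h2 h3
    rcases EX_inj hu h1 h2.symm with h4 | h4
    · exfalso
      have e : u = -(ε * (1 / 3)) + (u + ε * (1 / 3)) := by ring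
      rw [e, EW_add h4, EW_neg, h3] at hW9
      norm_num at hW9
    · exact h4
  have hf : (EX u - 3) * (EX u - 3 * ρ3) * (EX u - 3 * ρ3 ^ 2) = 0 := by
    linear_combination hX + (-3 * EX u ^ 2 + 9 * EX u * ρ3) * rho3_sq + (9 * EX u - 27) * rho3_cube
      - 9 * EX u * ρ3 * rho3_sq + 9 * EX u * rho3_sq
  have hr1 : ρ3 * (1 / 3) ∉ O3 := fun h => third_notMem (rho3_mul_mem.1 h)
  have hr2 : ρ3 ^ 2 * (1 / 3) ∉ O3 := fun h => third_notMem (rho3_sq_mul_mem.1 h)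
  rcases mul_eq_zero.1 hf with h1 | h1
  · rcases mul_eq_zero.1 h1 with h1 | h1
    · have := key 1 O3.one_mem (one_pow 3) (by rw [one_mul]; exact third_notMem)
        (by rw [one_mul, EX_third]; linear_combination -h1) (by rw [one_mul, EW_third])
      rw [one_mul] at this
      exact O3.mul_mem sqrtm3_mem this
    · have := key ρ3 rho3_mem rho3_cube hr1
        (by rw [EX_rho, EX_third]; linear_combination -h1) (by rw [EW_rho, EW_third])
      have e : sqrtm3 * (u - 1 / 3) = sqrtm3 * (u - ρ3 * (1 / 3)) + sqrtm3 * A1 := by rw [A1]; ring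
      rw [e, sqrtm3_A1]
      exact O3.add_mem (O3.mul_mem sqrtm3_mem this) (O3.pow_mem rho3_mem 2)
  · have := key (ρ3 ^ 2) (O3.pow_mem rho3_mem 2)
      (by rw [← pow_mul, mul_comm, pow_mul, rho3_cube, one_pow]) hr2
      (by rw [EX_rho_sq, EX_third]; linear_combination -h1) (by rw [EW_rho_sq, EW_third])
    have e : sqrtm3 * (u - 1 / 3) = sqrtm3 * (u - ρ3 ^ 2 * (1 / 3)) + (ρ3 + 1) * (sqrtm3 * A1) := by
      rw [A1]; ring
    rw [e, sqrtm3_A1]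
    exact O3.add_mem (O3.mul_mem sqrtm3_mem this) (O3.mul_mem (O3.add_mem rho3_mem O3.one_mem)
      (O3.pow_mem rho3_mem 2))

lemma differentiableAt_PH_of_notMem {u : ℂ} (hu : u ∉ O3) (h : 9 + EW u ≠ 0) :
    DifferentiableAt ℂ PH u := by
  have : DifferentiableAt ℂ (fun u => 6 * EX u / (9 + EW u)) u :=
    (((hasDerivAt_EX hu).differentiableAt.const_mul 6).div
      ((differentiableAt_EW hu).const_add 9) h)
  refine this.congr_of_eventuallyEq ?_
  filter_upwards [isOpen_compl_O3.mem_nhds hu] with z hz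
  exact PH_of_notMem hz

lemma differentiableAt_PH {u : ℂ} (h : sqrtm3 * (u - 1 / 3) ∉ O3) : DifferentiableAt ℂ PH u := by
  by_cases hu : u ∈ O3
  · have h1 : u + A1 ∉ O3 := fun h => A1_notMem (by simpa using O3.sub_mem h hu)
    have h2 : 9 + EW (u + A1) ≠ 0 := by
      rw [add_comm u, EW_add hu, EW_A1]
      intro h0
      have : (12 : ℂ) = 0 := by
        linear_combination (3 - sqrtm3) / 3 * h0 + sqrtm3_sq
      norm_num at this
    have h3 := (differentiableAt_PH_of_notMem h1 h2).fun_comp' u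
      (show DifferentiableAt ℂ (fun z => z + A1) u by fun_prop)
    have h4 : PH = fun z => ρ3 * PH (z + A1) := by
      funext z; rw [PH_add_A1]; linear_combination (-PH z) * rho3_cube
    rw [h4]
    exact h3.const_mul ρ3
  · exact differentiableAt_PH_of_notMem hu fun h0 => h (sqrtm3_sub_third_of_pole hu h0)

/-- The residue of `φ` at `1/3`. -/
lemma tendsto_PH_third : Filter.Tendsto (fun z => (z - 1 / 3) * PH z)
    (nhdsWithin (1 / 3) {1 / 3}ᶜ) (nhds (1 / (3 * varpi1))) := by
  have h0 := varpi1_ne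
  have hd := hasDerivAt_iff_tendsto_slope.1 (hasDerivAt_EW third_notMem)
  rw [EX_third] at hd
  have hX := (hasDerivAt_EX third_notMem).continuousAt.tendsto.mono_left
    (nhdsWithin_le_nhds (s := {1 / 3}ᶜ))
  rw [EX_third] at hX
  have := (hX.const_mul 6).div hd (by simp [h0])
  have hv : 6 * 3 / (6 * (varpi1 : ℂ) * 3 ^ 2) = 1 / (3 * varpi1) := by field_simp
  rw [hv] at this
  refine this.congr' ?_
  filter_upwards [nhdsWithin_le_nhds (isOpen_compl_O3.mem_nhds third_notMem), self_mem_nhdsWithin]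
    with z hz hz2
  rw [PH_of_notMem hz]
  have : z - 1 / 3 ≠ 0 := sub_ne_zero.2 hz2
  rw [Pi.div_apply, slope_def_field, EW_third, sub_neg_eq_add, add_comm 9]
  by_cases hw : EW z + 9 = 0
  · simp [hw]
  · field_simp

lemma three_mul_mem_of_sqrtm3 {u : ℂ} (h : sqrtm3 * u ∈ O3) : 3 * u ∈ O3 := by
  have := O3.neg_mem (O3.mul_mem sqrtm3_mem h)
  convert this using 1
  linear_combination u * sqrtm3_sq

lemma three_mem : (3 : ℂ) ∈ O3 := by exact_mod_cast natCast_mem O3 3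

lemma notMem_of_three_mul {v : ℂ} (hv : 3 * v ∉ O3) {w : ℂ} (hw : 3 * w ∈ O3) : v + w ∉ O3 := by
  intro h
  apply hv
  have := O3.sub_mem (O3.mul_mem three_mem h) hw
  convert this using 1
  ring

lemma nine_add_EW_ne {v : ℂ} (hv : 3 * v ∉ O3) : 9 + EW v ≠ 0 := fun h0 => by
  have hv0 : v ∉ O3 := by simpa using notMem_of_three_mul hv (w := 0) (by simp)
  have := three_mul_mem_of_sqrtm3 (sqrtm3_sub_third_of_pole hv0 h0)
  apply hv
  have := O3.add_mem this O3.one_mem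
  convert this using 1
  ring

lemma PH_add_neg_third {v : ℂ} (hv : 3 * v ∉ O3) :
    PH (v + -1 / 3) * (9 - EW v) = -(9 + EW v) := by
  have hv0 : v ∉ O3 := by simpa using notMem_of_three_mul hv (w := 0) (by simp)
  have h : v + -1 / 3 ∉ O3 := notMem_of_three_mul hv (by norm_num [O3.one_mem])
  have f := EX_add_formula hv0 neg_third_notMem h
  have g := EW_add_chord hv0 neg_third_notMem h
  rw [EX_neg_third, EW_neg_third] at f g
  rw [LP_g₃] at f
  have hW := EW_sq' hv0
  have hX : EX v - 3 ≠ 0 := fun h0 => by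
    rcases EX_inj hv0 third_notMem (by rw [EX_third]; linear_combination h0) with h1 | h1
    · exact notMem_of_three_mul hv (by norm_num [O3.one_mem]) h1
    · rw [sub_eq_add_neg] at h1
      exact notMem_of_three_mul hv (by norm_num [O3.one_mem]) h1
  have hden : 9 + EW (v + -1 / 3) ≠ 0 := nine_add_EW_ne fun h0 => hv (by
    have := O3.add_mem h0 O3.one_mem
    convert this using 1
    ring)
  rw [PH_of_notMem h, div_mul_eq_mul_div, div_eq_iff hden]
  apply mul_right_cancel₀ (pow_ne_zero 3 hX)
  linear_combination (9 - EW v) * (6 * (EX v - 3) + 9 + EW v) / 2 * f +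
    (EX v - 3) ^ 2 * (9 + EW v) * g - 9 / 2 * (9 - EW v) * hW

/-- The values of `φ` at two points symmetric about `-1/3`. -/
lemma PH_mul_symm {v : ℂ} (hv : 3 * v ∉ O3) : PH (-1 / 3 + v) * PH (-1 / 3 + -v) = 1 := by
  have hv' : 3 * -v ∉ O3 := by rwa [mul_neg, neg_mem_iff]
  have h1 := PH_add_neg_third hv
  have h2 := PH_add_neg_third hv'
  have h3 := nine_add_EW_ne hv
  have h4 := nine_add_EW_ne hv'
  rw [EW_neg] at h2 h4
  rw [add_comm _ v, add_comm _ (-v)]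
  apply mul_right_cancel₀ (mul_ne_zero h3 h4)
  linear_combination PH (-v + -1 / 3) * (9 + EW v) * h1 - (9 + EW v) * h2

lemma PH_neg_third : PH (-1 / 3) = 1 := by
  rw [PH_of_notMem neg_third_notMem, EX_neg_third, EW_neg_third]; norm_num

/-- A primary prime `π` of degree one, with norm `p`. -/
structure PrimaryPrime (p : ℕ) (π : ℂ) : Prop where
  prime : p.Prime
  mem : π ∈ O3
  primary : ∃ d ∈ O3, π = 1 + 3 * d
  norm : π * (starRingEnd ℂ) π = p
  mod_three : p % 3 = 1

/-- A ring homomorphism onto the residue field of a primary prime. -/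
def IsResHom {p : ℕ} (π : ℂ) (t : O3 →+* ZMod p) : Prop :=
  ∀ z : O3, t z = 0 ↔ ∃ d ∈ O3, (z : ℂ) = π * d

lemma norm_int_of_mem_O3 {z : ℂ} (hz : z ∈ O3) : ∃ n : ℤ, z * (starRingEnd ℂ) z = n := by
  obtain ⟨a, b, rfl⟩ := mem_O3.1 hz
  refine ⟨a ^ 2 - a * b + b ^ 2, ?_⟩
  rw [map_add, map_mul, map_intCast, map_intCast, conj_rho3]
  push_cast
  linear_combination a * b * rho3_sq + b ^ 2 * rho3_cube

namespace PrimaryPrime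

variable {p : ℕ} {π : ℂ}

lemma ne_zero (h : PrimaryPrime p π) : π ≠ 0 := by
  rintro rfl
  have := h.norm
  rw [zero_mul] at this
  exact h.prime.ne_zero (by exact_mod_cast this.symm)

lemma dvd_of_mul (h : PrimaryPrime p π) {n : ℤ} {d : ℂ} (hd : d ∈ O3) (e : (n : ℂ) = π * d) :
    (p : ℤ) ∣ n := by
  obtain ⟨k, hk⟩ := norm_int_of_mem_O3 hd
  have : (n : ℂ) * n = p * k := by
    have e2 := congrArg (starRingEnd ℂ) e
    rw [map_intCast, map_mul] at e2
    nth_rewrite 2 [e2]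
    rw [e, ← hk, ← h.norm]; ring
  have h2 : n * n = p * k := by exact_mod_cast this
  have h3 : (p : ℤ) ∣ n * n := ⟨k, h2⟩
  rcases (Nat.prime_iff_prime_int.1 h.prime).dvd_or_dvd h3 with h | h <;> exact h

lemma exists_int (h : PrimaryPrime p π) {z : ℂ} (hz : z ∈ O3) :
    ∃ n : ℤ, ∃ d ∈ O3, z - n = π * d := by
  obtain ⟨a, b, hab⟩ := mem_O3.1 h.mem
  have hpp : (p : ℂ) = π * (starRingEnd ℂ) π := h.norm.symm
  have hn : a ^ 2 - a * b + b ^ 2 = p := by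
    have := h.norm
    rw [hab, map_add, map_mul, map_intCast, map_intCast, conj_rho3] at this
    have h2 : ((a ^ 2 - a * b + b ^ 2 : ℤ) : ℂ) = (p : ℤ) := by
      push_cast
      rw [← this]
      linear_combination -a * b * rho3_sq - b ^ 2 * rho3_cube
    exact_mod_cast h2
  have hpi : Prime (p : ℤ) := Nat.prime_iff_prime_int.1 h.prime
  have hb : ¬ (p : ℤ) ∣ b := by
    intro hb
    have ha : (p : ℤ) ∣ a ^ 2 := by
      have : a ^ 2 = p + b * (a - b) := by linarith
      rw [this]; exact dvd_add dvd_rfl (hb.mul_right _)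
    have ha := hpi.dvd_of_dvd_pow ha
    obtain ⟨a', rfl⟩ := ha
    obtain ⟨b', rfl⟩ := hb
    have : (p : ℤ) * (p * (a' ^ 2 - a' * b' + b' ^ 2)) = p * 1 := by linarith
    have := mul_left_cancel₀ hpi.ne_zero this
    exact hpi.not_isUnit (IsUnit.of_mul_eq_one _ this)
  have hco : IsCoprime (p : ℤ) b := (Prime.coprime_iff_not_dvd hpi).2 hb
  obtain ⟨r, s, hrs⟩ := hco
  obtain ⟨x, y, rfl⟩ := mem_O3.1 hz
  refine ⟨x - y * s * a, y * s + y * r * ρ3 * (starRingEnd ℂ) π, ?_, ?_⟩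
  · exact O3.add_mem (O3.mul_mem (intCast_mem O3 y) (intCast_mem O3 s)) (O3.mul_mem (O3.mul_mem
      (O3.mul_mem (intCast_mem O3 y) (intCast_mem O3 r)) rho3_mem) (conj_mem_O3 h.mem))
  · have e : (r : ℂ) * p + s * b = 1 := by exact_mod_cast hrs
    push_cast
    linear_combination (-y * ρ3) * e + (y * r * ρ3) * hpp - y * s * hab

lemma exists_resHom (h : PrimaryPrime p π) : ∃ t : O3 →+* ZMod p, IsResHom π t := by
  have : Fact p.Prime := ⟨h.prime⟩
  choose f hf using fun z : O3 => h.exists_int z.2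
  have uniq : ∀ m n : ℤ, (∃ d ∈ O3, (m : ℂ) - n = π * d) → (m : ZMod p) = n := by
    rintro m n ⟨d, hd, e⟩
    have := h.dvd_of_mul (n := m - n) hd (by push_cast; exact e)
    have := (ZMod.intCast_zmod_eq_zero_iff_dvd (m - n) p).2 this
    push_cast at this
    exact sub_eq_zero.1 this
  refine ⟨{ toFun := fun z => (f z : ZMod p)
            map_one' := ?_, map_mul' := ?_, map_zero' := ?_, map_add' := ?_ }, ?_⟩
  · obtain ⟨d, hd, e⟩ := hf 1
    have := uniq 1 (f 1) ⟨d, hd, by simpa using e⟩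
    simpa using this.symm
  · intro x y
    obtain ⟨d, hd, e⟩ := hf x
    obtain ⟨d', hd', e'⟩ := hf y
    obtain ⟨d'', hd'', e''⟩ := hf (x * y)
    have := uniq (f (x * y)) (f x * f y)
      ⟨-d'' + x * d' + d * f y, O3.add_mem (O3.add_mem (O3.neg_mem hd'') (O3.mul_mem x.2 hd'))
        (O3.mul_mem hd (intCast_mem O3 _)), by
        push_cast at e'' ⊢
        linear_combination -e'' + x * e' + f y * e⟩
    simpa using this
  · obtain ⟨d, hd, e⟩ := hf 0
    have := uniq 0 (f 0) ⟨d, hd, by simpa using e⟩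
    simpa using this.symm
  · intro x y
    obtain ⟨d, hd, e⟩ := hf x
    obtain ⟨d', hd', e'⟩ := hf y
    obtain ⟨d'', hd'', e''⟩ := hf (x + y)
    have := uniq (f (x + y)) (f x + f y)
      ⟨-d'' + d' + d, O3.add_mem (O3.add_mem (O3.neg_mem hd'') hd') hd, by
        push_cast at e'' ⊢
        linear_combination -e'' + e' + e⟩
    simpa using this
  · intro z
    obtain ⟨d, hd, e⟩ := hf z
    change ((f z : ℤ) : ZMod p) = 0 ↔ _
    constructor
    · intro h0
      obtain ⟨k, hk⟩ := (ZMod.intCast_zmod_eq_zero_iff_dvd (f z) p).1 h0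
      refine ⟨d + (starRingEnd ℂ) π * k, O3.add_mem hd (O3.mul_mem (conj_mem_O3 h.mem)
        (intCast_mem O3 _)), ?_⟩
      have : (f z : ℂ) = p * k := by exact_mod_cast hk
      linear_combination e + this - k * h.norm
    · rintro ⟨d', hd', e'⟩
      have := uniq (f z) 0 ⟨d' - d, O3.sub_mem hd' hd, by push_cast; linear_combination e' - e⟩
      simpa using this

end PrimaryPrime

section residues

variable {p : ℕ} {π : ℂ} [Fact p.Prime] {t : O3 →+* ZMod p}

/-- The `π`-division point attached to a residue class. -/
def dpt (π : ℂ) (x : ZMod p) : ℂ := (x.val : ℂ) / π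

lemma exists_dpt_res (ht : IsResHom π t) (h : PrimaryPrime p π) (z : O3) :
    ∃ l ∈ O3, (z : ℂ) / π = dpt π (t z) + l := by
  have h0 : t (z - ((t z).val : O3)) = 0 := by
    rw [map_sub, map_natCast, ZMod.natCast_zmod_val, sub_self]
  obtain ⟨d, hd, e⟩ := (ht _).1 h0
  refine ⟨d, hd, ?_⟩
  have hpi := h.ne_zero
  push_cast at e
  rw [dpt]
  field_simp
  linear_combination e

lemma dpt_mem_iff (ht : IsResHom π t) (h : PrimaryPrime p π) (z : O3) :
    (z : ℂ) / π ∈ O3 ↔ t z = 0 := by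
  rw [ht]
  have hpi := h.ne_zero
  constructor
  · intro hz; exact ⟨_, hz, by field_simp⟩
  · rintro ⟨d, hd, e⟩
    rw [e, mul_div_cancel_left₀ _ hpi]; exact hd

lemma exists_dpt_add (ht : IsResHom π t) (h : PrimaryPrime p π) (x : ZMod p) (z : O3) :
    ∃ l ∈ O3, dpt π x + (z : ℂ) / π = dpt π (x + t z) + l := by
  have := exists_dpt_res ht h ((x.val : O3) + z)
  rw [map_add, map_natCast, ZMod.natCast_zmod_val] at this
  obtain ⟨l, hl, e⟩ := this
  refine ⟨l, hl, ?_⟩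
  rw [← e, dpt]; push_cast; ring

lemma exists_dpt_mul (ht : IsResHom π t) (h : PrimaryPrime p π) (x : ZMod p) (z : O3) :
    ∃ l ∈ O3, (z : ℂ) * dpt π x = dpt π (t z * x) + l := by
  have := exists_dpt_res ht h (z * (x.val : O3))
  rw [map_mul, map_natCast, ZMod.natCast_zmod_val] at this
  obtain ⟨l, hl, e⟩ := this
  refine ⟨l, hl, ?_⟩
  rw [← e, dpt]; push_cast; ring

lemma mul_dpt_mem_iff (ht : IsResHom π t) (h : PrimaryPrime p π) (x : ZMod p) (z : O3) :
    (z : ℂ) * dpt π x ∈ O3 ↔ t z * x = 0 := by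
  have := dpt_mem_iff ht h (z * (x.val : O3))
  rw [map_mul, map_natCast, ZMod.natCast_zmod_val] at this
  rw [← this, dpt]; push_cast; rw [mul_div_assoc]

lemma resHom_three_ne (h : PrimaryPrime p π) : t 3 ≠ 0 := by
  have hp3 : p ≠ 3 := fun e => by have := h.mod_three; rw [e] at this; norm_num at this
  have : t 3 = ((3 : ℕ) : ZMod p) := by rw [← map_natCast t]; rfl
  rw [this, Ne, ZMod.natCast_eq_zero_iff]
  intro hd
  exact hp3 ((Nat.prime_dvd_prime_iff_eq Fact.out Nat.prime_three).1 hd)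

lemma three_dpt_notMem (ht : IsResHom π t) (h : PrimaryPrime p π) {x : ZMod p}
    (hx : x ≠ 0) : 3 * dpt π x ∉ O3 := by
  have e : 3 * dpt π x ∈ O3 ↔ _ := mul_dpt_mem_iff ht h x 3
  rw [e]
  exact mul_ne_zero (resHom_three_ne h) hx

lemma dpt_notMem (ht : IsResHom π t) (h : PrimaryPrime p π) {x : ZMod p}
    (hx : x ≠ 0) : dpt π x ∉ O3 := by
  have := mul_dpt_mem_iff ht h x 1
  push_cast at this
  rw [one_mul] at this
  rw [this, map_one, one_mul]; exact hx

lemma dpt_zero : dpt π (0 : ZMod p) = 0 := by simp [dpt]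

end residues

section torsion

variable {p : ℕ} {π : ℂ} [Fact p.Prime] {t : O3 →+* ZMod p}

/-- The value of `φ` at a `π`-division point. -/
def Phi (π : ℂ) {p : ℕ} (x : ZMod p) : ℂ := PH (dpt π x)

lemma PH_div_eq (ht : IsResHom π t) (h : PrimaryPrime p π) (z : O3) :
    PH ((z : ℂ) / π) = Phi π (t z) := by
  obtain ⟨l, hl, e⟩ := exists_dpt_res ht h z
  rw [e, PH_add hl, Phi]

lemma PH_add_dpt (ht : IsResHom π t) (h : PrimaryPrime p π) (u : ℂ) (x : ZMod p) (z : O3) :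
    PH (u + z / π + dpt π x) = PH (u + dpt π (x + t z)) := by
  obtain ⟨l, hl, e⟩ := exists_dpt_add ht h x z
  rw [add_assoc, add_comm ((z : ℂ) / π), e, ← add_assoc, PH_add hl]

lemma isUnit_sqrtm3_third : ¬ sqrtm3 * (2 / 3) ∈ O3 := fun h => sqrtm3_div_three (by
  have := O3.sub_mem sqrtm3_mem h
  convert this using 1; ring)

/-- Splitting a `√−3·π`-division point. -/
lemma exists_split (h : PrimaryPrime p π) {l : ℂ} (hl : l ∈ O3) :
    ∃ z : O3, l / (sqrtm3 * π) = l / sqrtm3 + z / π := by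
  obtain ⟨d, hd, e⟩ := h.primary
  have hpi := h.ne_zero
  have hs := sqrtm3_ne_zero
  refine ⟨⟨sqrtm3 * d * l, O3.mul_mem (O3.mul_mem sqrtm3_mem hd) hl⟩, ?_⟩
  field_simp
  rw [sqrtm3_sq, e]; ring

/-- `∏_ν φ(u + ν/π)`. -/
def prodPhi (p : ℕ) [Fact p.Prime] (π u : ℂ) : ℂ := ∏ x : ZMod p, PH (u + dpt π x)

lemma prodPhi_add (ht : IsResHom π t) (h : PrimaryPrime p π) (u : ℂ) (z : O3) :
    prodPhi p π (u + z / π) = prodPhi p π u := by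
  exact Fintype.prod_equiv (Equiv.addRight (t z)) _ _ fun x => PH_add_dpt ht h u x z

lemma root_pow_p (h : PrimaryPrime p π) {ω : ℂ} (hω : ω ^ 3 = 1) : ω ^ p = ω := by
  have := h.mod_three
  obtain ⟨k, hk⟩ : ∃ k, p = 3 * k + 1 := ⟨p / 3, by omega⟩
  rw [hk, pow_succ, pow_mul, hω, one_pow, one_mul]

lemma not_pole_of (h : PrimaryPrime p π) {u : ℂ} (hu : sqrtm3 * π * (u - 1 / (3 * π)) ∉ O3)
    (x : ZMod p) : sqrtm3 * (u + dpt π x - 1 / 3) ∉ O3 := by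
  intro hx
  apply hu
  obtain ⟨d, hd, e⟩ := h.primary
  have hpi := h.ne_zero
  have := O3.add_mem (O3.mul_mem h.mem hx) (O3.mul_mem sqrtm3_mem (O3.sub_mem hd
    (natCast_mem O3 x.val)))
  convert this using 1
  have hd' : d = (π - 1) / 3 := by rw [e]; ring
  rw [dpt, hd']
  field_simp
  ring

/-- At the base pole only one factor is singular. -/
lemma not_pole_base (ht : IsResHom π t) (h : PrimaryPrime p π) {d : O3} (e : π = 1 + 3 * d)
    {x : ZMod p} (hx : x ≠ t d) : sqrtm3 * (1 / (3 * π) + dpt π x - 1 / 3) ∉ O3 := by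
  intro hm
  have hpi := h.ne_zero
  have e1 : 1 / (3 * π) - 1 / 3 = ((-d : O3) : ℂ) / π := by
    push_cast; field_simp; rw [e]; ring
  obtain ⟨l, hl, e2⟩ := exists_dpt_add ht h x (-d)
  have e3 : 1 / (3 * π) + dpt π x - 1 / 3 = dpt π (x + t (-d)) + l := by
    rw [← e2, ← e1]; ring
  rw [e3] at hm
  have hne : x + t (-d) ≠ 0 := by
    rw [map_neg, ← sub_eq_add_neg]; exact sub_ne_zero.2 hx
  apply three_dpt_notMem ht h hne
  have := O3.sub_mem (three_mul_mem_of_sqrtm3 hm) (O3.mul_mem three_mem hl)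
  convert this using 1
  ring

lemma tendsto_shift {a b : ℂ} : Filter.Tendsto (fun z => z + a) (nhdsWithin b {b}ᶜ)
    (nhdsWithin (b + a) {b + a}ᶜ) :=
  tendsto_nhdsWithin_iff.2 ⟨((continuous_id.add continuous_const).tendsto b).mono_left
    nhdsWithin_le_nhds, by
      filter_upwards [self_mem_nhdsWithin] with z hz hz2
      exact hz (add_right_cancel hz2)⟩

lemma tendsto_scale {c b : ℂ} (hc : c ≠ 0) : Filter.Tendsto (fun z => c * z) (nhdsWithin b {b}ᶜ)
    (nhdsWithin (c * b) {c * b}ᶜ) :=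
  tendsto_nhdsWithin_iff.2 ⟨((continuous_const.mul continuous_id).tendsto b).mono_left
    nhdsWithin_le_nhds, by
      filter_upwards [self_mem_nhdsWithin] with z hz hz2
      exact hz (mul_left_cancel₀ hc hz2)⟩

/-- Residue of the `d`-th factor at the base pole. -/
lemma tendsto_factor_base (ht : IsResHom π t) (h : PrimaryPrime p π) {d : O3} (e : π = 1 + 3 * d) :
    Filter.Tendsto (fun u => (u - 1 / (3 * π)) * PH (u + dpt π (t d)))
      (nhdsWithin (1 / (3 * π)) {1 / (3 * π)}ᶜ) (nhds (1 / (3 * varpi1))) := by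
  have hpi := h.ne_zero
  have e1 : 1 / (3 * π) + d / π = 1 / 3 := by
    field_simp; rw [e]
  have := tendsto_PH_third.comp (e1 ▸ tendsto_shift (a := d / π) (b := 1 / (3 * π)))
  refine this.congr fun u => ?_
  have e2 := PH_add_dpt ht h u 0 d
  rw [dpt_zero, zero_add, add_zero] at e2
  simp only [Function.comp_apply]
  rw [e2, ← e1]; ring

lemma tendsto_scaled_base (h : PrimaryPrime p π) :
    Filter.Tendsto (fun u => (u - 1 / (3 * π)) * PH (π * u))
      (nhdsWithin (1 / (3 * π)) {1 / (3 * π)}ᶜ) (nhds (1 / (3 * varpi1) / π)) := by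
  have hpi := h.ne_zero
  have e1 : π * (1 / (3 * π)) = 1 / 3 := by field_simp
  have := (tendsto_PH_third.comp (e1 ▸ tendsto_scale (b := 1 / (3 * π)) hpi)).div_const π
  refine this.congr fun u => ?_
  simp only [Function.comp_apply]
  field_simp

theorem exists_prodPhi_eq (ht : IsResHom π t) (h : PrimaryPrime p π) :
    ∃ k, ∀ u, sqrtm3 * π * (u - 1 / (3 * π)) ∉ O3 → prodPhi p π u = k * PH (π * u) := by
  classical
  obtain ⟨d, hd, e⟩ := h.primary
  lift d to O3 using hd
  have hpi := h.ne_zero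
  have hv := varpi1_ne
  have hc : sqrtm3 * π ≠ 0 := mul_ne_zero sqrtm3_ne_zero hpi
  set k1 := ∏ x ∈ Finset.univ.erase (t d), PH (1 / (3 * π) + dpt π x) with hk1
  have hdiff : ∀ u, sqrtm3 * π * (u - 1 / (3 * π)) ∉ O3 →
      DifferentiableAt ℂ (fun u => PH (π * u)) u := fun u hu => by
    apply (differentiableAt_PH (u := π * u) _).fun_comp' u (by fun_prop)
    intro h0; apply hu; convert h0 using 1; field_simp
  have hper : ∀ l ∈ O3, ∃ ω : ℂ, ω ^ 3 = 1 ∧ ∀ u,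
      prodPhi p π (u + l / (sqrtm3 * π)) = ω * prodPhi p π u ∧
      PH (π * (u + l / (sqrtm3 * π))) = ω * PH (π * u) ∧ ∀ u, PH (u + l / sqrtm3) = ω * PH u := by
    intro l hl
    obtain ⟨ω, h1, h2⟩ := PH_add_of_sqrtm3_mul_mem (v := l / sqrtm3)
      (by rwa [mul_div_cancel₀ _ sqrtm3_ne_zero])
    obtain ⟨z, hz⟩ := exists_split h hl
    refine ⟨ω, h1, fun u => ⟨?_, ?_, h2⟩⟩
    · rw [hz, ← add_assoc, prodPhi_add ht h, prodPhi, prodPhi]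
      nth_rewrite 1 [← root_pow_p h h1]
      have hcard : ω ^ p = ∏ _x : ZMod p, ω := by
        rw [Finset.prod_const, Finset.card_univ, ZMod.card]
      rw [hcard, ← Finset.prod_mul_distrib]
      refine Finset.prod_congr rfl fun x _ => ?_
      rw [add_right_comm, h2]
    · have : π * (u + l / (sqrtm3 * π)) = π * u + l / sqrtm3 := by
        have := sqrtm3_ne_zero
        field_simp
      rw [this, h2]
  obtain ⟨C, hC⟩ := liouville_coset hc (b := 1 / (3 * π))
    (fun u => prodPhi p π u - k1 * π * PH (π * u)) (fun u hu => by
      refine DifferentiableAt.sub ?_ ((hdiff u hu).const_mul _)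
      unfold prodPhi
      exact DifferentiableAt.fun_finsetProd fun x _ =>
        (differentiableAt_PH (not_pole_of h hu x)).fun_comp' u (by fun_prop))
    (fun u _ l hl => by
      obtain ⟨ω, h1, h2⟩ := hper l hl
      have : ‖ω‖ = 1 := by
        have : ‖ω‖ ^ 3 = 1 := by rw [← norm_pow, h1, norm_one]
        exact (pow_eq_one_iff_of_nonneg (norm_nonneg _) (by norm_num)).1 this
      rw [(h2 u).1, (h2 u).2.1, mul_left_comm, ← mul_sub, norm_mul, this, one_mul])
    (by
      have l1 : Filter.Tendsto (fun u => (u - 1 / (3 * π)) * prodPhi p π u)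
          (nhdsWithin (1 / (3 * π)) {1 / (3 * π)}ᶜ) (nhds (1 / (3 * varpi1) * k1)) := by
        have : Filter.Tendsto (fun u => ∏ x ∈ Finset.univ.erase (t d), PH (u + dpt π x))
            (nhdsWithin (1 / (3 * π)) {1 / (3 * π)}ᶜ) (nhds k1) :=
          tendsto_finsetProd _ fun x hx =>
            ((differentiableAt_PH (not_pole_base ht h e (Finset.ne_of_mem_erase hx))).fun_comp'
              (f := fun u => u + dpt π x) (1 / (3 * π))
              (by fun_prop)).continuousAt.tendsto.mono_left nhdsWithin_le_nhds
        refine ((tendsto_factor_base ht h e).mul this).congr fun u => ?_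
        rw [prodPhi, ← Finset.mul_prod_erase _ _ (Finset.mem_univ (t d)), mul_assoc]
      have l2 := l1.sub ((tendsto_scaled_base h).const_mul (k1 * π))
      have e0 : 1 / (3 * (varpi1 : ℂ)) * k1 - k1 * π * (1 / (3 * varpi1) / π) = 0 := by
        field_simp; ring
      rw [e0] at l2
      refine l2.congr fun u => by ring)
  refine ⟨k1 * π, fun u hu => ?_⟩
  have hs := sqrtm3_ne_zero
  obtain ⟨ω, h1, h2⟩ := hper (sqrtm3 * A1) (by rw [sqrtm3_A1]; exact O3.pow_mem rho3_mem 2)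
  have hω : ω ≠ 1 := by
    rintro rfl
    have h3 := (h2 0).2.2 (-1 / 3)
    rw [mul_div_cancel_left₀ _ hs, PH_add_A1, PH_neg_third] at h3
    exact rho3_ne_one (by linear_combination rho3_cube - ρ3 * h3)
  have hu' : sqrtm3 * π * (u + sqrtm3 * A1 / (sqrtm3 * π) - 1 / (3 * π)) ∉ O3 := fun hm => hu (by
    have := O3.sub_mem hm (by rw [sqrtm3_A1]; exact O3.pow_mem rho3_mem 2 : sqrtm3 * A1 ∈ O3)
    convert this using 1
    field_simp
    ring)
  have c1 := hC u hu
  have c2 := hC _ hu'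
  simp only [(h2 u).1, (h2 u).2.1] at c1 c2
  have : (ω - 1) * (prodPhi p π u - k1 * π * PH (π * u)) = 0 := by linear_combination c2 - c1
  exact sub_eq_zero.1 ((mul_eq_zero.1 this).resolve_left (sub_ne_zero.2 hω))

lemma prodPhi_neg_third (ht : IsResHom π t) (h : PrimaryPrime p π) : prodPhi p π (-1 / 3) = 1 := by
  unfold prodPhi
  refine Finset.prod_involution (fun x _ => -x) (fun x _ => ?_) (fun x _ hx hx2 => hx ?_)
    (fun _ _ => Finset.mem_univ _) (fun x _ => neg_neg x)
  · by_cases hx : x = 0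
    · rw [hx, neg_zero, dpt_zero, add_zero, PH_neg_third, one_mul]
    · have hs := PH_mul_symm (three_dpt_notMem ht h hx)
      obtain ⟨l, hl, e⟩ := exists_dpt_mul ht h x (-1)
      rw [map_neg, map_one, neg_one_mul] at e
      have e' : -dpt π x = dpt π (-x) + l := by rw [← e]; push_cast; ring
      rw [e', ← add_assoc, PH_add hl] at hs
      exact hs
  · have h2 : (2 : ZMod p) ≠ 0 := by
      have : (2 : ZMod p) = ((2 : ℕ) : ZMod p) := by norm_num
      rw [this, Ne, ZMod.natCast_eq_zero_iff, Nat.prime_dvd_prime_iff_eq Fact.out Nat.prime_two]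
      intro hp
      have := h.mod_three
      rw [hp] at this; norm_num at this
    have : x = 0 := by
      have : 2 * x = 0 := by linear_combination -hx2
      exact (mul_eq_zero.1 this).resolve_left h2
    rw [this, dpt_zero, add_zero, PH_neg_third]

/-- The multiplication-by-`π` formula for `φ`. -/
theorem prodPhi_eq (ht : IsResHom π t) (h : PrimaryPrime p π) {u : ℂ}
    (hu : sqrtm3 * π * (u - 1 / (3 * π)) ∉ O3) : prodPhi p π u = PH (π * u) := by
  obtain ⟨k, hk⟩ := exists_prodPhi_eq ht h
  obtain ⟨d, hd, e⟩ := h.primary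
  have hpi := h.ne_zero
  have h1 := hk (-1 / 3) (fun hm => by
    apply isUnit_sqrtm3_third
    have := O3.neg_mem (O3.add_mem hm (O3.mul_mem sqrtm3_mem hd))
    convert this using 1
    field_simp
    rw [e]; ring)
  have e2 : π * (-1 / 3) = -1 / 3 + -d := by rw [e]; ring
  rw [prodPhi_neg_third ht h, e2, PH_add (O3.neg_mem hd), PH_neg_third, mul_one] at h1
  rw [hk u hu, ← h1, one_mul]

lemma exists_hasDerivAt_PH_zero : ∃ c : ℂ, c ≠ 0 ∧ HasDerivAt PH c 0 := by
  have h9 : 9 + EW A1 ≠ 0 := by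
    rw [EW_A1]
    intro h0
    have : (12 : ℂ) = 0 := by
      linear_combination (3 - sqrtm3) / 3 * h0 + sqrtm3_sq
    norm_num at this
  have hv := varpi1_ne
  have h1 : HasDerivAt (fun u => 6 * EX u / (9 + EW u)) (6 * varpi1 * EW A1 / (9 + EW A1)) A1 := by
    refine (((hasDerivAt_EX A1_notMem).const_mul 6).div
      ((hasDerivAt_EW A1_notMem).const_add 9) h9).congr_deriv ?_
    rw [EX_A1]
    field_simp
    ring
  have h2 : HasDerivAt PH (6 * varpi1 * EW A1 / (9 + EW A1)) (0 + A1) := by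
    rw [zero_add]
    refine h1.congr_of_eventuallyEq ?_
    filter_upwards [isOpen_compl_O3.mem_nhds A1_notMem] with z hz
    exact PH_of_notMem hz
  have h4 : PH = fun z => ρ3 * PH (z + A1) := by
    funext z; rw [PH_add_A1]; linear_combination (-PH z) * rho3_cube
  refine ⟨ρ3 * (6 * varpi1 * EW A1 / (9 + EW A1)), ?_, ?_⟩
  · have hW : EW A1 ≠ 0 := by rw [EW_A1]; exact mul_ne_zero (by norm_num) sqrtm3_ne_zero
    exact mul_ne_zero rho3_ne_zero (div_ne_zero (mul_ne_zero (mul_ne_zero (by norm_num) hv) hW) h9)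
  · rw [h4]
    exact (h2.comp_add_const 0 A1).const_mul ρ3

/-- The product of all nonzero division values. -/
theorem prod_Phi (ht : IsResHom π t) (h : PrimaryPrime p π) :
    ∏ x ∈ Finset.univ.erase (0 : ZMod p), Phi π x = π := by
  classical
  obtain ⟨c, hc, hd⟩ := exists_hasDerivAt_PH_zero
  have hpi := h.ne_zero
  have hc2 : sqrtm3 * π ≠ 0 := mul_ne_zero sqrtm3_ne_zero hpi
  have h0 : sqrtm3 * π * (0 - 1 / (3 * π)) ∉ O3 := fun hm => sqrtm3_div_three (by
    have := O3.neg_mem hm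
    convert this using 1
    field_simp; ring)
  have hcont : Filter.Tendsto (fun u => ∏ x ∈ Finset.univ.erase (0 : ZMod p), PH (u + dpt π x))
      (nhdsWithin 0 {0}ᶜ) (nhds (∏ x ∈ Finset.univ.erase (0 : ZMod p), Phi π x)) := by
    refine tendsto_finsetProd _ fun x hx => ?_
    have h2 : sqrtm3 * (0 + dpt π x - 1 / 3) ∉ O3 := not_pole_of h h0 x
    have := ((differentiableAt_PH h2).fun_comp' (f := fun u => u + dpt π x) 0
              (by fun_prop)).continuousAt.tendsto.mono_left (nhdsWithin_le_nhds (s := {0}ᶜ))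
    rwa [zero_add] at this
  have s1 := hasDerivAt_iff_tendsto_slope.1 hd
  have s2 := hasDerivAt_iff_tendsto_slope.1
    (HasDerivAt.comp (0 : ℂ) (h₂ := PH) (h := fun z => π * z) (by rwa [mul_zero])
      ((hasDerivAt_id (0 : ℂ)).const_mul π))
  have l1 := s1.mul hcont
  have l2 := l1.congr' (f₂ := slope (PH ∘ fun z => π * z) 0) (by
    filter_upwards [eventually_notMem_coset hc2 (1 / (3 * π)) 0, self_mem_nhdsWithin] with u hu hu0
    have := prodPhi_eq ht h hu
    rw [prodPhi, ← Finset.mul_prod_erase _ _ (Finset.mem_univ (0 : ZMod p)), dpt_zero, add_zero]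
      at this
    rw [slope_def_field, slope_def_field, PH_zero, Function.comp_apply, Function.comp_apply,
      mul_zero, PH_zero, ← this]
    ring)
  have := tendsto_nhds_unique l2 s2
  apply mul_left_cancel₀ hc
  rw [this]; ring

end torsion

/-! ### The additive character -/

lemma sqrt3_ne : ((Real.sqrt 3 : ℝ) : ℂ) ≠ 0 := by
  have : (0 : ℝ) < Real.sqrt 3 := by positivity
  exact_mod_cast this.ne'

lemma eS3_coord (a b : ℝ) : eS3 (a + b * ρ3) = Complex.exp (2 * Real.pi * I * ((a - b : ℝ) : ℂ)) := by
  rw [eS3]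
  congr 1
  have h1 : ((a : ℂ) + b * ρ3) * ρ3 - (starRingEnd ℂ) (a + b * ρ3) * (starRingEnd ℂ) ρ3 =
      (a - b) * sqrtm3 := by
    simp only [map_add, map_mul, Complex.conj_ofReal, conj_rho3]
    rw [sqrtm3_eq]
    linear_combination (-b * ρ3) * rho3_cube + b * rho3_sq - b * rho3_sq
  rw [h1, sqrtm3]
  have := sqrt3_ne
  push_cast
  field_simp

lemma eS3_add (z w : ℂ) : eS3 (z + w) = eS3 z * eS3 w := by
  rw [eS3, eS3, eS3, ← Complex.exp_add]
  congr 1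
  rw [map_add]; ring

lemma eS3_zero : eS3 0 = 1 := by simp [eS3]

lemma eS3_of_mem {z : ℂ} (h : z ∈ O3) : eS3 z = 1 := by
  obtain ⟨a, b, rfl⟩ := mem_O3.1 h
  have := eS3_coord a b
  push_cast at this
  rw [this, Complex.exp_eq_one_iff]
  exact ⟨a - b, by push_cast; ring⟩

lemma eS3_neg (z : ℂ) : eS3 (-z) = (eS3 z)⁻¹ := by
  exact eq_inv_of_mul_eq_one_left (by rw [← eS3_add, neg_add_cancel, eS3_zero])

lemma eS3_symm (z : ℂ) : eS3 (-ρ3 * (starRingEnd ℂ) z) = eS3 z := by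
  rw [eS3, eS3]
  congr 2
  simp only [map_mul, map_neg, Complex.conj_conj, conj_rho3]
  linear_combination z * ρ3 * rho3_cube

lemma conj_eS3 (z : ℂ) : (starRingEnd ℂ) (eS3 z) = eS3 (-z) := by
  rw [eS3, eS3, ← Complex.exp_conj]
  congr 1
  simp only [map_mul, map_sub, Complex.conj_conj, Complex.conj_ofReal, map_neg]
  ring

lemma norm_eS3 (z : ℂ) : ‖eS3 z‖ = 1 := by
  have : ((‖eS3 z‖ ^ 2 : ℝ) : ℂ) = 1 := by
    rw [← Complex.normSq_eq_norm_sq, Complex.normSq_eq_conj_mul_self, conj_eS3, ← eS3_add,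
      neg_add_cancel, eS3_zero]
  have : ‖eS3 z‖ ^ 2 = 1 := by exact_mod_cast this
  exact (pow_eq_one_iff_of_nonneg (norm_nonneg _) (by norm_num)).1 this

/-! ### A Lambert-type series -/

/-- `∑_{n ≥ 0} aⁿ / (1 - x qⁿ)`. -/
def lamb (q a x : ℂ) : ℂ := ∑' n : ℕ, a ^ n / (1 - x * q ^ n)

lemma tendsto_lamb_denominator {q : ℂ} (hq : ‖q‖ < 1) (x : ℂ) :
    Filter.Tendsto (fun n : ℕ => ‖1 - x * q ^ n‖) Filter.atTop (nhds 1) := by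
  have h := (tendsto_pow_atTop_nhds_zero_of_norm_lt_one hq).const_mul x
  rw [mul_zero] at h
  have := (h.const_sub 1).norm
  simpa using this

lemma summable_lamb {q a : ℂ} (hq : ‖q‖ < 1) (ha : ‖a‖ < 1) (x : ℂ) :
    Summable fun n : ℕ => a ^ n / (1 - x * q ^ n) := by
  have hs : Summable fun n : ℕ => 2 * ‖a‖ ^ n :=
    (summable_geometric_of_lt_one (norm_nonneg _) ha).mul_left 2
  refine Summable.of_norm_bounded_eventually_nat hs ?_
  filter_upwards [(tendsto_lamb_denominator hq x).eventually (lt_mem_nhds (by norm_num : (1/2 : ℝ) < 1))]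
    with n hn
  rw [norm_div, norm_pow, div_le_iff₀ (by linarith)]
  have := pow_nonneg (norm_nonneg a) n
  nlinarith

lemma lamb_succ {q a : ℂ} (hq : ‖q‖ < 1) (ha : ‖a‖ < 1) (x : ℂ) :
    lamb q a x = 1 / (1 - x) + a * lamb q a (q * x) := by
  rw [lamb, (summable_lamb hq ha x).tsum_eq_zero_add, lamb, ← tsum_mul_left]
  congr 1
  · simp
  · refine tsum_congr fun n => ?_
    rw [pow_succ, pow_succ, mul_div_assoc', mul_comm a]
    congr 2; ring

lemma differentiableAt_lamb_of_norm_lt {q a : ℂ} (hq : ‖q‖ < 1) (ha : ‖a‖ < 1) {x : ℂ} (hx : ‖x‖ < 1) :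
    DifferentiableAt ℂ (lamb q a) x := by
  obtain ⟨r, h1, h2⟩ := exists_between hx
  have h0 : ∀ n : ℕ, ∀ w ∈ Metric.ball (0 : ℂ) r, 1 - r ≤ ‖1 - w * q ^ n‖ := by
    intro n w hw
    rw [mem_ball_zero_iff] at hw
    have e1 : ‖w * q ^ n‖ ≤ ‖w‖ := by
      rw [norm_mul, norm_pow]
      exact mul_le_of_le_one_right (norm_nonneg _) (pow_le_one₀ (norm_nonneg _) hq.le)
    have e2 := norm_sub_norm_le 1 (w * q ^ n)
    rw [norm_one] at e2
    linarith
  have hr : 0 < 1 - r := by linarith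
  have : DifferentiableOn ℂ (fun w => ∑' n : ℕ, a ^ n / (1 - w * q ^ n)) (Metric.ball 0 r) := by
    refine differentiableOn_tsum_of_summable_norm (u := fun n => ‖a‖ ^ n / (1 - r))
      ((summable_geometric_of_lt_one (norm_nonneg _) ha).div_const _) (fun n => ?_) Metric.isOpen_ball
      (fun n w hw => ?_)
    · refine DifferentiableOn.div (by fun_prop) (by fun_prop) fun w hw h3 => ?_
      have := h0 n w hw
      rw [h3, norm_zero] at this; linarith
    · rw [norm_div, norm_pow]
      exact div_le_div_of_nonneg_left (pow_nonneg (norm_nonneg _) n) hr (h0 n w hw)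
  exact this.differentiableAt (Metric.isOpen_ball.mem_nhds (by rwa [mem_ball_zero_iff]))

lemma differentiableAt_lamb {q a : ℂ} (hq : ‖q‖ < 1) (ha : ‖a‖ < 1) {x : ℂ}
    (hx : ∀ n : ℕ, x * q ^ n ≠ 1) : DifferentiableAt ℂ (lamb q a) x := by
  have key : ∀ k : ℕ, ∀ x : ℂ, ‖x * q ^ k‖ < 1 → (∀ n : ℕ, x * q ^ n ≠ 1) →
      DifferentiableAt ℂ (lamb q a) x := by
    intro k
    induction k with
    | zero => intro x h _; exact differentiableAt_lamb_of_norm_lt hq ha (by simpa using h)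
    | succ k ih =>
      intro x h h2
      have e : lamb q a = fun x => 1 / (1 - x) + a * lamb q a (q * x) :=
        funext fun x => lamb_succ hq ha x
      rw [e]
      have h3 := ih (q * x) (by rwa [mul_comm q, mul_assoc, ← pow_succ'])
        (fun n => by rw [mul_comm q, mul_assoc, ← pow_succ']; exact h2 _)
      have h4 : 1 - x ≠ 0 := fun h0 => h2 0 (by linear_combination -h0)
      have h5 : DifferentiableAt ℂ (fun x => lamb q a (q * x)) x := h3.fun_comp' x (by fun_prop)
      exact ((differentiableAt_const _).div (by fun_prop) h4).add (h5.const_mul a)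
  have h := (tendsto_pow_atTop_nhds_zero_of_norm_lt_one hq).const_mul x
  rw [mul_zero] at h
  obtain ⟨k, hk⟩ := (h.norm.eventually (gt_mem_nhds (by simp : ‖(0:ℂ)‖ < 1))).exists
  exact key k x hk hx

lemma lamb_symm {q x y : ℂ} (hq : ‖q‖ < 1) (hx : ‖x‖ < 1) (hy : ‖y‖ < 1) :
    lamb q y x = lamb q x y := by
  have hg : ∀ {x y : ℂ}, ‖x‖ < 1 → ∀ n : ℕ,
      y ^ n / (1 - x * q ^ n) = ∑' k : ℕ, y ^ n * x ^ k * q ^ (n * k) := by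
    intro x y hx n
    have hb : ‖x * q ^ n‖ < 1 := by
      rw [norm_mul, norm_pow]
      exact mul_lt_one_of_nonneg_of_lt_one_left (norm_nonneg _) hx (pow_le_one₀ (norm_nonneg _) hq.le)
    rw [div_eq_mul_inv, ← tsum_geometric_of_norm_lt_one hb, ← tsum_mul_left]
    refine tsum_congr fun k => ?_
    rw [mul_pow, pow_mul]; ring
  have hs : Summable (Function.uncurry fun n k : ℕ => y ^ n * x ^ k * q ^ (n * k)) := by
    have h0 := (summable_geometric_of_lt_one (norm_nonneg _) hy).mul_of_nonneg
      (summable_geometric_of_lt_one (norm_nonneg _) hx)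
      (fun _ => pow_nonneg (norm_nonneg _) _) (fun _ => pow_nonneg (norm_nonneg _) _)
    refine Summable.of_norm_bounded h0 fun ⟨n, k⟩ => ?_
    simp only [Function.uncurry, norm_mul, norm_pow]
    exact mul_le_of_le_one_right (by positivity) (pow_le_one₀ (norm_nonneg _) hq.le)
  rw [lamb, lamb, tsum_congr (hg hx), ← hs.tsum_comm]
  refine tsum_congr fun n => ?_
  rw [hg hy]
  refine tsum_congr fun k => ?_
  rw [mul_comm k n]; ring

/-! ### The Kronecker function -/

/-- `∑_{n ∈ ℤ} yⁿ / (1 - x qⁿ)`. -/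
def kronA (q y x : ℂ) : ℂ := lamb q y x - q / (y * x) * lamb q (q / y) (q / x)

lemma kronA_mul {q x y : ℂ} (hq : ‖q‖ < 1) (hy : ‖y‖ < 1) (hqy : ‖q / y‖ < 1) (hq0 : q ≠ 0)
    (hy0 : y ≠ 0) (hx0 : x ≠ 0) (hx : x ≠ 1) : kronA q y (q * x) = y⁻¹ * kronA q y x := by
  have h1 := lamb_succ hq hy x
  have h2 := lamb_succ hq hqy (1 / x)
  have e1 : q / (q * x) = 1 / x := by field_simp
  have e2 : q * (1 / x) = q / x := by ring
  have e3 : lamb q y (q * x) = y⁻¹ * (lamb q y x - 1 / (1 - x)) := by rw [h1]; field_simp; ring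
  have hx1 : 1 - x ≠ 0 := sub_ne_zero.2 hx.symm
  have hx2 : x - 1 ≠ 0 := sub_ne_zero.2 hx
  have e4 : 1 / (1 - 1 / x) = -x / (1 - x) := by
    have : 1 - 1 / x = -(1 - x) / x := by field_simp; ring
    rw [this]; field_simp
  rw [kronA, kronA, e1, h2, e2, e3, e4]
  field_simp
  ring

lemma kronA_symm {q x y : ℂ} (hq : ‖q‖ < 1) (hx : ‖x‖ < 1) (hy : ‖y‖ < 1) (hqx : ‖q / x‖ < 1)
    (hqy : ‖q / y‖ < 1) : kronA q y x = kronA q x y := by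
  rw [kronA, kronA, lamb_symm hq hx hy, lamb_symm hq hqx hqy, mul_comm x y]

/-- `e^{2πiz}`. -/
def ee (z : ℂ) : ℂ := Complex.exp (2 * Real.pi * I * z)

lemma ee_add (z w : ℂ) : ee (z + w) = ee z * ee w := by rw [ee, ee, ee, ← Complex.exp_add]; congr 1; ring

lemma ee_ne_zero (z : ℂ) : ee z ≠ 0 := Complex.exp_ne_zero _

lemma ee_neg (z : ℂ) : ee (-z) = (ee z)⁻¹ := by rw [ee, ee, ← Complex.exp_neg]; congr 1; ring

lemma ee_eq_one {z : ℂ} : ee z = 1 ↔ ∃ n : ℤ, z = n := by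
  rw [ee, Complex.exp_eq_one_iff]
  refine exists_congr fun n => ?_
  rw [mul_comm, mul_left_inj' Complex.two_pi_I_ne_zero]

lemma ee_one : ee 1 = 1 := ee_eq_one.2 ⟨1, by simp⟩

lemma norm_ee (z : ℂ) : ‖ee z‖ = Real.exp (-(2 * Real.pi * z.im)) := by
  rw [ee, Complex.norm_exp]; congr 1; simp

/-- The `ρ`-coordinate. -/
def cρ (w : ℂ) : ℝ := 2 * w.im / Real.sqrt 3

lemma cρ_coord (a b : ℝ) : cρ (a + b * ρ3) = b := by
  have : Real.sqrt 3 ≠ 0 := by positivity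
  rw [cρ, rho3_coord_im]; field_simp

lemma norm_ee_coord (a b : ℝ) : ‖ee (a + b * ρ3)‖ = Real.exp (-(Real.pi * Real.sqrt 3 * b)) := by
  rw [norm_ee, rho3_coord_im]; congr 1; ring

lemma norm_ee_rho : ‖ee ρ3‖ < 1 := by
  have := norm_ee_coord 0 1
  simp only [Complex.ofReal_zero, Complex.ofReal_one, zero_add, one_mul] at this
  rw [this, Real.exp_lt_one_iff]
  have := Real.pi_pos
  have : 0 < Real.sqrt 3 := by positivity
  nlinarith [mul_pos Real.pi_pos this]

lemma norm_ee_lt {w : ℂ} (h : 0 < cρ w) : ‖ee w‖ < 1 := by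
  obtain ⟨a, b, rfl⟩ := exists_rho3_coord w
  rw [cρ_coord] at h
  rw [norm_ee_coord, Real.exp_lt_one_iff]
  have := mul_pos (mul_pos Real.pi_pos (by positivity : 0 < Real.sqrt 3)) h
  linarith

lemma ee_div (z w : ℂ) : ee z / ee w = ee (z - w) := by
  rw [sub_eq_add_neg, ee_add, ee_neg, div_eq_mul_inv]

lemma norm_ee_div_lt {w : ℂ} (h : cρ w < 1) : ‖ee ρ3 / ee w‖ < 1 := by
  rw [ee_div]
  apply norm_ee_lt
  obtain ⟨a, b, rfl⟩ := exists_rho3_coord w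
  rw [cρ_coord] at h
  have : ρ3 - (a + b * ρ3) = ((-a : ℝ) : ℂ) + ((1 - b : ℝ) : ℂ) * ρ3 := by push_cast; ring
  rw [this, cρ_coord]; linarith

/-- The Kronecker function with multipliers `eS3 (ρ² l̄ w)` and simple poles on `ℤ[ρ]`. -/
def kron (w z : ℂ) : ℂ := ee (cρ w * z) * kronA (ee ρ3) (ee w) (ee z)

lemma ee_ne_one_of_notMem {z : ℂ} (hz : z ∉ O3) : ee z ≠ 1 := fun h => hz (by
  obtain ⟨n, rfl⟩ := ee_eq_one.1 h
  exact intCast_mem O3 n)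

lemma kron_add_one (w z : ℂ) : kron w (z + 1) = ee (cρ w) * kron w z := by
  rw [kron, kron, ee_add z, ee_one, mul_one, mul_add, ee_add, mul_one]; ring

lemma kron_add_rho {w z : ℂ} (hw : 0 < cρ w) (hw1 : cρ w < 1) (hz : z ∉ O3) :
    kron w (z + ρ3) = ee (cρ w * ρ3 - w) * kron w z := by
  rw [kron, kron, ee_add z, mul_comm (ee z), kronA_mul norm_ee_rho (norm_ee_lt hw) (norm_ee_div_lt hw1)
    (ee_ne_zero _) (ee_ne_zero _) (ee_ne_zero _) (ee_ne_one_of_notMem hz), mul_add, ee_add, ← ee_div]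
  field_simp [ee_ne_zero]

lemma eS3_eq_ee (a b : ℝ) : eS3 (a + b * ρ3) = ee ((a - b : ℝ) : ℂ) := eS3_coord a b

lemma pairing_coord (a b c d : ℝ) : eS3 (ρ3 ^ 2 * (starRingEnd ℂ) (a + b * ρ3) * (c + d * ρ3)) =
    ee ((d * a - c * b : ℝ) : ℂ) := by
  have : ρ3 ^ 2 * (starRingEnd ℂ) (a + b * ρ3) * (c + d * ρ3) =
      ((a * d - a * c - b * d : ℝ) : ℂ) + ((-a * c - b * d + b * c : ℝ) : ℂ) * ρ3 := by
    simp only [map_add, map_mul, Complex.conj_ofReal, conj_rho3]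
    push_cast
    linear_combination (a * d + b * d * ρ3 ^ 2 + b * c * ρ3) * rho3_cube + (a * c + b * d) * rho3_sq
  rw [this, eS3_eq_ee]
  congr 2
  ring

lemma kron_add {w z l : ℂ} (hw : 0 < cρ w) (hw1 : cρ w < 1) (hz : z ∉ O3) (hl : l ∈ O3) :
    kron w (z + l) = eS3 (ρ3 ^ 2 * (starRingEnd ℂ) l * w) * kron w z := by
  have h1 : eS3 (ρ3 ^ 2 * (starRingEnd ℂ) 1 * w) = ee (cρ w) := by
    obtain ⟨c, d, rfl⟩ := exists_rho3_coord w
    have := pairing_coord 1 0 c d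
    simp only [Complex.ofReal_one, Complex.ofReal_zero, zero_mul, add_zero] at this
    rw [this, cρ_coord]; congr 2; ring
  have h2 : eS3 (ρ3 ^ 2 * (starRingEnd ℂ) ρ3 * w) = ee (cρ w * ρ3 - w) := by
    obtain ⟨c, d, rfl⟩ := exists_rho3_coord w
    have := pairing_coord 0 1 c d
    simp only [Complex.ofReal_one, Complex.ofReal_zero, zero_add, one_mul] at this
    rw [this, cρ_coord]; congr 1; push_cast; ring
  let T (l : ℂ) : Prop := l ∈ O3 ∧ ∀ z ∉ O3, kron w (z + l) = eS3 (ρ3 ^ 2 * (starRingEnd ℂ) l * w) * kron w z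
  have tadd : ∀ l m, T l → T m → T (l + m) := fun l m hl hm => ⟨O3.add_mem hl.1 hm.1, fun z hz => by
    have hz' : z + l ∉ O3 := fun h => hz (by simpa using O3.sub_mem h hl.1)
    rw [← add_assoc, hm.2 _ hz', hl.2 _ hz, map_add, ← mul_assoc, ← eS3_add]
    congr 2; ring⟩
  have tneg : ∀ l, T l → T (-l) := fun l hl => ⟨O3.neg_mem hl.1, fun z hz => by
    have hz' : z + -l ∉ O3 := fun h => hz (by simpa using O3.add_mem h hl.1)
    have := hl.2 _ hz'
    rw [neg_add_cancel_right] at this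
    rw [this, ← mul_assoc, ← eS3_add, map_neg]
    ring_nf
    rw [eS3_zero, one_mul]⟩
  have t0 : T 0 := ⟨O3.zero_mem, fun z _ => by simp [eS3_zero]⟩
  have tnat : ∀ l, T l → ∀ n : ℕ, T (n * l) := fun l hl n => by
    induction n with
    | zero => simpa using t0
    | succ n ih => push_cast; rw [add_mul, one_mul]; exact tadd _ _ ih hl
  have tint : ∀ l, T l → ∀ n : ℤ, T (n * l) := fun l hl n => by
    rcases n with n | n
    · simpa using tnat l hl n
    · have := tneg _ (tnat l hl (n + 1))
      simpa [Int.negSucc_eq, add_mul] using this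
  have tone : T 1 := ⟨O3.one_mem, fun z _ => by rw [h1, kron_add_one]⟩
  have trho : T ρ3 := ⟨rho3_mem, fun z hz => by rw [h2, kron_add_rho hw hw1 hz]⟩
  obtain ⟨a, b, rfl⟩ := mem_O3.1 hl
  have := tadd _ _ (tint _ tone a) (tint _ trho b)
  rw [mul_one] at this
  exact this.2 z hz

lemma kron_symm {w z : ℂ} (hw : 0 < cρ w) (hw1 : cρ w < 1) (hz : 0 < cρ z) (hz1 : cρ z < 1) :
    kron w z = eS3 (ρ3 ^ 2 * (starRingEnd ℂ) z * w) * kron z w := by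
  rw [kron, kron, kronA_symm norm_ee_rho (norm_ee_lt hz) (norm_ee_lt hw) (norm_ee_div_lt hz1)
    (norm_ee_div_lt hw1), ← mul_assoc]
  congr 1
  obtain ⟨a, b, rfl⟩ := exists_rho3_coord z
  obtain ⟨c, d, rfl⟩ := exists_rho3_coord w
  rw [pairing_coord, cρ_coord, cρ_coord, ← ee_add]
  congr 1; push_cast; ring

lemma differentiableAt_kron {w z : ℂ} (hw : 0 < cρ w) (hw1 : cρ w < 1) (hz : z ∉ O3) :
    DifferentiableAt ℂ (kron w) z := by
  have hpow : ∀ n : ℕ, ee ρ3 ^ n = ee (n * ρ3) := fun n => by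
    rw [ee, ee, ← Complex.exp_nat_mul]; congr 1; ring
  have h1 : DifferentiableAt ℂ (lamb (ee ρ3) (ee w)) (ee z) :=
    differentiableAt_lamb norm_ee_rho (norm_ee_lt hw) fun n h => by
      rw [hpow, ← ee_add] at h
      refine ee_ne_one_of_notMem (fun h2 => hz ?_) h
      simpa using O3.sub_mem h2 (O3.mul_mem (natCast_mem O3 n) rho3_mem)
  have h2 : DifferentiableAt ℂ (lamb (ee ρ3) (ee ρ3 / ee w)) (ee ρ3 / ee z) :=
    differentiableAt_lamb norm_ee_rho (norm_ee_div_lt hw1) fun n h => by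
      rw [hpow, ee_div, ← ee_add] at h
      refine ee_ne_one_of_notMem (fun h2 => hz ?_) h
      have := O3.sub_mem (O3.add_mem rho3_mem (O3.mul_mem (natCast_mem O3 n) rho3_mem)) h2
      convert this using 1; ring
  have he : DifferentiableAt ℂ ee z := by unfold ee; fun_prop
  have he2 : DifferentiableAt ℂ (fun z => ee (cρ w * z)) z := by unfold ee; fun_prop
  have h3 : DifferentiableAt ℂ (fun z => lamb (ee ρ3) (ee w) (ee z)) z := h1.fun_comp' z he
  have h4 : DifferentiableAt ℂ (fun z => lamb (ee ρ3) (ee ρ3 / ee w) (ee ρ3 / ee z)) z :=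
    DifferentiableAt.fun_comp' (f := fun z => ee ρ3 / ee z) z h2
      ((differentiableAt_const _).div he (ee_ne_zero _))
  exact he2.mul (h3.sub (((differentiableAt_const _).div (he.const_mul _)
    (mul_ne_zero (ee_ne_zero _) (ee_ne_zero _))).mul h4))

lemma tendsto_kron {w : ℂ} (hw : 0 < cρ w) (hw1 : cρ w < 1) :
    Filter.Tendsto (fun z => z * kron w z) (nhdsWithin 0 {0}ᶜ) (nhds (-1 / (2 * Real.pi * I))) := by
  have hpow : ∀ n : ℕ, ee ρ3 * ee ρ3 ^ n = ee ((n + 1) * ρ3) := fun n => by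
    rw [ee, ee, ← Complex.exp_nat_mul, ← Complex.exp_add]; congr 1; ring
  have hne : ∀ n : ℕ, ee ρ3 * ee ρ3 ^ n ≠ 1 := fun n h => by
    rw [hpow, ee_eq_one] at h
    obtain ⟨k, hk⟩ := h
    have := (int_coord_inj (a := 0) (b := n + 1) (c := k) (d := 0) (by push_cast; rw [hk]; ring)).2
    omega
  have e0 : ee 0 = 1 := by simp [ee]
  have he : ContinuousAt ee 0 := by unfold ee; fun_prop
  have h1 : ContinuousAt (fun z => lamb (ee ρ3) (ee w) (ee ρ3 * ee z)) 0 := by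
    have : ContinuousAt (lamb (ee ρ3) (ee w)) (ee ρ3 * ee 0) := by
      rw [e0, mul_one]
      exact (differentiableAt_lamb norm_ee_rho (norm_ee_lt hw) hne).continuousAt
    exact ContinuousAt.comp (f := fun z => ee ρ3 * ee z) this (continuousAt_const.mul he)
  have h2 : ContinuousAt (fun z => lamb (ee ρ3) (ee ρ3 / ee w) (ee ρ3 / ee z)) 0 := by
    have : ContinuousAt (lamb (ee ρ3) (ee ρ3 / ee w)) (ee ρ3 / ee 0) := by
      rw [e0, div_one]
      exact (differentiableAt_lamb norm_ee_rho (norm_ee_div_lt hw1) hne).continuousAt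
    exact ContinuousAt.comp (f := fun z => ee ρ3 / ee z) this
      (continuousAt_const.div he (ee_ne_zero _))
  have h3 : ContinuousAt (fun z => ee (cρ w * z)) 0 := by unfold ee; fun_prop
  have h4 : Filter.Tendsto (fun z => z / (1 - ee z)) (nhdsWithin 0 {0}ᶜ)
      (nhds (-1 / (2 * Real.pi * I))) := by
    have hd : HasDerivAt ee (2 * Real.pi * I) 0 := by
      unfold ee
      have := ((hasDerivAt_id (0 : ℂ)).const_mul (2 * Real.pi * I)).cexp
      simpa using this
    have := (hd.tendsto_slope.inv₀ Complex.two_pi_I_ne_zero).neg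
    rw [show -1 / (2 * (Real.pi : ℂ) * I) = -(2 * Real.pi * I)⁻¹ by ring]
    refine this.congr fun z => ?_
    rw [slope_def_field, e0, sub_zero, inv_div, ← div_neg, neg_sub]
  have h5 : ContinuousAt (fun z => ee w * lamb (ee ρ3) (ee w) (ee ρ3 * ee z) -
      ee ρ3 / (ee w * ee z) * lamb (ee ρ3) (ee ρ3 / ee w) (ee ρ3 / ee z)) 0 :=
    (continuousAt_const.mul h1).sub ((continuousAt_const.div (continuousAt_const.mul he)
      (mul_ne_zero (ee_ne_zero _) (ee_ne_zero _))).mul h2)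
  have h6 := ((h3.tendsto).mono_left (nhdsWithin_le_nhds (s := {0}ᶜ))).mul (h4.add
    (((continuousAt_id.mul h5).tendsto).mono_left (nhdsWithin_le_nhds (s := {0}ᶜ))))
  simp only [mul_zero, e0, Pi.mul_apply, id, zero_mul, add_zero, one_mul] at h6
  refine h6.congr fun z => ?_
  rw [kron, kronA, lamb_succ norm_ee_rho (norm_ee_lt hw) (ee z)]
  ring

/-! ### `φ` as a Kronecker function -/

/-- Comparison of a function with prescribed multipliers and one simple pole with the
Kronecker function. -/
lemma eq_kron_of_multipliers {c b r w : ℂ} (hc : c ≠ 0) (hw : 0 < cρ w) (hw1 : cρ w < 1) (F : ℂ → ℂ)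
    (hd : ∀ z, c * (z - b) ∉ O3 → DifferentiableAt ℂ F z)
    (hper : ∀ z, c * (z - b) ∉ O3 → ∀ l ∈ O3,
      F (z + l / c) = eS3 (ρ3 ^ 2 * (starRingEnd ℂ) l * w) * F z)
    (hlim : Filter.Tendsto (fun z => (z - b) * F z) (nhdsWithin b {b}ᶜ) (nhds r))
    (hw0 : ∃ l ∈ O3, eS3 (ρ3 ^ 2 * (starRingEnd ℂ) l * w) ≠ 1) (z : ℂ) (hz : c * (z - b) ∉ O3) :
    F z = -(2 * Real.pi * I) * c * r * kron w (c * (z - b)) := by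
  set κ := -(2 * Real.pi * I) * c * r with hκ
  have hsh : ∀ z l : ℂ, c * (z + l / c - b) = c * (z - b) + l := fun z l => by field_simp; ring
  have hG : ∀ z, c * (z - b) ∉ O3 → ∀ l ∈ O3, F (z + l / c) - κ * kron w (c * (z + l / c - b)) =
      eS3 (ρ3 ^ 2 * (starRingEnd ℂ) l * w) * (F z - κ * kron w (c * (z - b))) := fun z hz l hl => by
    rw [hper z hz l hl, hsh, kron_add hw hw1 hz hl]; ring
  obtain ⟨C, hC⟩ := liouville_coset hc (b := b) (fun z => F z - κ * kron w (c * (z - b)))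
    (fun z hz => (hd z hz).sub (DifferentiableAt.const_mul
      ((differentiableAt_kron hw hw1 hz).fun_comp' (f := fun z => c * (z - b)) z (by fun_prop)) κ))
    (fun z hz l hl => by rw [hG z hz l hl, norm_mul, norm_eS3, one_mul])
    (by
      have e1 : c * (b - b) = 0 := by ring
      have h2 : Filter.Tendsto (fun z => c * (z - b)) (nhdsWithin b {b}ᶜ) (nhdsWithin 0 {0}ᶜ) :=
        tendsto_nhdsWithin_iff.2 ⟨by
          have : ContinuousAt (fun z => c * (z - b)) b := by fun_prop
          have := this.tendsto
          rw [e1] at this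
          exact this.mono_left nhdsWithin_le_nhds, by
          filter_upwards [self_mem_nhdsWithin] with z hz h0
          exact hz (sub_eq_zero.1 ((mul_eq_zero.1 h0).resolve_left hc))⟩
      have h3 := hlim.sub (((tendsto_kron hw hw1).comp h2).const_mul (κ / c))
      have e0 : r - κ / c * (-1 / (2 * Real.pi * I)) = 0 := by
        have h0 := Complex.two_pi_I_ne_zero
        rw [hκ]
        field_simp
        ring
      rw [e0] at h3
      refine h3.congr fun z => ?_
      simp only [Function.comp_apply]
      field_simp)
  obtain ⟨l, hl, h1⟩ := hw0
  have a1 := hC z hz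
  have a2 := hC (z + l / c) (fun h => hz (by
    rw [hsh] at h
    simpa using O3.sub_mem h hl))
  simp only [hG z hz l hl] at a2
  rw [a1] at a2
  have : (eS3 (ρ3 ^ 2 * (starRingEnd ℂ) l * w) - 1) * C = 0 := by linear_combination a2
  rw [(mul_eq_zero.1 this).resolve_left (sub_ne_zero.2 h1)] at a1
  exact sub_eq_zero.1 a1

/-- The residue point `ρ - √−3/3`. -/
def z1 : ℂ := ρ3 - sqrtm3 / 3

lemma z1_eq : z1 = ((-1 / 3 : ℝ) : ℂ) + ((1 / 3 : ℝ) : ℂ) * ρ3 := by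
  rw [z1, sqrtm3_eq']; push_cast; ring

lemma cρ_z1 : cρ z1 = 1 / 3 := by rw [z1_eq, cρ_coord]

lemma conj_z1 : (starRingEnd ℂ) z1 = ρ3 ^ 2 + sqrtm3 / 3 := by
  rw [z1, map_sub, map_div₀, conj_rho3, conj_sqrtm3, Complex.conj_ofNat]; ring

lemma eS3_int_mul (n : ℤ) (z : ℂ) : eS3 (n * z) = eS3 z ^ n := by
  rw [eS3, eS3, ← Complex.exp_int_mul]
  congr 1
  rw [map_mul, map_intCast]; ring

lemma eS3_z1 : eS3 z1 = ρ3 := by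
  rw [z1_eq, eS3_coord, ρ3, ← mul_one (Complex.exp _), ← Complex.exp_two_pi_mul_I, ← Complex.exp_add]
  congr 1; push_cast; ring

lemma PH_sub_A1 (u : ℂ) : PH (u - A1) = ρ3 * PH u := by
  have := PH_add_A1 (u - A1)
  rw [sub_add_cancel] at this
  rw [this]; linear_combination (-PH (u - A1)) * rho3_cube

lemma PH_sub_int_mul_A1 (n : ℤ) (u : ℂ) : PH (u - n * A1) = ρ3 ^ n * PH u := by
  induction n using Int.induction_on generalizing u with
  | zero => simp
  | succ k ih =>
    have : u - ((k + 1 : ℤ) : ℂ) * A1 = (u - A1) - ((k : ℤ) : ℂ) * A1 := by push_cast; ring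
    rw [this, ih, PH_sub_A1, zpow_add_one₀ rho3_ne_zero]; ring
  | pred k ih =>
    have : u - ((-k - 1 : ℤ) : ℂ) * A1 = (u + A1) - ((-k : ℤ) : ℂ) * A1 := by push_cast; ring
    rw [this, ih, PH_add_A1, zpow_sub_one₀ rho3_ne_zero, inv_eq_of_mul_eq_one_right
      (b := ρ3 ^ 2) (by rw [← pow_succ']; exact rho3_cube)]; ring

lemma sqrtm3_mul_z1 : sqrtm3 * z1 = sqrtm3 * ρ3 + 1 := by
  rw [z1]; linear_combination (-1 / 3 : ℂ) * sqrtm3_sq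

lemma PH_add_div_sqrtm3 {l : ℂ} (hl : l ∈ O3) (u : ℂ) :
    PH (u - l / sqrtm3) = eS3 (ρ3 ^ 2 * (starRingEnd ℂ) l * z1) * PH u := by
  have hs := sqrtm3_ne_zero
  obtain ⟨a, b, rfl⟩ := mem_O3.1 hl
  have hm : ((b : ℂ) - a * ρ3) ∈ O3 := O3.sub_mem (intCast_mem O3 b) (O3.mul_mem (intCast_mem O3 a) rho3_mem)
  have e1 : (a : ℂ) + b * ρ3 = sqrtm3 * (((a + b : ℤ) : ℂ) * A1 + (b - a * ρ3)) := by
    rw [mul_add, mul_left_comm, sqrtm3_A1, sqrtm3_eq]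
    push_cast
    linear_combination (-(a : ℂ)) * rho3_cube
  have e2 : u - ((a : ℂ) + b * ρ3) / sqrtm3 = (u - ((a + b : ℤ) : ℂ) * A1) + -(b - a * ρ3) := by
    rw [e1, mul_div_cancel_left₀ _ hs]; ring
  have e3 : ρ3 ^ 2 * (starRingEnd ℂ) ((a : ℂ) + b * ρ3) * z1 = ((a + b : ℤ) : ℂ) * z1 +
      -(ρ3 ^ 2 * (starRingEnd ℂ) (b - a * ρ3) * (sqrtm3 * ρ3 + 1)) := by
    rw [← sqrtm3_mul_z1]
    have : (starRingEnd ℂ) ((a : ℂ) + b * ρ3) = ((a + b : ℤ) : ℂ) * ρ3 -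
        sqrtm3 * (starRingEnd ℂ) (b - a * ρ3) := by
      simp only [map_add, map_sub, map_mul, map_intCast, conj_rho3]
      rw [sqrtm3_eq]; push_cast
      linear_combination ((a : ℂ) * ρ3 - a) * rho3_cube
    rw [this]
    linear_combination ((a + b : ℤ) : ℂ) * z1 * rho3_cube
  rw [e2, PH_add (O3.neg_mem hm), PH_sub_int_mul_A1, e3, eS3_add, eS3_int_mul, eS3_z1,
    eS3_of_mem (O3.neg_mem (O3.mul_mem (O3.mul_mem (O3.pow_mem rho3_mem 2) (conj_mem_O3 hm))
    (O3.add_mem (O3.mul_mem sqrtm3_mem rho3_mem) O3.one_mem))), mul_one]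

/-- The constant `κ`. -/
def kap : ℂ := -(2 * Real.pi * I) * (sqrtm3 * (1 / (3 * varpi1)))

lemma nontrivial_z1 : ∃ l ∈ O3, eS3 (ρ3 ^ 2 * (starRingEnd ℂ) l * z1) ≠ 1 := by
  refine ⟨ρ3 ^ 2, O3.pow_mem rho3_mem 2, ?_⟩
  have : ρ3 ^ 2 * (starRingEnd ℂ) (ρ3 ^ 2) * z1 = z1 * (ρ3 ^ 3) ^ 2 := by
    rw [map_pow, conj_rho3]; ring
  rw [this, rho3_cube, one_pow, mul_one, eS3_z1]
  exact rho3_ne_one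

lemma PH_eq_kron {u : ℂ} (hu : sqrtm3 * (u - 1 / 3) ∉ O3) :
    PH u = -kap * kron z1 (-sqrtm3 * (u - 1 / 3)) := by
  have hs := sqrtm3_ne_zero
  have hneg : ∀ z, -sqrtm3 * (z - 1 / 3) ∉ O3 → sqrtm3 * (z - 1 / 3) ∉ O3 := fun z hz h => hz (by
    rw [neg_mul]; exact O3.neg_mem h)
  have := eq_kron_of_multipliers (c := -sqrtm3) (b := 1 / 3) (r := 1 / (3 * varpi1)) (w := z1)
    (neg_ne_zero.2 hs) (by rw [cρ_z1]; norm_num) (by rw [cρ_z1]; norm_num) PH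
    (fun z hz => differentiableAt_PH (hneg z hz))
    (fun z hz l hl => by
      rw [div_neg, ← sub_eq_add_neg]; exact PH_add_div_sqrtm3 hl z)
    tendsto_PH_third nontrivial_z1 u (fun h => hu (by simpa using O3.neg_mem h))
  rw [this, kap]; ring

/-! ### The finite Fourier transform -/

section fourier
variable {p : ℕ} {π : ℂ} [Fact p.Prime] {t : O3 →+* ZMod p}

/-- The additive character of `ZMod p`. -/
def echar (π : ℂ) {p : ℕ} (x : ZMod p) : ℂ := eS3 (-3 * dpt π x)

lemma echar_res (ht : IsResHom π t) (h : PrimaryPrime p π) (z : O3) :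
    echar π (t z) = eS3 (-3 * (z / π)) := by
  obtain ⟨l, hl, e⟩ := exists_dpt_res ht h z
  rw [e, echar, mul_add, eS3_add, eS3_of_mem (O3.mul_mem (O3.neg_mem three_mem) hl), mul_one]

lemma resHom_surj (x : ZMod p) : ∃ z : O3, t z = x :=
  ⟨(x.val : O3), by rw [map_natCast, ZMod.natCast_zmod_val]⟩

lemma echar_add (ht : IsResHom π t) (h : PrimaryPrime p π) (x y : ZMod p) :
    echar π (x + y) = echar π x * echar π y := by
  obtain ⟨a, rfl⟩ := resHom_surj (t := t) x
  obtain ⟨b, rfl⟩ := resHom_surj (t := t) y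
  rw [← map_add, echar_res ht h, echar_res ht h, echar_res ht h, ← eS3_add]
  congr 1; push_cast; ring

lemma echar_zero : echar π (0 : ZMod p) = 1 := by simp [echar, dpt_zero, eS3_zero]

/-- The twisted sum of translates of `φ`. -/
def twist (p : ℕ) [Fact p.Prime] (π : ℂ) (μ : ZMod p) (u : ℂ) : ℂ :=
  ∑ x : ZMod p, PH (u + dpt π x) * echar π (x * μ)

lemma twist_add (ht : IsResHom π t) (h : PrimaryPrime p π) (μ : ZMod p) (u : ℂ) (z : O3) :
    twist p π μ (u + z / π) = echar π (-t z * μ) * twist p π μ u := by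
  rw [twist, twist, Finset.mul_sum]
  refine Fintype.sum_equiv (Equiv.addRight (t z)) _ _ fun x => ?_
  rw [PH_add_dpt ht h, Equiv.coe_addRight, mul_left_comm, ← echar_add ht h]
  congr 2; ring

lemma exists_split_neg (h : PrimaryPrime p π) {d : O3} (e : π = 1 + 3 * d) (l : ℂ) :
    l / (sqrtm3 * π) = -(-l) / sqrtm3 + sqrtm3 * d * l / π := by
  have hpi := h.ne_zero
  have hs := sqrtm3_ne_zero
  field_simp
  rw [sqrtm3_sq, e]; ring

lemma exists_reduce {w : ℂ} (hw : ∀ n : ℤ, cρ w ≠ n) : ∃ l ∈ O3, 0 < cρ (w + l) ∧ cρ (w + l) < 1 := by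
  obtain ⟨a, b, rfl⟩ := exists_rho3_coord w
  rw [cρ_coord] at hw
  refine ⟨(-⌊b⌋ : ℤ) * ρ3, O3.mul_mem (intCast_mem O3 _) rho3_mem, ?_⟩
  have : (a : ℂ) + b * ρ3 + (-⌊b⌋ : ℤ) * ρ3 = a + ((b - ⌊b⌋ : ℝ) : ℂ) * ρ3 := by push_cast; ring
  rw [this, cρ_coord]
  have h1 := Int.floor_le b
  have h2 := Int.lt_floor_add_one b
  have h3 := hw ⌊b⌋
  exact ⟨sub_pos.2 (lt_of_le_of_ne h1 h3.symm), by linarith⟩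

lemma eS3_congr {a b : ℂ} (h : a - b ∈ O3) : eS3 a = eS3 b := by
  have := eS3_add (a - b) b
  rwa [sub_add_cancel, eS3_of_mem h, one_mul] at this

lemma cρ_of_mem {w : ℂ} (hw : w ∈ O3) : ∃ n : ℤ, cρ w = n := by
  obtain ⟨a, b, rfl⟩ := mem_O3.1 hw
  have := cρ_coord a b
  push_cast at this
  exact ⟨b, this⟩

lemma PrimaryPrime.conj_ne_zero (h : PrimaryPrime p π) : (starRingEnd ℂ) π ≠ 0 := by
  simpa using h.ne_zero

/-- The dual parameter. -/
def wpar (π m : ℂ) : ℂ := -sqrtm3 * (ρ3 ^ 2 * (starRingEnd ℂ) (m / π) - 1 / 3)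

lemma cρ_wpar (h : PrimaryPrime p π) {m : ℂ} (hm : m ∈ O3) (n : ℤ) : cρ (wpar π m) ≠ n := by
  intro hn
  have h1 : -sqrtm3 * ρ3 ^ 2 * (starRingEnd ℂ) m * π ∈ O3 := O3.mul_mem (O3.mul_mem (O3.mul_mem
    (O3.neg_mem sqrtm3_mem) (O3.pow_mem rho3_mem 2)) (conj_mem_O3 hm)) h.mem
  obtain ⟨a, b, e⟩ := mem_O3.1 h1
  have hpi := h.ne_zero
  have hpi' := h.conj_ne_zero
  have hp0 : (p : ℝ) ≠ 0 := by exact_mod_cast h.prime.ne_zero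
  have hpc : (p : ℂ) ≠ 0 := by exact_mod_cast h.prime.ne_zero
  have e2 : wpar π m = ((1 / 3 + a / p : ℝ) : ℂ) + ((2 / 3 + b / p : ℝ) : ℂ) * ρ3 := by
    have e3 : (starRingEnd ℂ) (m / π) = (starRingEnd ℂ) m * π / p := by
      rw [map_div₀, ← h.norm]; field_simp
    rw [wpar, e3]
    push_cast
    have : (p : ℂ) * (-sqrtm3 * (ρ3 ^ 2 * ((starRingEnd ℂ) m * π / p) - 1 / 3)) =
        a + b * ρ3 + p * (1 + 2 * ρ3) / 3 := by
      rw [← e, ← sqrtm3_eq']; field_simp; ring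
    apply mul_left_cancel₀ hpc
    rw [this]
    field_simp; ring
  rw [e2, cρ_coord] at hn
  have h4 : (2 * p + 3 * b : ℝ) = 3 * p * n := by field_simp at hn; linarith
  have h5 : (2 * p + 3 * b : ℤ) = 3 * p * n := by exact_mod_cast h4
  have h6 := h.mod_three
  have h7 : (3 * p * n : ℤ) = 3 * (p * n) := by ring
  omega

/-- The finite Fourier transform of the division values of `φ`. -/
theorem fourier_Phi (ht : IsResHom π t) (h : PrimaryPrime p π) (μ : ZMod p) :
    ∑ x : ZMod p, Phi π x * echar π (x * μ) = -ρ3 ^ 2 * π * (starRingEnd ℂ) (Phi π μ) := by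
  classical
  obtain ⟨d, hd, e⟩ := h.primary
  lift d to O3 using hd
  obtain ⟨m, rfl⟩ := resHom_surj (t := t) μ
  have hpi := h.ne_zero
  have hpi' := h.conj_ne_zero
  have hs := sqrtm3_ne_zero
  have hc : sqrtm3 * π ≠ 0 := mul_ne_zero hs hpi
  have e' : (starRingEnd ℂ) π = 1 + 3 * (starRingEnd ℂ) (d : ℂ) := by
    rw [e]; simp [Complex.conj_ofNat]
  obtain ⟨l0, hl0, hw0, hw1⟩ := exists_reduce (cρ_wpar h m.2)
  set w := wpar π m with hw
  have hbase : sqrtm3 * π * (0 - 1 / (3 * π)) = -sqrtm3 / 3 := by field_simp; ring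
  have hmul : ∀ l ∈ O3, ∀ u, twist p π (t m) (u + l / (sqrtm3 * π)) =
      eS3 (ρ3 ^ 2 * (starRingEnd ℂ) l * (w + l0)) * twist p π (t m) u := by
    intro l hl u
    lift l to O3 using hl
    have hz := exists_split_neg h e l
    have h1 := twist_add ht h (t m) (u - -(l : ℂ) / sqrtm3) (⟨sqrtm3, sqrtm3_mem⟩ * d * l)
    push_cast at h1
    have h2 : twist p π (t m) (u - -(l : ℂ) / sqrtm3) =
        eS3 (ρ3 ^ 2 * (starRingEnd ℂ) (-l) * z1) * twist p π (t m) u := by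
      rw [twist, twist, Finset.mul_sum]
      refine Finset.sum_congr rfl fun x _ => ?_
      rw [sub_add_eq_add_sub, PH_add_div_sqrtm3 (O3.neg_mem l.2), mul_assoc]
    rw [hz, ← add_assoc, neg_div, ← sub_eq_add_neg, h1, h2, ← mul_assoc]
    congr 1
    rw [← map_neg t, ← map_mul, echar_res ht h, ← eS3_symm (-3 * _), ← eS3_add]
    apply eS3_congr
    have : -ρ3 * (starRingEnd ℂ) (-3 * (((-(⟨sqrtm3, sqrtm3_mem⟩ * d * l) * m : O3) : ℂ) / π)) +
        ρ3 ^ 2 * (starRingEnd ℂ) (-(l : ℂ)) * z1 - ρ3 ^ 2 * (starRingEnd ℂ) (l : ℂ) * (w + l0) =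
        (starRingEnd ℂ) (l : ℂ) * (ρ3 * sqrtm3 * (starRingEnd ℂ) m - 1 - ρ3 ^ 2 * l0) := by
      rw [hw, wpar, z1]
      push_cast
      simp only [map_mul, map_neg, map_div₀, conj_sqrtm3, Complex.conj_ofNat]
      have : 3 * (starRingEnd ℂ) (d : ℂ) = (starRingEnd ℂ) π - 1 := by rw [e']; ring
      field_simp
      linear_combination (-3 * (starRingEnd ℂ) (l : ℂ) * (starRingEnd ℂ) π +
        3 * ρ3 * sqrtm3 * (starRingEnd ℂ) (l : ℂ) * (starRingEnd ℂ) (m : ℂ)) * rho3_cube +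
        3 * ρ3 * sqrtm3 * (starRingEnd ℂ) (l : ℂ) * (starRingEnd ℂ) (m : ℂ) * this
    rw [this]
    exact O3.mul_mem (conj_mem_O3 l.2) (O3.sub_mem (O3.sub_mem (O3.mul_mem (O3.mul_mem rho3_mem sqrtm3_mem)
      (conj_mem_O3 m.2)) O3.one_mem) (O3.mul_mem (O3.pow_mem rho3_mem 2) hl0))
  have hdiff : ∀ u, sqrtm3 * π * (u - 1 / (3 * π)) ∉ O3 →
      DifferentiableAt ℂ (twist p π (t m)) u := fun u hu => by
    unfold twist
    exact DifferentiableAt.fun_sum fun x _ => ((differentiableAt_PH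
      (not_pole_of h hu x)).fun_comp' (f := fun u => u + dpt π x) u (by fun_prop)).mul_const _
  have hlim : Filter.Tendsto (fun u => (u - 1 / (3 * π)) * twist p π (t m) u)
      (nhdsWithin (1 / (3 * π)) {1 / (3 * π)}ᶜ)
      (nhds (1 / (3 * varpi1) * echar π (t d * t m))) := by
    have l1 : Filter.Tendsto (fun u => ∑ x ∈ Finset.univ.erase (t d),
        PH (u + dpt π x) * echar π (x * t m))
        (nhdsWithin (1 / (3 * π)) {1 / (3 * π)}ᶜ)
        (nhds (∑ x ∈ Finset.univ.erase (t d), PH (1 / (3 * π) + dpt π x) * echar π (x * t m))) :=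
      tendsto_finsetSum _ fun x hx => Filter.Tendsto.mul_const _
        (((differentiableAt_PH (not_pole_base ht h e (Finset.ne_of_mem_erase hx))).fun_comp'
          (f := fun u => u + dpt π x) (1 / (3 * π))
          (by fun_prop)).continuousAt.tendsto.mono_left nhdsWithin_le_nhds)
    have l2 : Filter.Tendsto (fun u => u - 1 / (3 * π)) (nhdsWithin (1 / (3 * π)) {1 / (3 * π)}ᶜ)
        (nhds 0) := by
      have : ContinuousAt (fun u => u - 1 / (3 * π)) (1 / (3 * π)) := by fun_prop
      have := this.tendsto
      rw [sub_self] at this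
      exact this.mono_left nhdsWithin_le_nhds
    have l3 := ((tendsto_factor_base ht h e).mul_const (echar π (t d * t m))).add (l2.mul l1)
    rw [zero_mul, add_zero] at l3
    refine l3.congr fun u => ?_
    rw [twist, ← Finset.add_sum_erase _ _ (Finset.mem_univ (t d))]
    ring
  have hnt : ∃ l ∈ O3, eS3 (ρ3 ^ 2 * (starRingEnd ℂ) l * (w + l0)) ≠ 1 := by
    refine ⟨π * ρ3 ^ 2, O3.mul_mem h.mem (O3.pow_mem rho3_mem 2), ?_⟩
    have : eS3 (ρ3 ^ 2 * (starRingEnd ℂ) (π * ρ3 ^ 2) * (w + l0)) = eS3 (-z1) := by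
      apply eS3_congr
      have : ρ3 ^ 2 * (starRingEnd ℂ) (π * ρ3 ^ 2) * (w + l0) - -z1 =
          ρ3 + sqrtm3 * (starRingEnd ℂ) (d : ℂ) - sqrtm3 * ρ3 ^ 2 * (starRingEnd ℂ) m +
          (starRingEnd ℂ) π * l0 := by
        have h6 : ρ3 ^ 2 * (starRingEnd ℂ) (π * ρ3 ^ 2) = (starRingEnd ℂ) π := by
          rw [map_mul, map_pow, conj_rho3]
          linear_combination (starRingEnd ℂ) π * (ρ3 ^ 3 + 1) * rho3_cube
        have h7 : (starRingEnd ℂ) (d : ℂ) = ((starRingEnd ℂ) π - 1) / 3 := by rw [e']; ring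
        rw [h6, hw, wpar, z1, map_div₀, h7]
        field_simp
        ring
      rw [this]
      exact O3.add_mem (O3.sub_mem (O3.add_mem rho3_mem (O3.mul_mem sqrtm3_mem (conj_mem_O3 d.2)))
        (O3.mul_mem (O3.mul_mem sqrtm3_mem (O3.pow_mem rho3_mem 2)) (conj_mem_O3 m.2)))
        (O3.mul_mem (conj_mem_O3 h.mem) hl0)
    rw [this, eS3_neg, eS3_z1]
    exact fun h8 => rho3_ne_one (inv_eq_one.1 h8)
  have hz0 : sqrtm3 * π * (0 - 1 / (3 * π)) ∉ O3 := by
    rw [hbase]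
    intro hm
    exact sqrtm3_div_three (by have := O3.neg_mem hm; convert this using 1; ring)
  have key := eq_kron_of_multipliers hc hw0 hw1 _ hdiff (fun u _ l hl => hmul l hl u) hlim hnt 0 hz0
  have hz1 : z1 ∉ O3 := fun hm => sqrtm3_div_three (by
    have := O3.sub_mem rho3_mem hm
    convert this using 1; rw [z1]; ring)
  have hwO : w ∉ O3 := fun hm => by
    obtain ⟨n, hn⟩ := cρ_of_mem hm
    exact cρ_wpar h m.2 n hn
  have k1 := kron_add hw0 hw1 hz1 (O3.neg_mem rho3_mem)
  have k2 := kron_symm hw0 hw1 (z := z1) (by rw [cρ_z1]; norm_num) (by rw [cρ_z1]; norm_num)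
  have k3 := kron_add (w := z1) (by rw [cρ_z1]; norm_num) (by rw [cρ_z1]; norm_num) hwO hl0
  have k4 := PH_eq_kron (u := ρ3 ^ 2 * (starRingEnd ℂ) (m / π)) (fun hm => hwO (by
    rw [hw, wpar, neg_mul]; exact O3.neg_mem hm))
  have k5 : PH (ρ3 ^ 2 * (starRingEnd ℂ) (m / π)) = ρ3 ^ 2 * (starRingEnd ℂ) (Phi π (t m)) := by
    rw [pow_two, mul_assoc, PH_rho, PH_rho, PH_conj, PH_div_eq ht h]; ring
  have e1 : z1 + -ρ3 = -sqrtm3 / 3 := by rw [z1]; ring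
  rw [hbase, ← e1, k1, k2, k3] at key
  have e2 : twist p π (t m) 0 = ∑ x : ZMod p, Phi π x * echar π (x * t m) := by
    rw [twist]; simp only [zero_add, Phi]
  have hphase : echar π (t d * t m) * (eS3 (ρ3 ^ 2 * (starRingEnd ℂ) (-ρ3) * (w + l0)) *
      (eS3 (ρ3 ^ 2 * (starRingEnd ℂ) z1 * (w + l0)) * eS3 (ρ3 ^ 2 * (starRingEnd ℂ) l0 * z1))) = 1 := by
    have f1 : eS3 (ρ3 ^ 2 * (starRingEnd ℂ) l0 * z1) = eS3 (-ρ3 ^ 2 * l0 * (starRingEnd ℂ) z1) := by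
      rw [← eS3_symm]
      congr 1
      simp only [map_mul, map_pow, conj_rho3, Complex.conj_conj]
      linear_combination (-ρ3 ^ 2 * l0 * (starRingEnd ℂ) z1) * rho3_cube
    have f2 : eS3 (ρ3 * (starRingEnd ℂ) (m / π)) = eS3 (-(m / π)) := by
      rw [← eS3_symm]
      congr 1
      simp only [map_mul, conj_rho3, Complex.conj_conj]
      linear_combination (-(m / π : ℂ)) * rho3_cube
    have f3 : eS3 (-ρ3 ^ 2 / 3) = 1 := by
      have := eS3_coord (1 / 3) (1 / 3)
      rw [sub_self, Complex.ofReal_zero, mul_zero, Complex.exp_zero] at this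
      rw [← this]
      congr 1
      push_cast; rw [rho3_sq]; ring
    rw [f1, ← map_mul, echar_res ht h, ← eS3_add, ← eS3_add, ← eS3_add]
    have f4 : -3 * (((d * m : O3) : ℂ) / π) + (ρ3 ^ 2 * (starRingEnd ℂ) (-ρ3) * (w + l0) +
        (ρ3 ^ 2 * (starRingEnd ℂ) z1 * (w + l0) + -ρ3 ^ 2 * l0 * (starRingEnd ℂ) z1)) =
        (ρ3 * (starRingEnd ℂ) (m / π) + -ρ3 ^ 2 / 3) + (m / π - (m + ρ3 * l0)) := by
      have f5 : (d : ℂ) = (π - 1) / 3 := by rw [e]; ring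
      rw [conj_z1, map_neg, conj_rho3, hw, wpar]
      push_cast
      rw [f5]
      linear_combination (ρ3 * (starRingEnd ℂ) (m / π) - ρ3 * l0) * rho3_cube
        + (-ρ3 ^ 4 * (starRingEnd ℂ) (m / π) / 3 + ρ3 ^ 2 / 9) * sqrtm3_sq
        + (-(m : ℂ)) * (mul_inv_cancel₀ hpi)
    rw [f4, eS3_add, eS3_add, f2, f3, mul_one, ← eS3_add]
    exact eS3_of_mem (by
      have := O3.neg_mem (O3.add_mem m.2 (O3.mul_mem rho3_mem hl0))
      convert this using 1; ring)
  rw [← e2, key]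
  rw [k5] at k4
  rw [show -sqrtm3 * (ρ3 ^ 2 * (starRingEnd ℂ) (m / π) - 1 / 3) = w from rfl] at k4
  have k6 : -(2 * Real.pi * I) * (sqrtm3 * π) * (1 / (3 * varpi1) * echar π (t d * t m)) =
      kap * π * echar π (t d * t m) := by rw [kap]; ring
  rw [k6]
  linear_combination kap * π * kron z1 w * hphase + π * k4

end fourier

/-! ### A place of `ℂ` above three -/

/-- A valuation subring of `ℂ` above `3`. -/
structure IsPlace (V : ValuationSubring ℂ) : Prop where
  le : O3 ≤ V.toSubring
  three : V.valuation 3 < 1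

lemma third_notMem' : (1 / 3 : ℂ) ∉ O3 := fun h => sqrtm3_div_three (O3.mul_mem sqrtm3_mem h)

lemma exists_place : ∃ V, IsPlace V := by
  obtain ⟨V, h1, h2⟩ := Ideal.image_subset_nonunits_valuationSubring
    (Ideal.span {(⟨3, three_mem⟩ : O3)}) (fun h => by
      rw [Ideal.eq_top_iff_one, Ideal.mem_span_singleton] at h
      obtain ⟨d, hd⟩ := h
      apply third_notMem'
      have : (1 : ℂ) = 3 * d := congrArg Subtype.val hd
      rw [this, mul_div_cancel_left₀ _ (by norm_num)]
      exact d.2)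
  exact ⟨V, h1, h2 ⟨⟨3, three_mem⟩, Ideal.subset_span rfl, rfl⟩⟩

section place

variable {V : ValuationSubring ℂ}

/-- `z` is integral with residue `β`. -/
def Red (V : ValuationSubring ℂ) (z : ℂ) (β : IsLocalRing.ResidueField V) : Prop :=
  ∃ h : z ∈ V, IsLocalRing.residue V ⟨z, h⟩ = β

/-- `a` is congruent to `1` modulo `√−3`, with second coefficient `β`. -/
def Expan (V : ValuationSubring ℂ) (a : ℂ) (β : IsLocalRing.ResidueField V) : Prop :=
  ∃ b, a = 1 + sqrtm3 * b ∧ Red V b β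

namespace Red

variable {a b : ℂ} {α β : IsLocalRing.ResidueField V}

lemma add (h1 : Red V a α) (h2 : Red V b β) : Red V (a + b) (α + β) := by
  obtain ⟨h1, rfl⟩ := h1
  obtain ⟨h2, rfl⟩ := h2
  exact ⟨V.add_mem _ _ h1 h2, map_add (IsLocalRing.residue V) ⟨a, h1⟩ ⟨b, h2⟩⟩

lemma mul (h1 : Red V a α) (h2 : Red V b β) : Red V (a * b) (α * β) := by
  obtain ⟨h1, rfl⟩ := h1
  obtain ⟨h2, rfl⟩ := h2
  exact ⟨V.mul_mem _ _ h1 h2, map_mul (IsLocalRing.residue V) ⟨a, h1⟩ ⟨b, h2⟩⟩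

lemma neg (h1 : Red V a α) : Red V (-a) (-α) := by
  obtain ⟨h1, rfl⟩ := h1
  exact ⟨V.neg_mem _ h1, map_neg (IsLocalRing.residue V) ⟨a, h1⟩⟩

lemma sub (h1 : Red V a α) (h2 : Red V b β) : Red V (a - b) (α - β) := by
  rw [sub_eq_add_neg, sub_eq_add_neg]; exact h1.add h2.neg

lemma zero : Red V 0 0 := ⟨V.zero_mem, map_zero (IsLocalRing.residue V)⟩

lemma one : Red V 1 1 := ⟨V.one_mem, map_one (IsLocalRing.residue V)⟩

lemma pow (h1 : Red V a α) (n : ℕ) : Red V (a ^ n) (α ^ n) := by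
  induction n with
  | zero => simpa using Red.one
  | succ n ih => rw [pow_succ, pow_succ]; exact ih.mul h1

lemma sum {ι : Type*} {s : Finset ι} {f : ι → ℂ} {g : ι → IsLocalRing.ResidueField V}
    (h : ∀ i ∈ s, Red V (f i) (g i)) : Red V (∑ i ∈ s, f i) (∑ i ∈ s, g i) := by
  classical
  induction s using Finset.induction_on with
  | empty => simpa using Red.zero
  | insert i s hi ih =>
    rw [Finset.sum_insert hi, Finset.sum_insert hi]
    exact (h i (Finset.mem_insert_self i s)).add
      (ih fun j hj => h j (Finset.mem_insert_of_mem hj))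

lemma unique (h1 : Red V a α) (h2 : Red V a β) : α = β := by
  obtain ⟨h1, rfl⟩ := h1
  obtain ⟨h2, rfl⟩ := h2
  rfl

lemma exists_of_mem (h : a ∈ V) : ∃ α, Red V a α := ⟨_, h, rfl⟩

lemma of_lt (h : V.valuation a < 1) : Red V a 0 :=
  ⟨V.mem_of_valuation_le_one a h.le, (IsLocalRing.residue_eq_zero_iff _).2
    ((V.valuation_lt_one_iff _).2 h)⟩

lemma val_eq_one (h : Red V a α) (hα : α ≠ 0) : V.valuation a = 1 := by
  obtain ⟨h1, rfl⟩ := h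
  refine (V.valuation_lt_one_or_eq_one ⟨a, h1⟩).resolve_left fun h2 => hα ?_
  exact (IsLocalRing.residue_eq_zero_iff _).2 ((V.valuation_lt_one_iff _).2 h2)

lemma ne_zero (h : Red V a α) (hα : α ≠ 0) : a ≠ 0 := by
  rintro rfl
  exact hα (h.unique zero)

lemma inv (h : Red V a α) (hα : α ≠ 0) : Red V a⁻¹ α⁻¹ := by
  have h0 := h.ne_zero hα
  have h1 : a⁻¹ ∈ V := V.mem_of_valuation_le_one _ (by rw [map_inv₀, h.val_eq_one hα, inv_one])
  obtain ⟨β, hβ⟩ := exists_of_mem h1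
  have h2 := h.mul hβ
  rw [mul_inv_cancel₀ h0] at h2
  rwa [inv_eq_of_mul_eq_one_right (h2.unique one)]

end Red

namespace IsPlace

variable (hV : IsPlace V)
include hV

lemma mem {z : ℂ} (h : z ∈ O3) : z ∈ V := hV.le h

lemma red_three : Red V 3 0 := .of_lt hV.three

lemma char_three : (3 : IsLocalRing.ResidueField V) = 0 := by
  have h : Red V 3 3 := by
    have := (Red.one (V := V)).add (Red.one.add Red.one)
    norm_num at this
    exact this
  exact h.unique hV.red_three

lemma two_ne_zero : (2 : IsLocalRing.ResidueField V) ≠ 0 := fun h => by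
  have : (1 : IsLocalRing.ResidueField V) = 0 := by linear_combination hV.char_three - h
  exact one_ne_zero this

lemma val_sqrtm3 : V.valuation sqrtm3 < 1 := by
  have h : V.valuation sqrtm3 ^ 2 < 1 := by
    rw [← map_pow, sqrtm3_sq, Valuation.map_neg]; exact hV.three
  exact (pow_lt_one_iff (by norm_num)).1 h

lemma red_sqrtm3 : Red V sqrtm3 0 := .of_lt hV.val_sqrtm3

lemma red_of_expan {a : ℂ} {α : IsLocalRing.ResidueField V} (h : Expan V a α) : Red V a 1 := by
  obtain ⟨b, rfl, hb⟩ := h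
  have := Red.one.add (hV.red_sqrtm3.mul hb)
  simpa using this

omit hV in
lemma mem_of_pow {z : ℂ} {n : ℕ} (hn : n ≠ 0) (h : z ^ n ∈ V) : z ∈ V := by
  apply V.mem_of_valuation_le_one
  rw [← V.valuation_le_one_iff, map_pow] at h
  exact (pow_le_one_iff hn).1 h

end IsPlace

namespace Expan

variable {a b : ℂ} {α β : IsLocalRing.ResidueField V}

lemma one : Expan V 1 0 := ⟨0, by ring, Red.zero⟩

lemma mul (hV : IsPlace V) (h1 : Expan V a α) (h2 : Expan V b β) : Expan V (a * b) (α + β) := by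
  obtain ⟨a', rfl, h1⟩ := h1
  obtain ⟨b', rfl, h2⟩ := h2
  refine ⟨a' + b' + sqrtm3 * (a' * b'), by ring, ?_⟩
  have := (h1.add h2).add (hV.red_sqrtm3.mul (h1.mul h2))
  simpa using this

lemma inv (hV : IsPlace V) (h1 : Expan V a α) : Expan V a⁻¹ (-α) := by
  have h2 := hV.red_of_expan h1
  have h0 := h2.ne_zero one_ne_zero
  have h3 := h2.inv one_ne_zero
  obtain ⟨a', e, h1⟩ := h1
  refine ⟨-(a' * a⁻¹), ?_, ?_⟩
  · field_simp; rw [e]; ring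
  · have := (h1.mul h3).neg
    simpa using this

lemma div (hV : IsPlace V) (h1 : Expan V a α) (h2 : Expan V b β) : Expan V (a / b) (α - β) := by
  rw [div_eq_mul_inv, sub_eq_add_neg]; exact h1.mul hV (h2.inv hV)

lemma pow (hV : IsPlace V) (h1 : Expan V a α) (n : ℕ) : Expan V (a ^ n) (n * α) := by
  induction n with
  | zero => simpa using Expan.one
  | succ n ih =>
    rw [pow_succ, Nat.cast_succ, add_mul, one_mul]; exact ih.mul hV h1

lemma prod (hV : IsPlace V) {ι : Type*} {s : Finset ι} {f : ι → ℂ}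
    {g : ι → IsLocalRing.ResidueField V}
    (h : ∀ i ∈ s, Expan V (f i) (g i)) : Expan V (∏ i ∈ s, f i) (∑ i ∈ s, g i) := by
  classical
  induction s using Finset.induction_on with
  | empty => simpa using Expan.one
  | insert i s hi ih =>
    rw [Finset.prod_insert hi, Finset.sum_insert hi]
    exact (h i (Finset.mem_insert_self i s)).mul hV
      (ih fun j hj => h j (Finset.mem_insert_of_mem hj))

lemma unique (h1 : Expan V a α) (h2 : Expan V a β) : α = β := by
  obtain ⟨a', e, h1⟩ := h1
  obtain ⟨b', e', h2⟩ := h2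
  have : a' = b' := mul_left_cancel₀ sqrtm3_ne_zero (by linear_combination e' - e)
  subst this
  exact h1.unique h2

lemma rho (hV : IsPlace V) : Expan V ρ3 (-1) := by
  refine ⟨-ρ3 ^ 2, by rw [sqrtm3_eq]; linear_combination (1 - ρ3) * rho3_cube, ?_⟩
  have h : Red V (ρ3 ^ 2) 1 := by
    obtain ⟨β, hβ⟩ := Red.exists_of_mem (hV.mem rho3_mem)
    have h1 := hV.red_sqrtm3
    have h2 := (Red.one (V := V)).add ((hβ.add hβ))
    rw [show (1 : ℂ) + (ρ3 + ρ3) = sqrtm3 by rw [sqrtm3_eq']; ring] at h2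
    have h3 := h2.unique h1
    have : β = 1 := by linear_combination (-1 : IsLocalRing.ResidueField V) * h3 + β * hV.char_three
    rw [this] at hβ
    simpa using hβ.pow 2
  exact h.neg

lemma of_primary (hV : IsPlace V) {d : ℂ} (hd : d ∈ V) : Expan V (1 + 3 * d) 0 := by
  refine ⟨-sqrtm3 * d, by linear_combination d * sqrtm3_sq, ?_⟩
  obtain ⟨δ, h⟩ := Red.exists_of_mem hd
  have := hV.red_sqrtm3.neg.mul h
  simpa using this

lemma eq_one_of_cube (hV : IsPlace V) {ω : ℂ} (h : ω ^ 3 = 1) (h0 : Expan V ω 0) : ω = 1 := by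
  have : (ω - 1) * (ω - ρ3) * (ω - ρ3 ^ 2) = 0 := by
    linear_combination h + (ω - ω ^ 2) * rho3_sum + (ω - 1) * rho3_cube
  rcases mul_eq_zero.1 this with h1 | h1
  · rcases mul_eq_zero.1 h1 with h1 | h1
    · exact sub_eq_zero.1 h1
    · rw [sub_eq_zero.1 h1] at h0
      exact absurd (h0.unique (rho hV)).symm (neg_ne_zero.2 one_ne_zero)
  · rw [sub_eq_zero.1 h1] at h0
    have := h0.unique ((rho hV).pow hV 2)
    push_cast at this
    exact absurd (by linear_combination this) hV.two_ne_zero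

end Expan

end place

/-! ### The reduction of the division values of `℘` -/

lemma exists_fixed : ∃ x0 : ℂ, 4 * x0 ^ 3 = -1 ∧ (starRingEnd ℂ) x0 = x0 := by
  have h : ((1 / 4 : ℝ) ^ (1 / 3 : ℝ)) ^ 3 = 1 / 4 := by
    rw [← Real.rpow_natCast, ← Real.rpow_mul (by norm_num)]; norm_num
  refine ⟨((-((1 / 4 : ℝ) ^ (1 / 3 : ℝ)) : ℝ) : ℂ), ?_, Complex.conj_ofReal _⟩
  rw [← Complex.ofReal_pow, neg_pow, h]; norm_num

section system

variable {V : ValuationSubring ℂ} {p : ℕ} {x0 : ℂ}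

lemma IsPlace.red_fixed (hV : IsPlace V) (h : 4 * x0 ^ 3 = -1) : Red V x0 (-1) := by
  have h4 : Red V 4 1 := by
    have := hV.red_three.add Red.one
    norm_num at this; exact this
  have h1 : x0 ^ 3 = -(4 : ℂ)⁻¹ := by field_simp; linear_combination h
  have hm : x0 ∈ V := IsPlace.mem_of_pow (n := 3) (by norm_num) (by
    rw [h1]
    exact (h4.inv one_ne_zero).neg.1)
  obtain ⟨β, hβ⟩ := Red.exists_of_mem hm
  have h2 := hβ.pow 3
  rw [h1] at h2
  have h3 := h2.unique (h4.inv one_ne_zero).neg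
  rw [inv_one] at h3
  have h5 : (β + 1) ^ 3 = 0 := by linear_combination h3 + (β ^ 2 + β) * hV.char_three
  have : β = -1 := by linear_combination (pow_eq_zero_iff (by norm_num)).1 h5
  rwa [this] at hβ

/-- The relations satisfied by `-℘/3` at the division points, with `ℓ` acting as `√−3` and
`r` as a cube root of unity. -/
structure DivSystem {p : ℕ} (ℓ r : ZMod p) (ω : ℂ) (X : ZMod p → ℂ) : Prop where
  isog : ∀ x, x ≠ 0 → -3 * X x ^ 2 * X (ℓ * x) = 1 + X x ^ 3
  rot : ∀ x, x ≠ 0 → X (r * x) = ω * X x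
  neg : ∀ x, x ≠ 0 → X (-x) = X x

variable [Fact p.Prime] {ℓ r : ZMod p} {ω : ℂ} {X : ZMod p → ℂ}

lemma isog_integral {x0 s x y T U : ℂ} (hl : s ^ 2 = -3) (h0 : 4 * x0 ^ 3 = -1)
    (hx : x = x0 + s * T) (hy : y = x0 + s * U) (h : -3 * x ^ 2 * y = 1 + x ^ 3) :
    U * (x0 + s * T) ^ 2 = T ^ 3 - 2 * x0 * s * T ^ 2 - 3 * x0 ^ 2 * T := by
  have hl0 : s ≠ 0 := by rintro rfl; norm_num at hl
  apply mul_left_cancel₀ (pow_ne_zero 3 hl0)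
  rw [hx, hy] at h
  linear_combination h + h0 + (U * s * (s * T + x0) ^ 2 + 2 * s * x0 * T ^ 2 * s + 
    3 * x0 ^ 2 * s * T) * hl

lemma DivSystem.mem (hX : DivSystem ℓ r ω X) (hV : IsPlace V) (h0 : 4 * x0 ^ 3 = -1) (hℓ : ℓ ≠ 0)
    {T : ZMod p → ℂ} (hT : ∀ x, X x = x0 + sqrtm3 * T x) : ∀ x, x ≠ 0 → T x ∈ V := by
  classical
  obtain ⟨x, hx, hmax⟩ := Finset.exists_max_image (Finset.univ.erase (0 : ZMod p))
    (fun x => V.valuation (T x)) ⟨1, by simp⟩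
  have hx0 : x ≠ 0 := Finset.ne_of_mem_erase hx
  suffices h : V.valuation (T x) ≤ 1 by
    intro y hy
    exact V.mem_of_valuation_le_one _ ((hmax y (by simp [hy])).trans h)
  by_contra! hgt
  have hne : T x ≠ 0 := by
    intro h; rw [h, map_zero] at hgt; exact absurd hgt (not_lt.2 zero_le_one)
  have hinv : Red V (T x)⁻¹ 0 := .of_lt (by
    rw [map_inv₀]; exact inv_lt_one_of_one_lt₀ hgt)
  have hf := hV.red_fixed h0
  have e := isog_integral sqrtm3_sq h0 (hT x) (hT (ℓ * x)) (hX.isog x hx0)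
  set z := T x
  set w := T (ℓ * x)
  have e2 : w * (x0 * z⁻¹ + sqrtm3) ^ 2 =
      z * (1 - (1 + 1) * x0 * sqrtm3 * z⁻¹ - 3 * x0 ^ 2 * (z⁻¹) ^ 2) := by
    field_simp
    linear_combination e
  have r1 : Red V (x0 * z⁻¹ + sqrtm3) 0 := by
    have := (hf.mul hinv).add hV.red_sqrtm3
    simpa using this
  have r2 : Red V (1 - (1 + 1) * x0 * sqrtm3 * z⁻¹ - 3 * x0 ^ 2 * (z⁻¹) ^ 2) 1 := by
    have := (Red.one.sub ((((Red.one.add Red.one).mul hf).mul hV.red_sqrtm3).mul hinv)).sub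
      ((hV.red_three.mul (hf.pow 2)).mul (hinv.pow 2))
    simpa using this
  have e3 := congrArg V.valuation e2
  have hw : V.valuation w ≤ V.valuation z := hmax _ (by simp [hℓ, hx0])
  have r3 : V.valuation (x0 * z⁻¹ + sqrtm3) < 1 := by
    obtain ⟨h1, h2⟩ := r1
    exact (V.valuation_lt_one_iff ⟨_, h1⟩).1 ((IsLocalRing.residue_eq_zero_iff _).1 h2)
  rw [map_mul, map_mul, map_pow, r2.val_eq_one one_ne_zero, mul_one] at e3
  have hz0 : 0 < V.valuation z := zero_lt_one.trans hgt
  have : V.valuation w * V.valuation (x0 * z⁻¹ + sqrtm3) ^ 2 < V.valuation z := by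
    calc _ ≤ V.valuation z * V.valuation (x0 * z⁻¹ + sqrtm3) ^ 2 := by gcongr
      _ < V.valuation z * 1 := by
          apply mul_lt_mul_of_pos_left _ hz0
          exact pow_lt_one₀ zero_le r3 (by norm_num)
      _ = _ := mul_one _
  exact absurd e3 this.ne

/-- The reduction of a division system. -/
lemma DivSystem.exists_tau (hX : DivSystem ℓ r ω X) (hV : IsPlace V) (h0 : 4 * x0 ^ 3 = -1)
    (hℓ : ℓ ≠ 0) (hr : r ≠ 0) {ε : IsLocalRing.ResidueField V} (hω : Expan V ω (-ε)) :
    ∃ τ : ZMod p → IsLocalRing.ResidueField V, (∀ x, x ≠ 0 → Expan V (X x / x0) (-τ x)) ∧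
      (∀ x, x ≠ 0 → τ (ℓ * x) = τ x ^ 3) ∧ (∀ x, x ≠ 0 → τ (r * x) = τ x + ε) ∧
      ∀ x, x ≠ 0 → τ (-x) = τ x := by
  have hs := sqrtm3_ne_zero
  set T : ZMod p → ℂ := fun x => (X x - x0) / sqrtm3 with hTd
  have hT : ∀ x, X x = x0 + sqrtm3 * T x := fun x => by rw [hTd]; field_simp; ring
  have hmem := hX.mem hV h0 hℓ hT
  have hf := hV.red_fixed h0
  have hf0 : x0 ≠ 0 := hf.ne_zero (neg_ne_zero.2 one_ne_zero)
  choose! τ hτ using fun x (hx : x ≠ 0) => Red.exists_of_mem (hmem x hx)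
  refine ⟨τ, fun x hx => ⟨T x / x0, ?_, ?_⟩, fun x hx => ?_, fun x hx => ?_, fun x hx => ?_⟩
  · rw [hT]; field_simp
  · have := (hτ x hx).mul (hf.inv (neg_ne_zero.2 one_ne_zero))
    rw [← div_eq_mul_inv] at this
    simpa using this
  · have e := isog_integral sqrtm3_sq h0 (hT x) (hT (ℓ * x)) (hX.isog x hx)
    have r1 := (hτ (ℓ * x) (mul_ne_zero hℓ hx)).mul ((hf.add (hV.red_sqrtm3.mul (hτ x hx))).pow 2)
    have r2 := (((hτ x hx).pow 3).sub ((((Red.one.add Red.one).mul hf).mul hV.red_sqrtm3).mul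
      ((hτ x hx).pow 2))).sub ((hV.red_three.mul (hf.pow 2)).mul (hτ x hx))
    rw [e] at r1
    have := r1.unique (by convert r2 using 1; ring)
    linear_combination this
  · obtain ⟨m, e, hm⟩ := hω
    have e2 : T (r * x) = m * x0 + ω * T x := by
      apply mul_left_cancel₀ hs
      have h1 := hX.rot x hx
      rw [hT, hT] at h1
      linear_combination h1 + x0 * e
    have r1 := (hm.mul hf).add ((hV.red_of_expan ⟨m, e, hm⟩).mul (hτ x hx))
    rw [← e2] at r1
    have := (hτ (r * x) (mul_ne_zero hr hx)).unique r1
    rw [this]; ring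
  · have e2 : T (-x) = T x := by rw [hTd]; simp only; rw [hX.neg x hx]
    have r1 := hτ (-x) (neg_ne_zero.2 hx)
    rw [e2] at r1
    exact r1.unique (hτ x hx)

end system

/-! ### Third sets -/

section third

variable {p : ℕ} [Fact p.Prime] {r : ZMod p} {S S' : Finset (ZMod p)}

/-- A set of representatives of the nonzero residues modulo powers of `r`. -/
structure ThirdSet (r : ZMod p) (S : Finset (ZMod p)) : Prop where
  ne_zero : ∀ s ∈ S, s ≠ 0
  cover : ∀ x, x ≠ 0 → ∃ s ∈ S, ∃ n : ℕ, x = r ^ n * s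
  inj : ∀ s ∈ S, ∀ s' ∈ S, ∀ n : ℕ, s = r ^ n * s' → s = s'

/-- A primitive cube root of unity. -/
structure CubeRoot (r : ZMod p) : Prop where
  quad : r ^ 2 + r + 1 = 0
  ne_one : r ≠ 1

namespace CubeRoot

lemma cube (h : CubeRoot r) : r ^ 3 = 1 := by linear_combination (r - 1) * h.quad

lemma ne_zero (h : CubeRoot r) : r ≠ 0 := by
  rintro rfl; have := h.quad; norm_num at this

lemma sq_ne_one (h : CubeRoot r) : r ^ 2 ≠ 1 := fun h2 =>
  h.ne_one (by linear_combination h.cube - r * h2)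

lemma exists_inv (h : CubeRoot r) {x y : ZMod p} {n : ℕ} (e : x = r ^ n * y) :
    ∃ m : ℕ, y = r ^ m * x := by
  refine ⟨2 * n, ?_⟩
  rw [e, ← mul_assoc, ← pow_add, show 2 * n + n = 3 * n by ring, pow_mul, h.cube, one_pow, one_mul]

lemma pow_mod (h : CubeRoot r) (n : ℕ) : r ^ n = r ^ (n % 3) := by
  conv_lhs => rw [← Nat.div_add_mod n 3]
  rw [pow_add, pow_mul, h.cube, one_pow, one_mul]

lemma mod_eq_of_pow_eq (h : CubeRoot r) {m n : ℕ} (e : r ^ m = r ^ n) : m % 3 = n % 3 := by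
  rw [h.pow_mod m, h.pow_mod n] at e
  have h1 := h.ne_one
  have h2 := h.sq_ne_one
  have h0 := h.ne_zero
  have hm := Nat.mod_lt m (by norm_num : 3 > 0)
  have hn := Nat.mod_lt n (by norm_num : 3 > 0)
  have h3 : r ^ 2 ≠ r := fun h3 => h1 (mul_right_cancel₀ h0 (by linear_combination h3))
  generalize m % 3 = a at *
  generalize n % 3 = b at *
  interval_cases a <;> interval_cases b <;> simp only [pow_zero, pow_one] at e <;>
    first | rfl | exact absurd e h1 | exact absurd e.symm h1 | exact absurd e h2 |
      exact absurd e.symm h2 | exact absurd e h3 | exact absurd e.symm h3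

end CubeRoot

lemma pow_rot {M : Type*} [CommMonoid M] {F : ZMod p → M} {c : M} (hr : r ≠ 0)
    (hF : ∀ x, x ≠ 0 → F (r * x) = c * F x) (n : ℕ) {x : ZMod p} (hx : x ≠ 0) :
    F (r ^ n * x) = c ^ n * F x := by
  induction n with
  | zero => simp
  | succ n ih =>
    rw [pow_succ', mul_assoc, hF _ (mul_ne_zero (pow_ne_zero n hr) hx), ih, pow_succ', mul_assoc]

namespace ThirdSet

/-- Products over two third sets compare by a common exponent. -/
theorem exists_transfer (h : CubeRoot r) (hS : ThirdSet r S) (hS' : ThirdSet r S') :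
    ∃ n : ℕ, ∀ (M : Type) [CommMonoid M] (F : ZMod p → M) (c : M),
      (∀ x, x ≠ 0 → F (r * x) = c * F x) → ∏ x ∈ S', F x = c ^ n * ∏ x ∈ S, F x := by
  classical
  choose! σ hσ i hi using hS.cover
  refine ⟨∑ x ∈ S', i x, fun M _ F c hF => ?_⟩
  have h1 : ∀ x ∈ S', F x = c ^ i x * F (σ x) := fun x hx => by
    have hx0 := hS'.ne_zero x hx
    conv_lhs => rw [hi x hx0]
    exact pow_rot h.ne_zero hF _ (hS.ne_zero _ (hσ x hx0))
  rw [Finset.prod_congr rfl h1, Finset.prod_mul_distrib, Finset.prod_pow_eq_pow_sum]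
  congr 1
  refine Finset.prod_nbij σ (fun x hx => hσ x (hS'.ne_zero x hx)) ?_ ?_ (fun _ _ => rfl)
  · intro x hx y hy e
    obtain ⟨m, hm⟩ := h.exists_inv (hi y (hS'.ne_zero y hy))
    refine hS'.inj x hx y hy (i x + m) ?_
    rw [pow_add, mul_assoc, ← hm, ← e]
    exact hi x (hS'.ne_zero x hx)
  · intro s hs
    have hs' : s ∈ S := hs
    obtain ⟨x, hx, n, e⟩ := hS'.cover s (hS.ne_zero s hs')
    have hx0 := hS'.ne_zero x hx
    refine ⟨x, hx, ?_⟩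
    refine (hS.inj s hs' _ (hσ x hx0) (n + i x) ?_).symm
    rw [pow_add, mul_assoc, ← hi x hx0, e]

lemma prod_univ (h : CubeRoot r) (hS : ThirdSet r S) {M : Type*} [CommMonoid M] (G : ZMod p → M) :
    ∏ x ∈ Finset.univ.erase 0, G x = ∏ s ∈ S, (G s * G (r * s) * G (r ^ 2 * s)) := by
  classical
  have : ∀ s ∈ S, G s * G (r * s) * G (r ^ 2 * s) = ∏ i ∈ Finset.range 3, G (r ^ i * s) := by
    intro s _; rw [Finset.prod_range_succ, Finset.prod_range_succ, Finset.prod_range_one]; simp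
  rw [Finset.prod_congr rfl this, ← Finset.prod_product' S (Finset.range 3) fun s i => G (r ^ i * s)]
  symm
  refine Finset.prod_nbij (fun q => r ^ q.2 * q.1) ?_ ?_ ?_ (fun _ _ => rfl)
  · rintro ⟨s, i⟩ hq
    rw [Finset.mem_product] at hq
    simp [h.ne_zero, hS.ne_zero s hq.1]
  · rintro ⟨s, i⟩ hq ⟨s', j⟩ hq' e
    rw [Finset.mem_coe, Finset.mem_product, Finset.mem_range] at hq hq'
    simp only at e hq hq'
    obtain ⟨m, hm⟩ := h.exists_inv e.symm
    obtain ⟨m', hm'⟩ := h.exists_inv (x := r ^ j * s') rfl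
    have hss : s = s' := by
      obtain ⟨k, hk⟩ := h.exists_inv (x := r ^ i * s) rfl
      refine hS.inj s hq.1 s' hq'.1 (k + j) ?_
      rw [pow_add, mul_assoc, ← e, ← hk]
    subst hss
    have := h.mod_eq_of_pow_eq (mul_right_cancel₀ (hS.ne_zero s hq.1) e)
    rw [Nat.mod_eq_of_lt hq.2, Nat.mod_eq_of_lt hq'.2] at this
    rw [this]
  · intro x hx
    have hx0 : x ≠ 0 := by simpa using hx
    obtain ⟨s, hs, n, e⟩ := hS.cover x hx0
    refine ⟨(s, n % 3), ?_, ?_⟩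
    · rw [Finset.mem_coe, Finset.mem_product, Finset.mem_range]
      exact ⟨hs, Nat.mod_lt _ (by norm_num)⟩
    · simp only; rw [← h.pow_mod, e]

lemma card (h : CubeRoot r) (hS : ThirdSet r S) : p = 3 * S.card + 1 := by
  have := hS.prod_univ h (fun _ => Multiplicative.ofAdd 1 : ZMod p → Multiplicative ℕ)
  rw [Finset.prod_const, Finset.prod_const, Finset.card_erase_of_mem (Finset.mem_univ _),
    Finset.card_univ, ZMod.card] at this
  have h2 := congrArg Multiplicative.toAdd this
  simp only [toAdd_pow, toAdd_mul, toAdd_ofAdd, smul_eq_mul] at h2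
  have := (Fact.out : p.Prime).two_le
  omega

lemma smul (hS : ThirdSet r S) {z : ZMod p} (hz : z ≠ 0) : ThirdSet r (S.image (z * ·)) where
  ne_zero := by
    simp only [Finset.mem_image, forall_exists_index, and_imp]
    rintro _ s hs rfl
    exact mul_ne_zero hz (hS.ne_zero s hs)
  cover := fun x hx => by
    obtain ⟨s, hs, n, e⟩ := hS.cover (z⁻¹ * x) (mul_ne_zero (inv_ne_zero hz) hx)
    refine ⟨z * s, Finset.mem_image_of_mem _ hs, n, ?_⟩
    rw [mul_left_comm, ← e, mul_inv_cancel_left₀ hz]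
  inj := by
    simp only [Finset.mem_image, forall_exists_index, and_imp]
    rintro _ s hs rfl _ s' hs' rfl n e
    rw [hS.inj s hs s' hs' n (mul_left_cancel₀ hz (by rw [e]; ring))]

lemma inv (h : CubeRoot r) (hS : ThirdSet r S) : ThirdSet r (S.image (·⁻¹)) where
  ne_zero := by
    simp only [Finset.mem_image, forall_exists_index, and_imp]
    rintro _ s hs rfl
    exact inv_ne_zero (hS.ne_zero s hs)
  cover := fun x hx => by
    obtain ⟨s, hs, n, e⟩ := hS.cover x⁻¹ (inv_ne_zero hx)
    obtain ⟨m, hm⟩ := h.exists_inv e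
    refine ⟨s⁻¹, Finset.mem_image_of_mem _ hs, m, ?_⟩
    have hs0 := hS.ne_zero s hs
    rw [hm]
    have := pow_ne_zero m h.ne_zero
    field_simp
  inj := by
    simp only [Finset.mem_image, forall_exists_index, and_imp]
    rintro _ s hs rfl _ s' hs' rfl n e
    congr 1
    have hs0 := hS.ne_zero s hs
    have hs0' := hS.ne_zero s' hs'
    refine (hS.inj s' hs' s hs n ?_).symm
    field_simp at e
    rw [e, mul_comm]

lemma prod_smul {z : ZMod p} (hz : z ≠ 0) {M : Type*} [CommMonoid M] (F : ZMod p → M) :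
    ∏ x ∈ S.image (z * ·), F x = ∏ s ∈ S, F (z * s) :=
  Finset.prod_image fun _ _ _ _ e => mul_left_cancel₀ hz e

lemma prod_inv {M : Type*} [CommMonoid M] (F : ZMod p → M) :
    ∏ x ∈ S.image (·⁻¹), F x = ∏ s ∈ S, F s⁻¹ :=
  Finset.prod_image fun _ _ _ _ e => inv_injective e

/-- Gauss's lemma for cubic residues. -/
theorem gauss_lemma (h : CubeRoot r) (hS : ThirdSet r S) {z : ZMod p} (hz : z ≠ 0) :
    ∃ n : ℕ, z ^ S.card = r ^ n ∧ ∀ (M : Type) [CommMonoid M] (F : ZMod p → M) (c : M),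
      (∀ x, x ≠ 0 → F (r * x) = c * F x) → ∏ x ∈ S, F (z * x) = c ^ n * ∏ x ∈ S, F x := by
  obtain ⟨n, hn⟩ := exists_transfer h hS (hS.smul hz)
  have hn' : ∀ (M : Type) [CommMonoid M] (F : ZMod p → M) (c : M),
      (∀ x, x ≠ 0 → F (r * x) = c * F x) → ∏ x ∈ S, F (z * x) = c ^ n * ∏ x ∈ S, F x := by
    intro M _ F c hF
    rw [← prod_smul hz]; exact hn M F c hF
  refine ⟨n, ?_, hn'⟩
  have : ∏ x ∈ S, z * x = r ^ n * ∏ x ∈ S, x := hn' (ZMod p) id r (fun _ _ => rfl)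
  rw [Finset.prod_mul_distrib, Finset.prod_const] at this
  exact mul_right_cancel₀ (Finset.prod_ne_zero_iff.2 hS.ne_zero) this

theorem inv_transfer (h : CubeRoot r) (hS : ThirdSet r S) :
    ∃ n : ℕ, r ^ n * (∏ s ∈ S, s) ^ 2 = 1 ∧ ∀ (M : Type) [CommMonoid M] (F : ZMod p → M) (c : M),
      (∀ x, x ≠ 0 → F (r * x) = c * F x) → ∏ x ∈ S, F x⁻¹ = c ^ n * ∏ x ∈ S, F x := by
  obtain ⟨n, hn⟩ := exists_transfer h hS (hS.inv h)
  have hn' : ∀ (M : Type) [CommMonoid M] (F : ZMod p → M) (c : M),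
      (∀ x, x ≠ 0 → F (r * x) = c * F x) → ∏ x ∈ S, F x⁻¹ = c ^ n * ∏ x ∈ S, F x := by
    intro M _ F c hF
    rw [← prod_inv]; exact hn M F c hF
  refine ⟨n, ?_, hn'⟩
  have : ∏ x ∈ S, x⁻¹ = r ^ n * ∏ x ∈ S, x := hn' (ZMod p) id r (fun _ _ => rfl)
  rw [Finset.prod_inv_distrib] at this
  have h0 : ∏ s ∈ S, s ≠ 0 := Finset.prod_ne_zero_iff.2 hS.ne_zero
  rw [sq, ← mul_assoc, ← this, inv_mul_cancel₀ h0]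

/-- The additive form of a transfer exponent. -/
lemma _root_.additive_transfer {κ : Type} [AddCommGroup κ] {S : Finset (ZMod p)} {f : ZMod p → ZMod p}
    {n : ℕ} (hn : ∀ (M : Type) [CommMonoid M] (F : ZMod p → M) (c : M),
      (∀ x, x ≠ 0 → F (r * x) = c * F x) → ∏ x ∈ S, F (f x) = c ^ n * ∏ x ∈ S, F x)
    {F : ZMod p → κ} {c : κ} (hF : ∀ x, x ≠ 0 → F (r * x) = F x + c) :
    ∑ x ∈ S, F (f x) = n • c + ∑ x ∈ S, F x := by
  have := hn (Multiplicative κ) (fun x => Multiplicative.ofAdd (F x)) (Multiplicative.ofAdd c)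
    (fun x hx => by rw [hF x hx, ofAdd_add, mul_comm])
  have := congrArg Multiplicative.toAdd this
  simpa [toAdd_prod] using this

end ThirdSet

end third

/-! ### Relations among division values -/

/-- `ρ` as an element of the Eisenstein integers. -/
def rO : O3 := ⟨ρ3, rho3_mem⟩

/-- `√−3` as an element of the Eisenstein integers. -/
def sO : O3 := ⟨sqrtm3, sqrtm3_mem⟩

lemma rO_quad : rO ^ 2 + rO + 1 = 0 := Subtype.ext (by
  simp only [rO]; push_cast; linear_combination rho3_sum)

lemma sO_sq : sO ^ 2 = -3 := Subtype.ext (by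
  simp only [sO]; push_cast; exact sqrtm3_sq)

section relations

variable {p : ℕ} {π : ℂ} [Fact p.Prime] {t : O3 →+* ZMod p}

lemma cubeRoot_rO (h : PrimaryPrime p π) : CubeRoot (t rO) where
  quad := by
    have := congrArg t rO_quad
    simpa using this
  ne_one := fun h1 => by
    have := congrArg t rO_quad
    simp only [map_add, map_pow, map_one, map_zero, h1] at this
    apply resHom_three_ne (t := t) h
    have h3 : t 3 = 1 + 1 + 1 := by rw [← map_one t, ← map_add, ← map_add]; norm_num
    rw [h3, ← this]; ring

lemma resHom_sO_sq : t sO ^ 2 = -t 3 := by rw [← map_pow, sO_sq, map_neg]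

lemma resHom_sO_ne (h : PrimaryPrime p π) : t sO ≠ 0 := fun h0 => by
  have := resHom_sO_sq (t := t)
  rw [h0] at this
  exact resHom_three_ne (t := t) h (by simpa using this)

/-- The normalised values `-℘/3` at the `π`-division points. -/
def Xp (π : ℂ) {p : ℕ} (x : ZMod p) : ℂ := -EX (dpt π x) / 3

lemma Xp_mul (ht : IsResHom π t) (h : PrimaryPrime p π) (z : O3) (x : ZMod p) :
    Xp π (t z * x) = -EX (z * dpt π x) / 3 := by
  obtain ⟨l, hl, e⟩ := exists_dpt_mul ht h x z
  rw [e, EX_add hl, Xp]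

lemma Phi_mul (ht : IsResHom π t) (h : PrimaryPrime p π) (z : O3) (x : ZMod p) :
    Phi π (t z * x) = PH (z * dpt π x) := by
  obtain ⟨l, hl, e⟩ := exists_dpt_mul ht h x z
  rw [e, PH_add hl, Phi]

lemma Phi_neg_eq (ht : IsResHom π t) (h : PrimaryPrime p π) (x : ZMod p) :
    Phi π (-x) = PH (-dpt π x) := by
  have := Phi_mul ht h (-1) x
  simpa using this

lemma Phi_rho (ht : IsResHom π t) (h : PrimaryPrime p π) (x : ZMod p) :
    Phi π (t rO * x) = ρ3 * Phi π x := by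
  rw [Phi_mul ht h, rO, PH_rho, Phi]

lemma sqrtm3_dpt_notMem (ht : IsResHom π t) (h : PrimaryPrime p π) {x : ZMod p} (hx : x ≠ 0) :
    sqrtm3 * dpt π x ∉ O3 := fun hm => mul_ne_zero (resHom_sO_ne (t := t) h) hx
  ((mul_dpt_mem_iff ht h x sO).1 hm)

theorem divSystem_Xp (ht : IsResHom π t) (h : PrimaryPrime p π) :
    DivSystem (t sO) (t rO) ρ3 (fun x : ZMod p => Xp π x) where
  isog := fun x hx => by
    have := EX_sqrtm3 (dpt_notMem ht h hx) (sqrtm3_dpt_notMem ht h hx)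
    rw [LP_g₃] at this
    rw [Xp_mul ht h, sO, Xp]
    linear_combination this / 27
  rot := fun x _ => by
    rw [Xp_mul ht h, rO, EX_rho, Xp]; ring
  neg := fun x _ => by
    have := Xp_mul ht h (-1) x
    simp only [map_neg, map_one, neg_mul, one_mul] at this
    rw [this]
    push_cast
    rw [neg_one_mul, EX_neg, Xp]

lemma DivSystem.conj {ℓ r : ZMod p} {ω : ℂ} {X : ZMod p → ℂ} (hX : DivSystem ℓ r ω X) :
    DivSystem ℓ r ((starRingEnd ℂ) ω) (fun x => (starRingEnd ℂ) (X x)) where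
  isog := fun x hx => by
    have := congrArg (starRingEnd ℂ) (hX.isog x hx)
    simpa [Complex.conj_ofNat] using this
  rot := fun x hx => by rw [hX.rot x hx, map_mul]
  neg := fun x hx => by rw [hX.neg x hx]

lemma sq_relations {X Y W : ℂ} (hW : W ^ 2 = 4 * X ^ 3 - 27) (h1 : 9 + W ≠ 0) (h2 : 9 + -W ≠ 0)
    (hY : 3 * X ^ 2 * Y = 27 - X ^ 3) :
    6 * X / (9 + W) * (6 * X / (9 + -W)) * (-Y / 3) = -1 ∧
    (6 * X / (9 + W) + 6 * X / (9 + -W)) * (-X / 3 * (-Y / 3)) = 1 := by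
  constructor
  · field_simp
    linear_combination (-12 : ℂ) * hY - 3 * hW
  · field_simp
    linear_combination (36 : ℂ) * hY + 9 * hW

lemma Phi_relations (ht : IsResHom π t) (h : PrimaryPrime p π) {x : ZMod p} (hx : x ≠ 0) :
    Phi π x * Phi π (-x) * Xp π (t sO * x) = -1 ∧
    (Phi π x + Phi π (-x)) * (Xp π x * Xp π (t sO * x)) = 1 := by
  have h1 := dpt_notMem ht h hx
  have h2 : -dpt π x ∉ O3 := fun hm => h1 (by simpa using O3.neg_mem hm)
  have h3 := three_dpt_notMem ht h hx
  have h3' : 3 * -dpt π x ∉ O3 := fun hm => h3 (by simpa using O3.neg_mem hm)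
  have h4 := EX_sqrtm3 h1 (sqrtm3_dpt_notMem ht h hx)
  rw [LP_g₃] at h4
  have h5 := nine_add_EW_ne h3'
  rw [EW_neg] at h5
  rw [Phi_neg_eq ht h, Xp_mul ht h, Phi, Xp, PH_of_notMem h1, PH_of_notMem h2, EX_neg, EW_neg]
  exact sq_relations (EW_sq' h1) (nine_add_EW_ne h3) h5 h4

end relations

/-! ### The reduced functional equation -/

section reduced

variable {p : ℕ} {π : ℂ} [Fact p.Prime] {t : O3 →+* ZMod p} {V : ValuationSubring ℂ}

/-- The additive character `echar π` as an element of Mathlib's `AddChar`. -/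
def echarAdd (ht : IsResHom π t) (h : PrimaryPrime p π) : AddChar (ZMod p) ℂ where
  toFun := echar π
  map_zero_eq_one' := echar_zero
  map_add_eq_mul' := echar_add ht h

lemma echarAdd_apply (ht : IsResHom π t) (h : PrimaryPrime p π) (x : ZMod p) :
    echarAdd ht h x = echar π x := rfl

lemma Phi_zero : Phi π (0 : ZMod p) = 0 := by rw [Phi, dpt_zero, PH_zero]

lemma Phi_ne_zero (ht : IsResHom π t) (h : PrimaryPrime p π) {x : ZMod p} (hx : x ≠ 0) :
    Phi π x ≠ 0 := fun h0 => h.ne_zero (by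
  rw [← prod_Phi ht h]; exact Finset.prod_eq_zero (by simpa using hx) h0)

lemma echarAdd_ne_one (ht : IsResHom π t) (h : PrimaryPrime p π) : echarAdd ht h ≠ 1 := fun h1 => by
  have e : ∀ x : ZMod p, echar π x = 1 := fun x => by
    rw [← echarAdd_apply ht h, h1, AddChar.one_apply]
  have h0 := fourier_Phi ht h 0
  have h2 := fourier_Phi ht h 1
  simp only [e, Phi_zero, map_zero, mul_zero] at h0 h2
  rw [h0] at h2
  have h3 : (starRingEnd ℂ) (Phi π (1 : ZMod p)) ≠ 0 := by
    simpa using Phi_ne_zero ht h (one_ne_zero)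
  exact mul_ne_zero (mul_ne_zero (neg_ne_zero.2 (pow_ne_zero 2 rho3_ne_zero)) h.ne_zero) h3 h2.symm

lemma sum_echar (ht : IsResHom π t) (h : PrimaryPrime p π) {y : ZMod p} (hy : y ≠ 0) :
    ∑ x ∈ Finset.univ.erase (0 : ZMod p), echar π (x * y) = -1 := by
  have h1 : ∑ x : ZMod p, echar π (x * y) = 0 := by
    rw [Fintype.sum_bijective (· * y) (mulRight_bijective₀ y hy) (fun x => echar π (x * y))
      (fun x => echarAdd ht h x) fun _ => rfl]
    exact AddChar.sum_eq_zero_of_ne_one (echarAdd_ne_one ht h)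
  rw [← Finset.add_sum_erase _ _ (Finset.mem_univ (0 : ZMod p)), zero_mul, echar_zero] at h1
  linear_combination h1

lemma echar_mem (ht : IsResHom π t) (h : PrimaryPrime p π) (x : ZMod p) : echar π x ∈ V := by
  have : echar π x ^ p = 1 := by
    rw [← echarAdd_apply ht h, ← AddChar.map_nsmul_eq_pow]
    simp
  exact IsPlace.mem_of_pow (Fact.out : p.Prime).ne_zero (by rw [this]; exact V.one_mem)

/-- The even part of `Phi`. -/
def evenPhi (π : ℂ) {p : ℕ} (x : ZMod p) : ℂ := Phi π x + Phi π (-x)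

lemma fourier_evenPhi (ht : IsResHom π t) (h : PrimaryPrime p π) (y : ZMod p) :
    ∑ x ∈ Finset.univ.erase (0 : ZMod p), evenPhi π x * echar π (x * y) =
      -ρ3 ^ 2 * π * (starRingEnd ℂ) (evenPhi π y) := by
  have h1 : ∑ x : ZMod p, evenPhi π x * echar π (x * y) =
      -ρ3 ^ 2 * π * (starRingEnd ℂ) (evenPhi π y) := by
    simp only [evenPhi, add_mul, Finset.sum_add_distrib, map_add, mul_add]
    rw [fourier_Phi ht h, ← fourier_Phi ht h (-y)]
    congr 1
    exact Fintype.sum_bijective (-·) (Equiv.neg (ZMod p)).bijective _ _ fun x => by simp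
  rw [← h1, ← Finset.add_sum_erase _ _ (Finset.mem_univ (0 : ZMod p))]
  simp [evenPhi, Phi_zero]

/-- The reduction data of the division values at a place above `3`. -/
structure Reduction (V : ValuationSubring ℂ) (π : ℂ) {p : ℕ} (ℓ r : ZMod p) (x0 : ℂ)
    (τ τ' : ZMod p → IsLocalRing.ResidueField V) : Prop where
  cube : 4 * x0 ^ 3 = -1
  real : (starRingEnd ℂ) x0 = x0
  expan : ∀ x, x ≠ 0 → Expan V (Xp π x / x0) (-τ x)
  expan' : ∀ x, x ≠ 0 → Expan V ((starRingEnd ℂ) (Xp π x) / x0) (-τ' x)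
  isog : ∀ x, x ≠ 0 → τ (ℓ * x) = τ x ^ 3
  isog' : ∀ x, x ≠ 0 → τ' (ℓ * x) = τ' x ^ 3
  rot : ∀ x, x ≠ 0 → τ (r * x) = τ x + 1
  rot' : ∀ x, x ≠ 0 → τ' (r * x) = τ' x - 1

lemma exists_reduction (ht : IsResHom π t) (h : PrimaryPrime p π) (hV : IsPlace V) :
    ∃ x0 τ τ', Reduction V π (t sO) (t rO) x0 τ τ' := by
  obtain ⟨x0, h0, hr⟩ := exists_fixed
  obtain ⟨τ, h1, h2, h3, -⟩ := (divSystem_Xp ht h).exists_tau hV h0 (resHom_sO_ne h)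
    (cubeRoot_rO h).ne_zero (Expan.rho hV)
  obtain ⟨τ', h1', h2', h3', -⟩ := (divSystem_Xp ht h).conj.exists_tau hV h0 (resHom_sO_ne h)
    (cubeRoot_rO h).ne_zero (ε := -1) (by
      rw [conj_rho3]
      have := (Expan.rho hV).pow hV 2
      have e : ((2 : ℕ) : IsLocalRing.ResidueField V) * -1 = - -1 := by
        push_cast; linear_combination -hV.char_three
      rwa [e] at this)
  exact ⟨x0, τ, τ', h0, hr, h1, h1', h2, h2', h3, fun x hx => by rw [h3' x hx]; ring⟩

namespace Reduction

variable {x0 : ℂ} {τ τ' : ZMod p → IsLocalRing.ResidueField V}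

lemma ne_zero {ℓ r : ZMod p} (hR : Reduction V π ℓ r x0 τ τ') : x0 ≠ 0 := by
  rintro rfl
  have := hR.cube
  norm_num at this

lemma expan_evenPhi (ht : IsResHom π t) (h : PrimaryPrime p π) (hV : IsPlace V)
    (hR : Reduction V π (t sO) (t rO) x0 τ τ') {x : ZMod p} (hx : x ≠ 0) :
    Expan V (x0 ^ 2 * evenPhi π x) (τ x + τ x ^ 3) ∧
    Expan V (x0 ^ 2 * (starRingEnd ℂ) (evenPhi π x)) (τ' x + τ' x ^ 3) := by
  have hs : t sO * x ≠ 0 := mul_ne_zero (resHom_sO_ne h) hx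
  have hr := (Phi_relations ht h hx).2
  have hr' := congrArg (starRingEnd ℂ) hr
  rw [map_mul, map_mul, map_one] at hr'
  have h0 := hR.ne_zero
  have key : ∀ {a b c : ℂ}, a * (b * c) = 1 → x0 ^ 2 * a = ((b / x0) * (c / x0))⁻¹ := by
    intro a b c e
    have hb : b ≠ 0 := by rintro rfl; simp at e
    have hc : c ≠ 0 := by rintro rfl; simp at e
    field_simp
    linear_combination e
  constructor
  · have := ((hR.expan x hx).mul hV (hR.expan _ hs)).inv hV
    rw [hR.isog x hx] at this
    rw [evenPhi, key hr]
    convert this using 1; ring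
  · have := ((hR.expan' x hx).mul hV (hR.expan' _ hs)).inv hV
    rw [hR.isog' x hx] at this
    rw [evenPhi, key hr']
    convert this using 1; ring

end Reduction

/-- Weighted character sums of elements close to `1`. -/
lemma expan_sum_echar (ht : IsResHom π t) (h : PrimaryPrime p π)
    {E : ZMod p → IsLocalRing.ResidueField V} (hE : ∀ x, Red V (echar π x) (E x))
    {a : ZMod p → ℂ} {α : ZMod p → IsLocalRing.ResidueField V}
    (ha : ∀ x, x ≠ 0 → Expan V (a x) (α x)) {y : ZMod p} (hy : y ≠ 0) :
    Expan V (-∑ x ∈ Finset.univ.erase (0 : ZMod p), a x * echar π (x * y))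
      (-∑ x ∈ Finset.univ.erase (0 : ZMod p), α x * E (x * y)) := by
  choose! b hb hb' using ha
  refine ⟨-∑ x ∈ Finset.univ.erase (0 : ZMod p), b x * echar π (x * y), ?_, ?_⟩
  · have : ∑ x ∈ Finset.univ.erase (0 : ZMod p), a x * echar π (x * y) =
        ∑ x ∈ Finset.univ.erase (0 : ZMod p), (echar π (x * y) + sqrtm3 * (b x * echar π (x * y))) :=
      Finset.sum_congr rfl fun x hx => by rw [hb x (Finset.ne_of_mem_erase hx)]; ring
    rw [this, Finset.sum_add_distrib, sum_echar ht h hy, ← Finset.mul_sum]; ring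
  · exact (Red.sum fun x hx => (hb' x (Finset.ne_of_mem_erase hx)).mul (hE _)).neg

lemma Reduction.functional_equation (ht : IsResHom π t) (h : PrimaryPrime p π) (hV : IsPlace V)
    {E : ZMod p → IsLocalRing.ResidueField V} (hE : ∀ x, Red V (echar π x) (E x))
    {x0 : ℂ} {τ τ' : ZMod p → IsLocalRing.ResidueField V}
    (hR : Reduction V π (t sO) (t rO) x0 τ τ') {y : ZMod p} (hy : y ≠ 0) :
    ∑ x ∈ Finset.univ.erase (0 : ZMod p), (τ x + τ x ^ 3) * E (x * y) =
      -1 - (τ' y + τ' y ^ 3) := by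
  have h1 := expan_sum_echar ht h hE (fun x hx => (hR.expan_evenPhi ht h hV hx).1) hy
  have h2 := fourier_evenPhi ht h y
  have h3 : -∑ x ∈ Finset.univ.erase (0 : ZMod p), x0 ^ 2 * evenPhi π x * echar π (x * y) =
      ρ3 ^ 2 * π * (x0 ^ 2 * (starRingEnd ℂ) (evenPhi π y)) := by
    simp only [mul_assoc, ← Finset.mul_sum]
    rw [h2]; ring
  rw [h3] at h1
  obtain ⟨d, hd, e⟩ := h.primary
  have h4 : Expan V π 0 := by
    rw [show π = 1 + 3 * d by linear_combination e]
    exact Expan.of_primary hV (hV.mem hd)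
  have h5 := h1.unique ((((Expan.rho hV).pow hV 2).mul hV h4).mul hV
    (hR.expan_evenPhi ht h hV hy).2)
  push_cast at h5
  linear_combination -h5 + hV.char_three

end reduced

/-! ### The reduction of the cubic Gauss sum -/

section gauss

variable {p : ℕ} {π : ℂ} [Fact p.Prime] {t : O3 →+* ZMod p} {V : ValuationSubring ℂ}
  {S : Finset (ZMod p)} {ψ : MulChar (ZMod p) ℂ}

/-- The multiplicative character with `ψ x = ρ ^ n` whenever `x ^ m = r ^ n`. -/
def IsCubicMul (m : ℕ) (r : ZMod p) (ψ : MulChar (ZMod p) ℂ) : Prop :=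
  ∀ x : ZMod p, x ≠ 0 → ∀ n : ℕ, x ^ m = r ^ n → ψ x = ρ3 ^ n

lemma Expan.rho_pow (hV : IsPlace V) (n : ℕ) : Expan V (ρ3 ^ n) (-n) := by
  simpa using (Expan.rho hV).pow hV n

lemma sum_inv_transfer (h : CubeRoot (t rO)) (hS : ThirdSet (t rO) S)
    {κ : Type} [AddCommGroup κ] {F : ZMod p → κ} {c : κ}
    (hF : ∀ x, x ≠ 0 → F (t rO * x) = F x + c) {z : ZMod p} {n : ℕ} (hz : z ≠ 0)
    (hn : z ^ S.card = (t rO) ^ n) (hc : 3 • c = 0) :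
    ∑ s ∈ S, F (z * s⁻¹) = n • c + ∑ s ∈ S, F s⁻¹ := by
  obtain ⟨n', h1, h2⟩ := ThirdSet.gauss_lemma h (hS.inv h) hz
  have hcard : (S.image (·⁻¹)).card = S.card := Finset.card_image_of_injective _ inv_injective
  rw [hcard, hn] at h1
  have h3 := additive_transfer h2 hF
  rw [Finset.sum_image fun _ _ _ _ e => inv_injective e,
    Finset.sum_image fun _ _ _ _ e => inv_injective e] at h3
  have h4 : n' • c = n • c := by
    have h5 := h.mod_eq_of_pow_eq h1
    have h6 : ∀ k : ℕ, k • c = (k % 3) • c := fun k => by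
      conv_lhs => rw [← Nat.div_add_mod k 3, add_nsmul, mul_comm, mul_nsmul, nsmul_left_comm, hc,
        nsmul_zero, zero_add]
    rw [h6 n, h6 n', h5]
  rw [h3, h4]

theorem Reduction.expan_gaussSum (ht : IsResHom π t) (h : PrimaryPrime p π) (hV : IsPlace V)
    {x0 : ℂ} {τ τ' : ZMod p → IsLocalRing.ResidueField V}
    (hR : Reduction V π (t sO) (t rO) x0 τ τ') (hS : ThirdSet (t rO) S)
    (hψ : IsCubicMul S.card (t rO) ψ) :
    Expan V (-gaussSum ψ (echarAdd ht h))
      (S.card + ∑ s ∈ S, (τ' s + τ' s ^ 3) - ∑ s ∈ S, (τ s⁻¹ + τ s⁻¹ ^ 3)) := by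
  have hc := cubeRoot_rO (t := t) h
  choose E hE using fun x : ZMod p => Red.exists_of_mem (echar_mem (V := V) ht h x)
  have hk : ∀ x : ZMod p, x ≠ 0 → ∃ n : ℕ, x ^ S.card = (t rO) ^ n := fun x hx => by
    obtain ⟨n, hn, -⟩ := ThirdSet.gauss_lemma hc hS hx
    exact ⟨n, hn⟩
  choose! k hk using hk
  have h1 := expan_sum_echar (y := 1) ht h hE (a := ψ) (α := fun x => -(k x : _)) (fun x hx => by
    rw [hψ x hx _ (hk x hx)]; exact Expan.rho_pow hV _) one_ne_zero
  have h2 : ∑ x ∈ Finset.univ.erase (0 : ZMod p), ψ x * echar π (x * 1) =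
      gaussSum ψ (echarAdd ht h) := by
    rw [gaussSum, ← Finset.add_sum_erase _ _ (Finset.mem_univ (0 : ZMod p)),
      MulChar.map_zero, zero_mul, zero_add]
    simp [echarAdd_apply]
  rw [h2] at h1
  convert h1 using 1
  set F : ZMod p → IsLocalRing.ResidueField V := fun x => τ x + τ x ^ 3 with hF
  have hFr : ∀ x, x ≠ 0 → F (t rO * x) = F x + -1 := fun x hx => by
    rw [hF]
    simp only [hR.rot x hx]
    linear_combination (τ x ^ 2 + τ x + 1) * hV.char_three
  have hE1 : ∑ x ∈ Finset.univ.erase (0 : ZMod p), E x = -1 := by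
    have := (Red.sum (V := V) fun x (_ : x ∈ Finset.univ.erase (0 : ZMod p)) => hE (x * 1))
    rw [sum_echar ht h one_ne_zero] at this
    simpa using this.unique Red.one.neg
  have key : ∑ s ∈ S, ∑ x ∈ Finset.univ.erase (0 : ZMod p), F x * E (x * s) =
      ∑ s ∈ S, (-1 - (τ' s + τ' s ^ 3)) :=
    Finset.sum_congr rfl fun s hs => hR.functional_equation ht h hV hE (hS.ne_zero s hs)
  have hsub : ∀ s ∈ S, ∑ x ∈ Finset.univ.erase (0 : ZMod p), F x * E (x * s) =
      ∑ x ∈ Finset.univ.erase (0 : ZMod p), F (x * s⁻¹) * E x := fun s hs => by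
    have hs0 := hS.ne_zero s hs
    refine Finset.sum_nbij' (· * s) (· * s⁻¹) ?_ ?_ ?_ ?_ ?_
    · intro x hx; simpa [hs0] using hx
    · intro x hx; simpa [hs0] using hx
    · intro x _; field_simp
    · intro x _; field_simp
    · intro x _
      simp only [mul_assoc, mul_inv_cancel₀ hs0, mul_one]
  rw [Finset.sum_congr rfl hsub, Finset.sum_comm, Finset.sum_sub_distrib] at key
  have h3 : ∀ x ∈ Finset.univ.erase (0 : ZMod p), ∑ s ∈ S, F (x * s⁻¹) * E x =
      (∑ s ∈ S, F s⁻¹) * E x - k x * E x := fun x hx => by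
    rw [← Finset.sum_mul, sum_inv_transfer hc hS hFr (Finset.ne_of_mem_erase hx)
      (hk x (Finset.ne_of_mem_erase hx)) (by
        rw [smul_neg, nsmul_one]; push_cast; linear_combination -hV.char_three)]
    rw [nsmul_eq_mul]; ring
  rw [Finset.sum_congr rfl h3, Finset.sum_sub_distrib, ← Finset.mul_sum, hE1] at key
  simp only [Finset.sum_const, nsmul_eq_mul, mul_one, neg_mul, Finset.sum_neg_distrib, neg_neg]
    at key ⊢
  linear_combination key

theorem Reduction.expan_gaussSum' (ht : IsResHom π t) (h : PrimaryPrime p π) (hV : IsPlace V)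
    {x0 : ℂ} {τ τ' : ZMod p → IsLocalRing.ResidueField V}
    (hR : Reduction V π (t sO) (t rO) x0 τ τ') (hS : ThirdSet (t rO) S)
    (hψ : IsCubicMul S.card (t rO) ψ) {k c : ℕ} (hk : t sO ^ S.card = t rO ^ k)
    (hc : -∏ s ∈ S, s = t rO ^ c) :
    Expan V (-gaussSum ψ (echarAdd ht h)) (S.card + ∑ s ∈ S, τ s - ∑ s ∈ S, τ' s + k + c) ∧
    ∑ s ∈ S, τ s ^ 3 = ∑ s ∈ S, τ s + k ∧ ∑ s ∈ S, τ' s ^ 3 = ∑ s ∈ S, τ' s - k := by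
  have hr := cubeRoot_rO (t := t) h
  have h3 := hV.char_three
  have hmod : ∀ {a b : ℕ}, a % 3 = b % 3 → (a : IsLocalRing.ResidueField V) = b := by
    intro a b e
    rw [← Nat.div_add_mod a 3, ← Nat.div_add_mod b 3, e]
    push_cast
    rw [h3]; ring
  obtain ⟨k', hk1, hk2⟩ := ThirdSet.gauss_lemma hr hS (resHom_sO_ne (t := t) h)
  obtain ⟨n, hn1, hn2⟩ := ThirdSet.inv_transfer hr hS
  have e1 : (k' : IsLocalRing.ResidueField V) = k := hmod (hr.mod_eq_of_pow_eq (by rw [← hk1, hk]))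
  have e2 : (n : IsLocalRing.ResidueField V) = c := by
    have : t rO ^ (n + 2 * c) = t rO ^ 0 := by
      rw [pow_add, mul_comm 2 c, pow_mul, ← hc, neg_sq, hn1, pow_zero]
    have := hmod (hr.mod_eq_of_pow_eq this)
    push_cast at this
    linear_combination this - c * h3
  have hτ : ∑ s ∈ S, τ s ^ 3 = ∑ s ∈ S, τ s + k := by
    rw [← Finset.sum_congr rfl fun s hs => hR.isog s (hS.ne_zero s hs),
      additive_transfer hk2 hR.rot, nsmul_eq_mul, e1]; ring
  have hτ' : ∑ s ∈ S, τ' s ^ 3 = ∑ s ∈ S, τ' s - k := by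
    rw [← Finset.sum_congr rfl fun s hs => hR.isog' s (hS.ne_zero s hs),
      additive_transfer hk2 (fun x hx => (hR.rot' x hx).trans (sub_eq_add_neg _ _)),
      nsmul_eq_mul, e1]; ring
  refine ⟨?_, hτ, hτ'⟩
  convert hR.expan_gaussSum ht h hV hS hψ using 1
  have hF : ∀ x, x ≠ 0 → τ (t rO * x) + τ (t rO * x) ^ 3 = τ x + τ x ^ 3 + -1 := fun x hx => by
    simp only [hR.rot x hx]
    linear_combination (τ x ^ 2 + τ x + 1) * h3
  rw [additive_transfer hn2 (F := fun x => τ x + τ x ^ 3) hF, nsmul_eq_mul, e2,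
    Finset.sum_add_distrib, Finset.sum_add_distrib, hτ, hτ']
  linear_combination (∑ s ∈ S, τ s - ∑ s ∈ S, τ' s + k) * h3

end gauss

/-! ### The cubic Jacobi sum -/

section jacobi

variable {p : ℕ} {π : ℂ} [Fact p.Prime] {t : O3 →+* ZMod p} {m : ℕ} {ψ : MulChar (ZMod p) ℂ}

lemma exists_pow_eq {r x : ZMod p} (h : CubeRoot r) (hm : p = 3 * m + 1) (hx : x ≠ 0) :
    ∃ n : ℕ, x ^ m = r ^ n := by
  have h1 : (x ^ m) ^ 3 = 1 := by
    rw [← pow_mul, show m * 3 = p - 1 by omega]; exact ZMod.pow_card_sub_one_eq_one hx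
  have h2 : (x ^ m - 1) * (x ^ m - r) * (x ^ m - r ^ 2) = 0 := by
    linear_combination h1 + (x ^ m - (x ^ m) ^ 2) * h.quad + (x ^ m - 1) * h.cube
  rcases mul_eq_zero.1 h2 with h3 | h3
  · rcases mul_eq_zero.1 h3 with h3 | h3
    · exact ⟨0, by rw [pow_zero]; exact sub_eq_zero.1 h3⟩
    · exact ⟨1, by rw [pow_one]; exact sub_eq_zero.1 h3⟩
  · exact ⟨2, sub_eq_zero.1 h3⟩

lemma IsCubicMul.cube {r : ZMod p} (hψ : IsCubicMul m r ψ) (h : CubeRoot r) (hm : p = 3 * m + 1) :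
    ψ ^ 3 = 1 := by
  ext x
  obtain ⟨n, hn⟩ := exists_pow_eq h hm x.ne_zero
  rw [MulChar.pow_apply_coe, hψ _ x.ne_zero n hn, MulChar.one_apply_coe, ← pow_mul, mul_comm,
    pow_mul, rho3_cube, one_pow]

lemma rho3_pow_eq_one {n : ℕ} (h : ρ3 ^ n = 1) : n % 3 = 0 := by
  rw [← Nat.div_add_mod n 3, pow_add, pow_mul, rho3_cube, one_pow, one_mul] at h
  have := Nat.mod_lt n (by norm_num : 0 < 3)
  interval_cases hn : n % 3
  · rfl
  · exact absurd (by simpa using h) rho3_ne_one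
  · exfalso
    apply rho3_ne_one
    calc ρ3 = ρ3 * ρ3 ^ 2 := by rw [h, mul_one]
      _ = ρ3 ^ 3 := by ring
      _ = 1 := rho3_cube

lemma IsCubicMul.ne_one {r : ZMod p} (hψ : IsCubicMul m r ψ) (h : CubeRoot r)
    (hm : p = 3 * m + 1) : ψ ≠ 1 := by
  intro h1
  have hp := (Fact.out : p.Prime).one_lt
  have h2 : ∀ x : ZMod p, x ≠ 0 → x ^ m = 1 := fun x hx => by
    obtain ⟨n, hn⟩ := exists_pow_eq h hm hx
    have h3 := hψ x hx n hn
    rw [h1, MulChar.one_apply (IsUnit.mk0 x hx)] at h3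
    rw [hn, h.pow_mod, rho3_pow_eq_one h3.symm, pow_zero]
  have h4 := FiniteField.sum_pow_lt_card_sub_one (ZMod p) m (by rw [ZMod.card]; omega)
  rw [← Finset.add_sum_erase _ _ (Finset.mem_univ (0 : ZMod p)),
    Finset.sum_congr rfl fun x hx => h2 x (Finset.ne_of_mem_erase hx), Finset.sum_const,
    Finset.card_erase_of_mem (Finset.mem_univ _), Finset.card_univ, ZMod.card,
    zero_pow (by omega), zero_add, nsmul_one, Nat.cast_sub hp.le] at h4
  simp at h4

lemma IsCubicMul.mul_ne_one {r : ZMod p} (hψ : IsCubicMul m r ψ) (h : CubeRoot r)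
    (hm : p = 3 * m + 1) : ψ * ψ ≠ 1 := fun h1 => hψ.ne_one h hm (by
  have := hψ.cube h hm
  rwa [pow_succ, sq, h1, one_mul] at this)

lemma sum_pow_mul_pow (hm : p = 3 * m + 1) : ∑ x : ZMod p, x ^ m * (1 - x) ^ m = 0 := by
  have hp := (Fact.out : p.Prime).one_lt
  have h1 : ∀ x : ZMod p, x ^ m * (1 - x) ^ m =
      ∑ j ∈ Finset.range (m + 1), (-1) ^ j * (m.choose j) * x ^ (m + j) := fun x => by
    rw [sub_eq_add_neg, add_comm (1 : ZMod p), add_pow, Finset.mul_sum]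
    refine Finset.sum_congr rfl fun j _ => ?_
    rw [one_pow, neg_pow, pow_add]; ring
  simp only [h1]
  rw [Finset.sum_comm]
  refine Finset.sum_eq_zero fun j hj => ?_
  rw [← Finset.mul_sum, FiniteField.sum_pow_lt_card_sub_one, mul_zero]
  rw [ZMod.card]
  have := Finset.mem_range.1 hj
  omega

lemma jacobi_dvd (ht : IsResHom π t) (h : PrimaryPrime p π) (hm : p = 3 * m + 1)
    (hψ : IsCubicMul m (t rO) ψ) : ∃ u ∈ O3, jacobiSum ψ ψ = π * u := by
  classical
  have hr := cubeRoot_rO (t := t) h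
  have hp := (Fact.out : p.Prime).one_lt
  choose! n hn using fun (x : ZMod p) (hx : x ≠ 0) => exists_pow_eq hr hm hx
  set f : ZMod p → O3 := fun x => if x = 0 then 0 else rO ^ n x with hf
  have h1 : ∀ x, (f x : ℂ) = ψ x := fun x => by
    by_cases hx : x = 0
    · simp [hf, hx, MulChar.map_zero]
    · rw [hψ x hx _ (hn x hx)]; simp [hf, hx, rO]
  have h2 : ∀ x, t (f x) = x ^ m := fun x => by
    by_cases hx : x = 0
    · rw [hx, zero_pow (by omega)]; simp [hf]
    · simp [hf, hx, hn x hx]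
  have h3 : t (∑ x : ZMod p, f x * f (1 - x)) = 0 := by
    rw [map_sum, ← sum_pow_mul_pow hm]
    exact Finset.sum_congr rfl fun x _ => by rw [map_mul, h2, h2]
  obtain ⟨u, hu, e⟩ := (ht _).1 h3
  refine ⟨u, hu, ?_⟩
  rw [← e, jacobiSum]
  push_cast
  exact Finset.sum_congr rfl fun x _ => by rw [h1, h1]

lemma isPrimitiveRoot_rho3 : IsPrimitiveRoot ρ3 3 :=
  IsPrimitiveRoot.mk_of_lt _ (by norm_num) rho3_cube fun l h0 h3 h1 => by
    have := rho3_pow_eq_one h1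
    omega

lemma mem_O3_of_adjoin {z : ℂ} (hz : z ∈ Algebra.adjoin ℤ {ρ3}) : z ∈ O3 := by
  refine Algebra.adjoin_induction (p := fun z _ => z ∈ O3) ?_ ?_ ?_ ?_ hz
  · rintro x rfl; exact rho3_mem
  · intro n; simp
  · intro _ _ _ _ h1 h2; exact O3.add_mem h1 h2
  · intro _ _ _ _ h1 h2; exact O3.mul_mem h1 h2

lemma unit_eq_neg_one {u : ℂ} (hn : u * (starRingEnd ℂ) u = 1) {v : ℂ}
    (hv : v ∈ O3) (e : u = -1 + 3 * v) : u = -1 := by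
  obtain ⟨a, b, rfl⟩ := mem_O3.1 hv
  have h1 : (((-1 + 3 * a) ^ 2 - (-1 + 3 * a) * (3 * b) + (3 * b) ^ 2 : ℤ) : ℂ) = (1 : ℤ) := by
    rw [e] at hn
    simp only [map_add, map_mul, map_neg, map_one, map_intCast, conj_rho3, Complex.conj_ofNat] at hn
    push_cast
    linear_combination hn - 3 * b * (-1 + 3 * a) * rho3_sq - 9 * b ^ 2 * rho3_cube
  have h2 := Int.cast_injective h1
  have hb : b = 0 := by
    have h3 : 27 * b ^ 2 ≤ 4 := by nlinarith [sq_nonneg (2 * (-1 + 3 * a) - 3 * b)]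
    nlinarith [sq_nonneg b, sq_abs b, abs_nonneg b, Int.one_le_abs (z := b)]
  subst hb
  have ha : a = 0 := by
    have h3 : a * (9 * a - 6) = 0 := by linarith
    rcases mul_eq_zero.1 h3 with h4 | h4 <;> omega
  subst ha
  rw [e]; push_cast; ring

theorem jacobiSum_eq (ht : IsResHom π t) (h : PrimaryPrime p π) (hm : p = 3 * m + 1)
    (hψ : IsCubicMul m (t rO) ψ) : jacobiSum ψ ψ = -π := by
  have hr := cubeRoot_rO (t := t) h
  have h1 := hψ.ne_one hr hm
  have h2 := hψ.mul_ne_one hr hm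
  have h3 := hψ.cube hr hm
  have hp := (Fact.out : p.Prime)
  obtain ⟨u, hu, e⟩ := jacobi_dvd ht h hm hψ
  obtain ⟨z, hz, e'⟩ := exists_jacobiSum_eq_neg_one_add (n := 3) (by norm_num) h3 h3
    (by rw [ZMod.card]; exact ⟨m, by omega⟩) isPrimitiveRoot_rho3
  have hz' := mem_O3_of_adjoin hz
  obtain ⟨d, hd, ed⟩ := h.primary
  have hconj : (starRingEnd ℂ) (jacobiSum ψ ψ) = jacobiSum ψ⁻¹ ψ⁻¹ := by
    rw [jacobiSum, jacobiSum, map_sum]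
    refine Finset.sum_congr rfl fun x _ => ?_
    rw [map_mul, ← MulChar.star_eq_inv, MulChar.star_apply, MulChar.star_apply]; rfl
  have hnorm := jacobiSum_mul_jacobiSum_inv (F := ZMod p) (F' := ℂ) (by
    rw [ZMod.ringChar_zmod_n, ringChar.eq_zero]; exact hp.ne_zero.symm)
    h1 h1 h2
  rw [← hconj, e, ZMod.card, map_mul] at hnorm
  have hun : u * (starRingEnd ℂ) u = 1 := by
    have hp0 : (p : ℂ) ≠ 0 := Nat.cast_ne_zero.2 hp.ne_zero
    apply mul_left_cancel₀ hp0
    rw [mul_one]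
    linear_combination hnorm - u * (starRingEnd ℂ) u * h.norm
  have hu1 := unit_eq_neg_one hun (v := -ρ3 * z - d * u)
    (O3.sub_mem (O3.mul_mem (O3.neg_mem rho3_mem) hz') (O3.mul_mem hd hu)) (by
      rw [e, ed] at e'
      linear_combination e' + z * rho3_sq)
  rw [e, hu1]; ring

theorem gaussSum_cube (ht : IsResHom π t) (h : PrimaryPrime p π) (hm : p = 3 * m + 1)
    (hψ : IsCubicMul m (t rO) ψ) : gaussSum ψ (echarAdd ht h) ^ 3 = -p * π := by
  have hr := cubeRoot_rO (t := t) h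
  have h1 := hψ.ne_one hr hm
  have h2 := hψ.mul_ne_one hr hm
  have h3 := hψ.cube hr hm
  have hprim : (echarAdd ht h).IsPrimitive :=
    AddChar.IsPrimitive.of_ne_one (echarAdd_ne_one ht h)
  have hord : orderOf ψ = 3 := orderOf_eq_prime h3 h1
  have h4 := gaussSum_mul_gaussSum_pow_orderOf_sub_one h1 hprim
  have h5 := jacobiSum_mul_nontrivial h2 (echarAdd ht h)
  have h6 : ψ (-1) = 1 := by
    have h7 : ψ (-1) ^ 2 = 1 := by rw [← map_pow]; simp
    have h8 : ψ (-1) ^ 3 = 1 := by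
      rw [← MulChar.pow_apply' _ (by norm_num), h3, MulChar.one_apply isUnit_one.neg]
    linear_combination h8 - ψ (-1) * h7
  rw [hord, show 3 - 1 = 2 from rfl, sq, h6, ZMod.card, one_mul] at h4
  rw [jacobiSum_eq ht h hm hψ] at h5
  linear_combination -gaussSum ψ (echarAdd ht h) * h5 - π * h4

end jacobi

/-! ### The cubic Gauss sum in terms of the canonical cube root -/

section canonical

variable {p : ℕ} {π : ℂ} [Fact p.Prime] {t : O3 →+* ZMod p} {S : Finset (ZMod p)}
  {ψ : MulChar (ZMod p) ℂ}

lemma prod_Phi_third_cube (ht : IsResHom π t) (h : PrimaryPrime p π) (hS : ThirdSet (t rO) S) :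
    (∏ s ∈ S, Phi π s) ^ 3 = π := by
  refine Eq.trans ?_ (prod_Phi ht h)
  rw [hS.prod_univ (cubeRoot_rO h), ← Finset.prod_pow]
  refine Finset.prod_congr rfl fun s _ => ?_
  rw [pow_two (t rO), mul_assoc (t rO), Phi_rho ht h (t rO * s), Phi_rho ht h]
  linear_combination -(Phi π s) ^ 3 * rho3_cube

lemma even_card (h : PrimaryPrime p π) (hm : p = 3 * S.card + 1) : Even S.card := by
  have h2 : p ≠ 2 := fun e => by have := h.mod_three; rw [e] at this; norm_num at this
  have h3 := h.prime.odd_of_ne_two h2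
  rw [hm] at h3
  by_contra h4
  rw [Nat.not_even_iff_odd] at h4
  have : Even (3 * S.card + 1) := (Odd.mul (by decide) h4).add_one
  exact (Nat.not_even_iff_odd.2 h3) this

lemma prod_Phi_neg (ht : IsResHom π t) (h : PrimaryPrime p π) (hS : ThirdSet (t rO) S) :
    ∏ s ∈ S, Phi π (-s) = ∏ s ∈ S, Phi π s := by
  have hr := cubeRoot_rO (t := t) h
  obtain ⟨n, h1, h2⟩ := ThirdSet.gauss_lemma hr hS (neg_ne_zero.2 one_ne_zero)
  rw [(even_card h (hS.card hr)).neg_one_pow] at h1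
  have h3 := h2 ℂ (Phi π) ρ3 fun x _ => Phi_rho ht h x
  have h4 : n % 3 = 0 := (hr.mod_eq_of_pow_eq (m := n) (n := 0) (by rw [← h1, pow_zero]))
  rw [← Nat.div_add_mod n 3, h4, add_zero, pow_mul, rho3_cube, one_pow, one_mul] at h3
  simpa using h3

lemma Expan.const_pow {V : ValuationSubring ℂ} (hV : IsPlace V) {x0 : ℂ} (h : 4 * x0 ^ 3 = -1)
    (n : ℕ) : Expan V (((-x0) ^ n) ^ 3) 0 := by
  have h1 : Expan V (4 : ℂ) 0 := by
    have := Expan.of_primary hV V.one_mem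
    norm_num at this; exact this
  have h2 : (-x0) ^ 3 = (4 : ℂ)⁻¹ := by field_simp; linear_combination -h
  rw [← pow_mul, mul_comm, pow_mul, h2]
  simpa using (h1.inv hV).pow hV n

/-- The cubic Gauss sum, evaluated by means of a third set. -/
theorem gaussSum_eq (ht : IsResHom π t) (h : PrimaryPrime p π) (hS : ThirdSet (t rO) S)
    (hψ : IsCubicMul S.card (t rO) ψ) {c : ℕ} (hc : -∏ s ∈ S, s = t rO ^ c) {P : ℂ}
    (hP : P = (ρ3 ^ c)⁻¹ * ∏ s ∈ S, Phi π s) :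
    P ^ 3 = π ∧ gaussSum ψ (echarAdd ht h) =
      -ρ3 ^ (2 * S.card) * ψ (t sO) * P ^ 2 * (starRingEnd ℂ) P := by
  have hr := cubeRoot_rO (t := t) h
  have hm := hS.card hr
  have hρ := rho3_ne_zero
  have hP3 : P ^ 3 = π := by
    rw [hP, mul_pow, prod_Phi_third_cube ht h hS, inv_pow, ← pow_mul, mul_comm c, pow_mul,
      rho3_cube, one_pow, inv_one, one_mul]
  refine ⟨hP3, ?_⟩
  obtain ⟨V, hV⟩ := exists_place
  obtain ⟨x0, τ, τ', hR⟩ := exists_reduction ht h hV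
  obtain ⟨k, hk⟩ := exists_pow_eq hr hm (resHom_sO_ne (t := t) h)
  obtain ⟨hg, hτ, hτ'⟩ := hR.expan_gaussSum' ht h hV hS hψ hk hc
  rw [hψ _ (resHom_sO_ne h) k hk]
  set g := gaussSum ψ (echarAdd ht h) with hgd
  have hx0 := hR.ne_zero
  set y := (-x0) ^ S.card with hy
  have hy0 : y ≠ 0 := pow_ne_zero _ (neg_ne_zero.2 hx0)
  have hX : ∀ s ∈ S, Xp π (t sO * s) ≠ 0 := fun s hs h0 => by
    have := (Phi_relations ht h (hS.ne_zero s hs)).1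
    rw [h0, mul_zero] at this
    exact absurd this (by norm_num)
  have hA0 : ρ3 ^ (2 * c) * P ^ 2 * y = ∏ s ∈ S, (Xp π (t sO * s) / x0)⁻¹ := by
    have e1 : ρ3 ^ (2 * c) * P ^ 2 = (∏ s ∈ S, Phi π s) * ∏ s ∈ S, Phi π (-s) := by
      rw [prod_Phi_neg ht h hS, hP, mul_comm 2 c, pow_mul]; field_simp
    rw [e1, hy, ← Finset.prod_const, ← Finset.prod_mul_distrib, ← Finset.prod_mul_distrib]
    refine Finset.prod_congr rfl fun s hs => ?_
    have := (Phi_relations ht h (hS.ne_zero s hs)).1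
    have h0 := hX s hs
    rw [inv_div, eq_div_iff h0]
    linear_combination -x0 * this
  have hB0 : ρ3 ^ c * (starRingEnd ℂ) P ^ 2 * y =
      ∏ s ∈ S, ((starRingEnd ℂ) (Xp π (t sO * s)) / x0)⁻¹ := by
    have e1 := congrArg (starRingEnd ℂ) hA0
    rw [map_prod, map_mul, map_mul, map_pow, map_pow, conj_rho3, hy, map_pow, map_neg, hR.real,
      ← hy] at e1
    have e2 : (ρ3 ^ 2) ^ (2 * c) = ρ3 ^ c := by
      rw [← pow_mul, show 2 * (2 * c) = 3 * c + c by ring, pow_add, pow_mul, rho3_cube, one_pow,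
        one_mul]
    rw [e2] at e1
    rw [e1]
    exact Finset.prod_congr rfl fun s _ => by rw [map_inv₀, map_div₀, hR.real]
  have hA : Expan V (ρ3 ^ (2 * c) * P ^ 2 * y) (∑ s ∈ S, τ s + k) := by
    rw [hA0, ← hτ]
    exact Expan.prod hV fun s hs => by
      have := (hR.expan _ (mul_ne_zero (resHom_sO_ne (t := t) h) (hS.ne_zero s hs))).inv hV
      rwa [neg_neg, hR.isog s (hS.ne_zero s hs)] at this
  have hB : Expan V (ρ3 ^ c * (starRingEnd ℂ) P ^ 2 * y) (∑ s ∈ S, τ' s - k) := by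
    rw [hB0, ← hτ']
    exact Expan.prod hV fun s hs => by
      have := (hR.expan' _ (mul_ne_zero (resHom_sO_ne (t := t) h) (hS.ne_zero s hs))).inv hV
      rwa [neg_neg, hR.isog' s (hS.ne_zero s hs)] at this
  have hP0 : P ≠ 0 := by rintro rfl; exact h.ne_zero (by rw [← hP3]; ring)
  have hPc : (starRingEnd ℂ) P ≠ 0 := by simpa using hP0
  set Q := (starRingEnd ℂ) P with hQ
  have hQ3 : Q ^ 3 = (starRingEnd ℂ) π := by rw [hQ, ← map_pow, hP3]
  have hg3 := gaussSum_cube ht h hm hψ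
  rw [← hgd, ← h.norm, ← hQ3, ← hP3] at hg3
  set w := ρ3 ^ (2 * S.card) * ρ3 ^ k with hw
  have hw0 : w ≠ 0 := mul_ne_zero (pow_ne_zero _ hρ) (pow_ne_zero _ hρ)
  have hw3 : w ^ 3 = 1 := by
    rw [hw, ← pow_add, ← pow_mul, mul_comm, pow_mul, rho3_cube, one_pow]
  set R := g / (P ^ 2 * Q) with hRd
  have hgR : g = R * (P ^ 2 * Q) := by rw [hRd]; field_simp
  have hR3 : R ^ 3 = -1 := by
    apply mul_right_cancel₀ (pow_ne_zero 3 (mul_ne_zero (pow_ne_zero 2 hP0) hPc))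
    rw [← mul_pow, ← hgR, hg3]; ring
  have hone : R ^ 2 / w ^ 2 = 1 := by
    apply Expan.eq_one_of_cube hV
    · rw [div_pow, ← pow_mul, mul_comm 2 3, pow_mul, hR3, ← pow_mul, mul_comm 2 3, pow_mul, hw3]
      norm_num
    · have e1 := ((hg.pow hV 2).div hV ((hA.pow hV 2).mul hV hB)).mul hV
        ((Expan.rho_pow hV (5 * c)).mul hV (Expan.const_pow hV hR.cube S.card))
      have e2 := e1.div hV (((Expan.rho_pow hV (2 * S.card)).mul hV (Expan.rho_pow hV k)).pow hV 2)
      have e3 : (-g) ^ 2 / ((ρ3 ^ (2 * c) * P ^ 2 * y) ^ 2 * (ρ3 ^ c * Q ^ 2 * y)) *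
          (ρ3 ^ (5 * c) * y ^ 3) / (ρ3 ^ (2 * S.card) * ρ3 ^ k) ^ 2 = R ^ 2 / w ^ 2 := by
        rw [← hw, hgR]
        have e4 : ρ3 ^ (5 * c) = (ρ3 ^ c) ^ 5 := by rw [← pow_mul, mul_comm]
        have e5 : ρ3 ^ (2 * c) = (ρ3 ^ c) ^ 2 := by rw [← pow_mul, mul_comm]
        rw [e4, e5]
        have hρc := pow_ne_zero c hρ
        field_simp
      rw [e3] at e2
      convert e2 using 1
      push_cast
      linear_combination (-2 * S.card - k + ∑ s ∈ S, τ' s + c) * hV.char_three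
  have hR2 : R ^ 2 = w ^ 2 := by field_simp at hone; exact hone
  have hRw : R = -w := by
    apply mul_right_cancel₀ (pow_ne_zero 2 hw0)
    linear_combination hR3 + hw3 - R * hR2
  rw [hgR, hRw, hw]; ring

end canonical

/-! ### Sums over complete residue systems -/

section crs

lemma ECong.symm {a b c : ℂ} (h : ECong a b c) : ECong b a c := by
  obtain ⟨d, hd, e⟩ := h
  exact ⟨-d, O3.neg_mem hd, by linear_combination -e⟩

lemma ECong.trans {a b c d : ℂ} (h : ECong a b d) (h' : ECong b c d) : ECong a c d := by
  obtain ⟨u, hu, e⟩ := h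
  obtain ⟨v, hv, e'⟩ := h'
  exact ⟨u + v, O3.add_mem hu hv, by linear_combination e + e'⟩

lemma eS3_div_congr {a b c : ℂ} (hc : c ≠ 0) (h : ECong a b c) : eS3 (a / c) = eS3 (b / c) := by
  obtain ⟨d, hd, e⟩ := h
  have : a / c = b / c + d := by field_simp; linear_combination e
  rw [this, eS3_add, eS3_of_mem hd, mul_one]

/-- An indexed complete residue system. -/
structure IsResidueSystem (β : ℂ) {ι : Type} (I : Finset ι) (g : ι → ℂ) : Prop where
  mem : ∀ i ∈ I, g i ∈ O3
  inj : ∀ i ∈ I, ∀ j ∈ I, ECong (g i) (g j) β → i = j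
  surj : ∀ z ∈ O3, ∃ i ∈ I, ECong z (g i) β

lemma IsCRS3.sum_eq {β : ℂ} {T : Finset ℂ} (hT : IsCRS3 β T) {ι : Type} {I : Finset ι} {g : ι → ℂ}
    (hI : IsResidueSystem β I g) {f : ℂ → ℂ}
    (hf : ∀ a ∈ O3, ∀ b ∈ O3, ECong a b β → f a = f b) :
    ∑ l ∈ T, f l = ∑ i ∈ I, f (g i) := by
  obtain ⟨h1, h2, h3⟩ := hT
  choose k hk hk' using fun l (hl : l ∈ T) => hI.surj l (h1 l hl)
  refine Finset.sum_bij k hk ?_ ?_ ?_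
  · intro a ha b hb e
    exact h2 a ha b hb ((hk' a ha).trans (by rw [e]; exact (hk' b hb).symm))
  · intro i hi
    obtain ⟨a, ha, e⟩ := h3 (g i) (hI.mem i hi)
    exact ⟨a, ha, (hI.inj _ hi _ (hk a ha) (e.trans (hk' a ha))).symm⟩
  · intro a ha
    exact hf a (h1 a ha) _ (hI.mem _ (hk a ha)) (hk' a ha)

section crt

variable {p : ℕ} {π : ℂ} [Fact p.Prime] {t : O3 →+* ZMod p}

lemma IsResHom.cong_iff (ht : IsResHom π t) (a b : O3) : ECong a b π ↔ t a = t b := by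
  rw [← sub_eq_zero, ← map_sub, ht]
  push_cast
  rfl

lemma IsResidueSystem.crt (ht : IsResHom π t) (h : PrimaryPrime p π) {c : ℂ} (hc : c ∈ O3)
    (hc0 : c ≠ 0) {d : ℂ} (hd : d ∈ O3) (e : π = 1 + c * d) {J : Type} {I : Finset J} {g : J → ℂ}
    (hI : IsResidueSystem c I g) :
    IsResidueSystem (c * π) (Finset.range p ×ˢ I) (fun q => c * q.1 + π * g q.2) where
  mem := fun q hq => by
    have := hI.mem q.2 (Finset.mem_product.1 hq).2
    exact O3.add_mem (O3.mul_mem hc (natCast_mem O3 _)) (O3.mul_mem h.mem this)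
  inj := by
    rintro ⟨a, i⟩ hq ⟨b, j⟩ hq' ⟨u, hu, eu⟩
    rw [Finset.mem_product, Finset.mem_range] at hq hq'
    simp only at hq hq' eu
    have hij : i = j := hI.inj i hq.2 j hq'.2
      ⟨π * u - (a - b) - d * (g i - g j), by
        have hi := hI.mem i hq.2
        have hj := hI.mem j hq'.2
        exact O3.sub_mem (O3.sub_mem (O3.mul_mem h.mem hu)
          (O3.sub_mem (natCast_mem O3 _) (natCast_mem O3 _))) (O3.mul_mem hd (O3.sub_mem hi hj)), by
        linear_combination eu - (g i - g j) * e⟩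
    subst hij
    have h1 : (a : ℂ) - b = π * u := by
      apply mul_left_cancel₀ hc0
      linear_combination eu
    have h2 := (ht.cong_iff (a : O3) (b : O3)).1 ⟨u, hu, by push_cast; exact h1⟩
    rw [map_natCast, map_natCast, ZMod.natCast_eq_natCast_iff', Nat.mod_eq_of_lt hq.1,
      Nat.mod_eq_of_lt hq'.1] at h2
    rw [h2]
  surj := fun z hz => by
    obtain ⟨i, hi, w, hw, ew⟩ := hI.surj z hz
    have hgi := hI.mem i hi
    have hm : w - d * g i ∈ O3 := O3.sub_mem hw (O3.mul_mem hd hgi)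
    obtain ⟨v, hv, ev⟩ := (ht.cong_iff ⟨_, hm⟩ ((t ⟨_, hm⟩).val : O3)).2 (by
      rw [map_natCast, ZMod.natCast_zmod_val])
    refine ⟨((t ⟨_, hm⟩).val, i), Finset.mem_product.2 ⟨Finset.mem_range.2 (ZMod.val_lt _), hi⟩,
      v, hv, ?_⟩
    push_cast at ev
    linear_combination ew + c * ev - g i * e

lemma sum_crt (ht : IsResHom π t) (h : PrimaryPrime p π) {c : ℂ} (hc : c ∈ O3)
    (hc0 : c ≠ 0) {d : ℂ} (hd : d ∈ O3) (e : π = 1 + c * d) {J : Type} {I : Finset J} {g : J → ℂ}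
    (hI : IsResidueSystem c I g) {T : Finset ℂ} (hT : IsCRS3 (c * π) T) {χ χ₁ : ℂ → ℂ}
    (hχ : IsResChar3 π χ) (hχ₁ : ∀ a ∈ O3, ∀ b ∈ O3, ECong a b c → χ₁ a = χ₁ b) :
    ∑ l ∈ T, (χ l * χ₁ l) * eS3 (l / (c * π)) =
      χ c * (∑ a ∈ Finset.range p, χ a * eS3 (a / π)) * ∑ i ∈ I, χ₁ (g i) * eS3 (g i / c) := by
  have hπ0 := h.ne_zero
  have hI' := hI.crt ht h hc hc0 hd e
  rw [IsCRS3.sum_eq hT hI' (f := fun l => (χ l * χ₁ l) * eS3 (l / (c * π)))]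
  · rw [Finset.sum_product, Finset.mul_sum (Finset.range p), Finset.sum_mul (Finset.range p)]
    refine Finset.sum_congr rfl fun a ha => ?_
    rw [Finset.mul_sum]
    refine Finset.sum_congr rfl fun i hi => ?_
    have hgi := hI.mem i hi
    have hmem := hI'.mem (a, i) (Finset.mem_product.2 ⟨ha, hi⟩)
    have e1 : χ (c * a + π * g i) = χ c * χ a := by
      rw [← hχ.map_mul _ hc _ (natCast_mem O3 _)]
      exact hχ.periodic _ hmem _ (O3.mul_mem hc (natCast_mem O3 _)) ⟨g i, hgi, by ring⟩
    have e2 : χ₁ (c * a + π * g i) = χ₁ (g i) :=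
      hχ₁ _ hmem _ hgi ⟨a + d * g i, O3.add_mem (natCast_mem O3 _) (O3.mul_mem hd hgi), by
        rw [e]; ring⟩
    have e3 : (c * a + π * g i) / (c * π) = a / π + g i / c := by field_simp
    simp only
    rw [e1, e2, e3, eS3_add]; ring
  · rintro a ha b hb hab
    have hab' := hab
    obtain ⟨u, hu, eu⟩ := hab
    rw [eS3_div_congr (mul_ne_zero hc0 hπ0) hab',
      hχ.periodic a ha b hb ⟨c * u, O3.mul_mem hc hu, by linear_combination eu⟩,
      hχ₁ a ha b hb ⟨π * u, O3.mul_mem h.mem hu, by linear_combination eu⟩]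

/-- The residue character, as a multiplicative character of `ZMod p`. -/
def resMul (ht : IsResHom π t) (h : PrimaryPrime p π) {χ : ℂ → ℂ} (hχ : IsResChar3 π χ) :
    MulChar (ZMod p) ℂ where
  toFun := fun x => χ (x.val : ℂ)
  map_one' := by
    rw [ZMod.val_one'' h.prime.one_lt.ne', Nat.cast_one]; exact hχ.map_one
  map_mul' := fun x y => by
    rw [← hχ.map_mul _ (natCast_mem O3 _) _ (natCast_mem O3 _)]
    refine hχ.periodic _ (natCast_mem O3 _) _ (O3.mul_mem (natCast_mem O3 _) (natCast_mem O3 _)) ?_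
    have := (ht.cong_iff ((x * y).val : O3) ((x.val : O3) * (y.val : O3))).2 (by simp)
    push_cast at this
    exact this
  map_nonunit' := fun x hx => by
    have hx0 : x = 0 := by simpa using hx
    subst hx0
    rw [ZMod.val_zero, Nat.cast_zero]
    refine hχ.vanish _ O3.zero_mem ?_
    rintro ⟨u, hu, v, hv, e⟩
    have h1 : t 1 = 0 := (ht 1).2 ⟨v, hv, by push_cast; linear_combination -e⟩
    rw [map_one] at h1
    exact one_ne_zero h1

lemma resMul_res (ht : IsResHom π t) (h : PrimaryPrime p π) {χ : ℂ → ℂ} (hχ : IsResChar3 π χ)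
    (z : O3) : resMul ht h hχ (t z) = χ z := by
  refine hχ.periodic _ (natCast_mem O3 _) _ z.2 ?_
  have := (ht.cong_iff ((t z).val : O3) z).2 (by simp)
  push_cast at this
  exact this

lemma rho3_pow_of_cube {z : ℂ} (h : z ^ 3 = 1) : ∃ n : ℕ, z = ρ3 ^ n := by
  have : (z - 1) * (z - ρ3) * (z - ρ3 ^ 2) = 0 := by
    linear_combination h + (z - z ^ 2) * rho3_sum + (z - 1) * rho3_cube
  rcases mul_eq_zero.1 this with h1 | h1
  · rcases mul_eq_zero.1 h1 with h1 | h1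
    · exact ⟨0, by rw [pow_zero]; exact sub_eq_zero.1 h1⟩
    · exact ⟨1, by rw [pow_one]; exact sub_eq_zero.1 h1⟩
  · exact ⟨2, sub_eq_zero.1 h1⟩

lemma coprime_of_res_ne_zero (ht : IsResHom π t) {z : O3} (hz : t z ≠ 0) : ECoprime z π := by
  obtain ⟨d, hd, e⟩ := (ht.cong_iff (((t z)⁻¹.val : O3) * z) 1).2 (by
    rw [map_mul, map_natCast, ZMod.natCast_zmod_val, inv_mul_cancel₀ hz, map_one])
  refine ⟨((t z)⁻¹.val : ℂ), natCast_mem O3 _, -d, O3.neg_mem hd, ?_⟩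
  push_cast at e
  linear_combination e

lemma res_ne_zero_of_coprime (ht : IsResHom π t) {z : O3} (hz : ECoprime z π) : t z ≠ 0 := by
  obtain ⟨u, hu, v, hv, e⟩ := hz
  intro h0
  obtain ⟨d, hd, ed⟩ := (ht z).1 h0
  have h1 : t 1 = 0 := (ht 1).2 ⟨u * d + v, O3.add_mem (O3.mul_mem hu hd) hv, by
    push_cast; linear_combination -e + u * ed⟩
  rw [map_one] at h1
  exact one_ne_zero h1

lemma IsCubicChar.isCubicMul (ht : IsResHom π t) (h : PrimaryPrime p π) {χ : ℂ → ℂ}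
    (hχ : IsCubicChar π p χ) {m : ℕ} (hm : p = 3 * m + 1) :
    IsCubicMul m (t rO) (resMul ht h hχ.resChar) := by
  intro x hx n hn
  obtain ⟨z, rfl⟩ := resHom_surj (t := t) x
  have hz := coprime_of_res_ne_zero ht hx
  obtain ⟨i, hi⟩ := rho3_pow_of_cube (hχ.cube z z.2 hz)
  have h1 := hχ.euler z z.2 hz
  rw [show (p - 1) / 3 = m by omega, hi] at h1
  have h2 := (ht.cong_iff (rO ^ i) (z ^ m)).1 (by push_cast; exact h1)
  rw [map_pow, map_pow, hn] at h2
  have h3 := (cubeRoot_rO (t := t) h).mod_eq_of_pow_eq h2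
  rw [resMul_res, hi, ← Nat.div_add_mod i 3, ← Nat.div_add_mod n 3, h3]
  simp only [pow_add, pow_mul, rho3_cube, one_pow]

lemma sum_res_eS3 (ht : IsResHom π t) (h : PrimaryPrime p π) {χ : ℂ → ℂ}
    (hχ : IsResChar3 π χ) :
    ∑ a ∈ Finset.range p, χ a * eS3 (a / π) =
      χ (-3) * gaussSum (resMul ht h hχ) (echarAdd ht h) := by
  have h3 : t (-3) ≠ 0 := by rw [map_neg]; exact neg_ne_zero.2 (resHom_three_ne h)
  have h4 : resMul ht h hχ (t (-3)) = χ (-3) := resMul_res ht h hχ (-3)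
  rw [← h4, gaussSum, Finset.mul_sum]
  refine Finset.sum_bij' (fun a _ => (a : ZMod p) * (t (-3))⁻¹) (fun x _ => (t (-3) * x).val)
    ?_ ?_ ?_ ?_ ?_
  · simp
  · intro x _; exact Finset.mem_range.2 (ZMod.val_lt _)
  · intro a ha
    rw [mul_comm (a : ZMod p), mul_inv_cancel_left₀ h3, ZMod.val_cast_of_lt (Finset.mem_range.1 ha)]
  · intro x _
    rw [ZMod.natCast_zmod_val, mul_comm (t (-3)), mul_inv_cancel_right₀ h3]
  · intro a _
    rw [← mul_assoc, ← map_mul, mul_comm (a : ZMod p), mul_inv_cancel_left₀ h3]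
    obtain ⟨z, hz⟩ := resHom_surj (t := t) ((t (-3))⁻¹ * (a : ZMod p))
    have h5 := resMul_res ht h hχ (a : O3)
    rw [map_natCast] at h5
    push_cast at h5
    rw [h5, echarAdd_apply, ← hz, echar_res ht h, ← mul_div_assoc]
    congr 1
    have h6 : ECong (-3 * z) a π := (ht.cong_iff (-3 * z) (a : O3)).2 (by
      rw [map_mul, hz, mul_inv_cancel_left₀ h3, map_natCast])
    exact (eS3_div_congr h.ne_zero h6).symm

end crt

end crs

/-! ### The local sums at `3` and at `√-3` -/

section localSums

lemma eS3_one_third : eS3 (1 / 3) = ρ3 := by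
  have := eS3_coord (1 / 3) 0
  push_cast at this
  rw [zero_mul, add_zero] at this
  rw [this, ρ3]
  congr 1
  ring

lemma eS3_rho_third : eS3 (ρ3 / 3) = ρ3 ^ 2 := by
  have := eS3_coord 0 (1 / 3)
  push_cast at this
  rw [show ρ3 / 3 = 0 + 1 / 3 * ρ3 by ring, this]
  have h1 : Complex.exp (2 * Real.pi * I * (0 - 1 / 3)) * ρ3 = 1 := by
    rw [ρ3, ← Complex.exp_add]
    convert Complex.exp_zero using 2
    ring
  linear_combination ρ3 ^ 2 * h1 -
    Complex.exp (2 * Real.pi * I * (0 - 1 / 3)) * rho3_cube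

lemma eS3_nat_third (i j : ℕ) : eS3 ((i + j * ρ3) / 3) = ρ3 ^ i * (ρ3 ^ 2) ^ j := by
  have h1 := eS3_int_mul i (1 / 3)
  have h2 := eS3_int_mul j (ρ3 / 3)
  rw [eS3_one_third, zpow_natCast] at h1
  rw [eS3_rho_third, zpow_natCast] at h2
  rw [← h1, ← h2, ← eS3_add]
  congr 1
  push_cast
  ring

lemma eS3_nat_sqrtm3 (i : ℕ) : eS3 (i / sqrtm3) = ρ3 ^ i := by
  have h1 := eS3_int_mul i (1 / sqrtm3)
  have h0 : eS3 (1 / sqrtm3) = ρ3 := by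
    have := eS3_coord (-1 / 3) (-2 / 3)
    push_cast at this
    rw [show (1 : ℂ) / sqrtm3 = -1 / 3 + -2 / 3 * ρ3 by
      rw [div_eq_iff sqrtm3_ne_zero]
      linear_combination (1 / 3 : ℂ) * sqrtm3_sq - (1 / 3 : ℂ) * sqrtm3 * sqrtm3_eq', this, ρ3]
    congr 1
    ring
  rw [h0, zpow_natCast] at h1
  rw [← h1]
  congr 1
  push_cast
  ring

lemma int_rho_eq_zero {a b : ℤ} (h : (a : ℂ) + b * ρ3 = 0) : a = 0 ∧ b = 0 := by
  have h1 : ((a : ℂ) + b * ρ3) * (starRingEnd ℂ) ((a : ℂ) + b * ρ3) = 0 := by rw [h, zero_mul]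
  rw [map_add, map_mul, map_intCast, map_intCast, conj_rho3] at h1
  have h2 : a ^ 2 - a * b + b ^ 2 = 0 := by
    have : ((a ^ 2 - a * b + b ^ 2 : ℤ) : ℂ) = 0 := by
      push_cast
      linear_combination h1 - a * b * rho3_sum - b ^ 2 * rho3_cube
    exact_mod_cast this
  constructor <;> nlinarith [sq_nonneg (2 * a - b), sq_nonneg (2 * b - a), sq_nonneg a, sq_nonneg b]

/-- The standard residue system modulo `3`. -/
lemma isResidueSystem_three :
    IsResidueSystem 3 (Finset.range 3 ×ˢ Finset.range 3) (fun q : ℕ × ℕ => (q.1 + q.2 * ρ3 : ℂ)) where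
  mem := fun q _ => O3.add_mem (natCast_mem O3 _) (O3.mul_mem (natCast_mem O3 _) rho3_mem)
  inj := by
    rintro ⟨a, b⟩ hq ⟨a', b'⟩ hq' ⟨d, hd, e⟩
    obtain ⟨x, y, rfl⟩ := mem_O3.1 hd
    simp only [Finset.mem_product, Finset.mem_range] at hq hq' e
    have h1 : ((a - a' - 3 * x : ℤ) : ℂ) + ((b - b' - 3 * y : ℤ) : ℂ) * ρ3 = 0 := by
      push_cast
      linear_combination e
    have h2 := int_rho_eq_zero h1
    ext <;> simp only <;> omega
  surj := fun z hz => by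
    obtain ⟨x, y, rfl⟩ := mem_O3.1 hz
    refine ⟨((x % 3).toNat, (y % 3).toNat), by simp; omega, (x / 3 : ℤ) + (y / 3 : ℤ) * ρ3,
      mem_O3.2 ⟨_, _, rfl⟩, ?_⟩
    have h1 : (((x % 3).toNat : ℤ) : ℂ) = x - 3 * (x / 3 : ℤ) := by
      rw [Int.toNat_of_nonneg (by omega)]
      have := Int.emod_add_mul_ediv x 3
      exact_mod_cast (by omega : x % 3 = x - 3 * (x / 3))
    have h2 : (((y % 3).toNat : ℤ) : ℂ) = y - 3 * (y / 3 : ℤ) := by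
      rw [Int.toNat_of_nonneg (by omega)]
      exact_mod_cast (by omega : y % 3 = y - 3 * (y / 3))
    rw [Int.cast_natCast] at h1 h2
    simp only
    rw [h1, h2]
    ring

/-- The standard residue system modulo `√-3`. -/
lemma isResidueSystem_sqrtm3 :
    IsResidueSystem sqrtm3 (Finset.range 3) (fun i : ℕ => (i : ℂ)) where
  mem := fun q _ => natCast_mem O3 _
  inj := by
    rintro a ha b hb ⟨d, hd, e⟩
    obtain ⟨x, y, rfl⟩ := mem_O3.1 hd
    rw [Finset.mem_range] at ha hb
    have h1 : ((a - b - x + 2 * y : ℤ) : ℂ) + ((-2 * x + y : ℤ) : ℂ) * ρ3 = 0 := by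
      push_cast
      rw [sqrtm3_eq'] at e
      linear_combination e + 2 * y * rho3_sq
    have h2 := int_rho_eq_zero h1
    omega
  surj := fun z hz => by
    obtain ⟨x, y, rfl⟩ := mem_O3.1 hz
    have h1 : (((((x + y) % 3).toNat : ℕ) : ℤ) : ℂ) = x + y - 3 * ((x + y) / 3 : ℤ) := by
      rw [Int.toNat_of_nonneg (by omega)]
      exact_mod_cast (by omega : (x + y) % 3 = x + y - 3 * ((x + y) / 3))
    rw [Int.cast_natCast] at h1
    refine ⟨((x + y) % 3).toNat, by simp; omega, -((x + y) / 3 : ℤ) * sqrtm3 - y * ρ3 ^ 2,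
      O3.sub_mem (O3.mul_mem (O3.neg_mem (intCast_mem O3 _)) sqrtm3_mem)
        (O3.mul_mem (intCast_mem O3 _) (O3.pow_mem rho3_mem 2)), ?_⟩
    rw [h1]
    linear_combination (((x + y) / 3 : ℤ) : ℂ) * sqrtm3_sq + y * ρ3 ^ 2 * sqrtm3_eq
      + y * (1 - ρ3) * rho3_cube

lemma isChi0_values {χ₀ : ℂ → ℂ} (h : IsChi0₃ χ₀) :
    χ₀ 0 = 0 ∧ χ₀ 1 = 1 ∧ χ₀ 2 = -1 ∧ χ₀ ρ3 = ρ3 ∧ χ₀ (2 * ρ3) = -ρ3 ∧ χ₀ (1 + ρ3) = -ρ3 ^ 2 ∧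
      χ₀ (2 + 2 * ρ3) = ρ3 ^ 2 ∧ χ₀ (1 + 2 * ρ3) = 0 ∧ χ₀ (2 + ρ3) = 0 := by
  obtain ⟨h1, h2⟩ := h
  have hm := rho3_mem
  have one := O3.one_mem
  have two : (2 : ℂ) ∈ O3 := by exact_mod_cast natCast_mem O3 2
  have key : ∀ z ∈ O3, (∃ w ∈ O3, z = sqrtm3 * w) → χ₀ z = 0 := by
    rintro z hz ⟨w, hw, e⟩
    refine h1.vanish z hz ?_
    rintro ⟨u, hu, v, hv, e'⟩
    have := isResidueSystem_sqrtm3.inj 1 (by simp) 0 (by simp)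
      ⟨u * w - v * sqrtm3, O3.sub_mem (O3.mul_mem hu hw) (O3.mul_mem hv sqrtm3_mem), by
        push_cast
        linear_combination -e' + u * e + v * sqrtm3_sq⟩
    omega
  refine ⟨key 0 O3.zero_mem ⟨0, O3.zero_mem, by ring⟩, h1.map_one, ?_, h2 _ (by simp), ?_, ?_, ?_,
    key _ (O3.add_mem one (O3.mul_mem two hm)) ⟨1, one, by rw [sqrtm3_eq']; ring⟩,
    key _ (O3.add_mem two hm) ⟨-ρ3, O3.neg_mem hm, by
      rw [sqrtm3_eq']; linear_combination 2 * rho3_sq⟩⟩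
  · rw [← h2 (-1) (by simp)]
    exact h1.periodic _ two _ (O3.neg_mem one) ⟨1, one, by ring⟩
  · rw [← h2 (-ρ3) (by simp)]
    exact h1.periodic _ (O3.mul_mem two hm) _ (O3.neg_mem hm) ⟨ρ3, hm, by ring⟩
  · rw [← h2 (-ρ3 ^ 2) (by simp)]
    congr 1
    linear_combination rho3_sum
  · rw [← h2 (ρ3 ^ 2) (by simp)]
    exact h1.periodic _ (O3.add_mem two (O3.mul_mem two hm)) _ (O3.pow_mem hm 2)
      ⟨1 + ρ3, O3.add_mem one hm, by linear_combination -rho3_sum⟩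

lemma sum_chi0 {χ₀ : ℂ → ℂ} (h : IsChi0₃ χ₀) :
    ∑ q ∈ Finset.range 3 ×ˢ Finset.range 3, χ₀ ((q.1 : ℂ) + q.2 * ρ3) *
      eS3 (((q.1 : ℂ) + q.2 * ρ3) / 3) = -3 * ρ3 ^ 2 := by
  obtain ⟨v0, v1, v2, v3, v4, v5, v6, v7, v8⟩ := isChi0_values h
  simp only [eS3_nat_third]
  rw [Finset.sum_product]
  simp only [Finset.sum_range_succ, Finset.sum_range_zero]
  norm_num
  rw [v0, v1, v2, v3, v4, v5, v6, v7, v8]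
  linear_combination (-ρ3 ^ 2 + 1 - ρ3 ^ 2 + ρ3 ^ 5 + ρ3 ^ 2) * rho3_cube + rho3_sum

lemma sum_conj_chi0 {χ₀ : ℂ → ℂ} (h : IsChi0₃ χ₀) :
    ∑ q ∈ Finset.range 3 ×ˢ Finset.range 3, (starRingEnd ℂ) (χ₀ ((q.1 : ℂ) + q.2 * ρ3)) *
      eS3 (((q.1 : ℂ) + q.2 * ρ3) / 3) = 3 * ρ3 := by
  obtain ⟨v0, v1, v2, v3, v4, v5, v6, v7, v8⟩ := isChi0_values h
  simp only [eS3_nat_third]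
  rw [Finset.sum_product]
  simp only [Finset.sum_range_succ, Finset.sum_range_zero]
  norm_num
  rw [v0, v1, v2, v3, v4, v5, v6, v7, v8]
  simp only [map_neg, map_one, map_zero, map_pow, conj_rho3]
  linear_combination (ρ3 - (ρ3 ^ 3 + 1) - ρ3 * (ρ3 ^ 3 + 1) + ρ3 * (ρ3 ^ 6 + ρ3 ^ 3 + 1)) * rho3_cube - rho3_sum

lemma sum_chi0' {χ₀ : ℂ → ℂ} (h : IsChi0'₃ χ₀) :
    ∑ i ∈ Finset.range 3, χ₀ (i : ℂ) * eS3 ((i : ℂ) / sqrtm3) = sqrtm3 := by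
  obtain ⟨h1, h2⟩ := h
  have one := O3.one_mem
  have two : (2 : ℂ) ∈ O3 := by exact_mod_cast natCast_mem O3 2
  have v0 : χ₀ 0 = 0 := by
    refine h1.vanish 0 O3.zero_mem ?_
    rintro ⟨u, hu, v, hv, e⟩
    have := isResidueSystem_sqrtm3.inj 1 (by simp) 0 (by simp) ⟨v, hv, by
      push_cast
      linear_combination -e⟩
    omega
  have v2 : χ₀ 2 = -1 := by
    rw [← h2]
    exact h1.periodic _ two _ (O3.neg_mem one) ⟨-sqrtm3, O3.neg_mem sqrtm3_mem, by
      linear_combination sqrtm3_sq⟩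
  simp only [eS3_nat_sqrtm3, Finset.sum_range_succ, Finset.sum_range_zero]
  norm_num
  rw [v0, h1.map_one, v2, sqrtm3_eq]
  ring

end localSums

/-! ### Third sets of Eisenstein integers and the root number -/

section bridge

variable {p : ℕ} {π : ℂ} [Fact p.Prime] {t : O3 →+* ZMod p}

lemma rho3_pow_mem_roots (n : ℕ) : ρ3 ^ n ∈ ({1, ρ3, ρ3 ^ 2} : Set ℂ) := by
  rw [← Nat.div_add_mod n 3, pow_add, pow_mul, rho3_cube, one_pow, one_mul]
  have : n % 3 < 3 := Nat.mod_lt _ (by norm_num)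
  interval_cases n % 3 <;> simp

/-- The residue map extended by zero to all complex numbers. -/
def resExt (t : O3 →+* ZMod p) (z : ℂ) : ZMod p :=
  open Classical in if h : z ∈ O3 then t ⟨z, h⟩ else 0

lemma resExt_of_mem {z : ℂ} (h : z ∈ O3) : resExt t z = t ⟨z, h⟩ := dif_pos h

section thirdSet

variable {S : Finset ℂ}

lemma resExt_injOn (ht : IsResHom π t) (hS : IsThirdSet π S) : Set.InjOn (resExt t) S := by
  intro a ha b hb e
  have ma := (hS.1 a ha).1
  have mb := (hS.1 b hb).1
  rw [resExt_of_mem ma, resExt_of_mem mb] at e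
  refine (hS.2.2 a ha b hb 1 (by simp) 1 (by simp) ?_).1
  rw [one_mul, one_mul]
  exact (ht.cong_iff ⟨a, ma⟩ ⟨b, mb⟩).2 e

lemma IsThirdSet.thirdSet (ht : IsResHom π t) (hS : IsThirdSet π S) :
    ThirdSet (t rO) (S.image (resExt t)) where
  ne_zero := by
    intro s hs
    obtain ⟨a, ha, rfl⟩ := Finset.mem_image.1 hs
    rw [resExt_of_mem (hS.1 a ha).1]
    exact res_ne_zero_of_coprime ht (hS.1 a ha).2
  cover := by
    intro x hx
    obtain ⟨z, rfl⟩ := resHom_surj (t := t) x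
    obtain ⟨ν, hν, ε, hε, e⟩ := hS.2.1 z z.2 (coprime_of_res_ne_zero ht hx)
    have mν := (hS.1 ν hν).1
    have : ∃ n : ℕ, ε = ρ3 ^ n := by
      rcases hε with rfl | rfl | rfl
      exacts [⟨0, (pow_zero _).symm⟩, ⟨1, (pow_one _).symm⟩, ⟨2, rfl⟩]
    obtain ⟨n, rfl⟩ := this
    refine ⟨_, Finset.mem_image_of_mem _ hν, n, ?_⟩
    rw [resExt_of_mem mν, ← map_pow, ← map_mul]
    exact (ht.cong_iff z (rO ^ n * (⟨ν, mν⟩ : O3))).1 e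
  inj := by
    intro s hs s' hs' n e
    obtain ⟨a, ha, rfl⟩ := Finset.mem_image.1 hs
    obtain ⟨b, hb, rfl⟩ := Finset.mem_image.1 hs'
    have ma := (hS.1 a ha).1
    have mb := (hS.1 b hb).1
    rw [resExt_of_mem ma, resExt_of_mem mb, ← map_pow, ← map_mul] at e
    have h1 : ECong a (ρ3 ^ n * b) π := (ht.cong_iff ⟨a, ma⟩ (rO ^ n * (⟨b, mb⟩ : O3))).2 e
    rw [(hS.2.2 a ha b hb 1 (by simp) _ (rho3_pow_mem_roots n) (by rwa [one_mul])).1]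

lemma IsThirdSet.prod_phi3 (ht : IsResHom π t) (h : PrimaryPrime p π) (hS : IsThirdSet π S) :
    ∏ s ∈ S.image (resExt t), Phi π s = ∏ ν ∈ S, phi3 (ν / π) := by
  rw [Finset.prod_image (resExt_injOn ht hS)]
  refine Finset.prod_congr rfl fun ν hν => ?_
  have mν := (hS.1 ν hν).1
  rw [resExt_of_mem mν, ← PH_div_eq ht h ⟨ν, mν⟩, phi3_eq_PH]
  intro hm
  refine res_ne_zero_of_coprime ht (z := ⟨ν, mν⟩) (hS.1 ν hν).2 ((ht _).2 ⟨_, hm, ?_⟩)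
  have := h.ne_zero
  field_simp

lemma IsThirdSet.prod_res (ht : IsResHom π t) (hS : IsThirdSet π S) {n : ℕ}
    (hγ : ECong (ρ3 ^ n) (-∏ ν ∈ S, ν) π) :
    -∏ s ∈ S.image (resExt t), s = t rO ^ n := by
  rw [Finset.prod_image (resExt_injOn ht hS)]
  have h1 : ∏ ν ∈ S, resExt t ν = t (∏ ν ∈ S.attach, ⟨ν, (hS.1 ν ν.2).1⟩) := by
    rw [map_prod, ← Finset.prod_attach]
    exact Finset.prod_congr rfl fun ν _ => resExt_of_mem (hS.1 ν ν.2).1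
  rw [h1, ← map_neg, ← map_pow]
  symm
  refine (ht.cong_iff _ _).1 ?_
  have h2 : ((-∏ ν ∈ S.attach, (⟨ν, (hS.1 ν ν.2).1⟩ : O3) : O3) : ℂ) = -∏ ν ∈ S, ν := by
    push_cast
    rw [Finset.prod_attach S (fun ν => ν)]
  rw [h2]
  exact hγ

end thirdSet

/-- The Gauss sum of a cubic residue character in terms of the canonical cubic root. -/
theorem sum_cubicChar_eq (h : PrimaryPrime p π) {χ : ℂ → ℂ} (hχ : IsCubicChar π p χ)
    {S : Finset ℂ} (hS : IsThirdSet π S) {γ : ℂ} (hγ : IsGamma3 π S γ) {P : ℂ}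
    (hP : P = γ⁻¹ * ∏ ν ∈ S, phi3 (ν / π)) {m : ℕ} (hm : p = 3 * m + 1) :
    P ^ 3 = π ∧ χ 3 = χ sqrtm3 ^ 2 ∧ χ sqrtm3 ^ 3 = 1 ∧
      ∑ a ∈ Finset.range p, χ a * eS3 (a / π) = -ρ3 ^ (2 * m) * P ^ 2 * (starRingEnd ℂ) P := by
  obtain ⟨t, ht⟩ := h.exists_resHom
  have hr := cubeRoot_rO (t := t) h
  have hS' := hS.thirdSet ht
  have hcard : (S.image (resExt t)).card = m := by
    have := hS'.card hr
    omega
  obtain ⟨n, rfl⟩ := rho3_pow_of_cube hγ.1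
  have hmul := hχ.isCubicMul ht h hm
  have hg := gaussSum_eq ht h hS' (ψ := resMul ht h hχ.resChar) (by rw [hcard]; exact hmul)
    (hS.prod_res ht hγ.2) (P := P) (by rw [hP, hS.prod_phi3 ht h])
  rw [hcard] at hg
  have hc := hmul.cube hr hm
  have e1 : resMul ht h hχ.resChar (t sO) = χ sqrtm3 := resMul_res ht h hχ.resChar sO
  have e2 : χ (-3) = χ sqrtm3 ^ 2 := by
    rw [← sqrtm3_sq, sq, hχ.resChar.map_mul _ sqrtm3_mem _ sqrtm3_mem, sq]
  have e3 : χ sqrtm3 ^ 3 = 1 := by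
    rw [← e1, ← MulChar.pow_apply' _ three_ne_zero, hc]
    exact MulChar.one_apply (isUnit_iff_ne_zero.2 (resHom_sO_ne h))
  have e4 : χ 3 = χ (-3) := by
    have m3 := O3.neg_mem three_mem
    have h1 : (χ (-1)) = 1 := by
      have m1 := O3.neg_mem O3.one_mem
      have a1 : χ (-1) ^ 2 = 1 := by
        rw [sq, ← hχ.resChar.map_mul _ m1 _ m1]; norm_num; exact hχ.resChar.map_one
      have a2 : χ (-1) ^ 3 = 1 := hχ.cube _ m1 ⟨-1, m1, 0, O3.zero_mem, by ring⟩
      linear_combination a2 - χ (-1) * a1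
    rw [show (3 : ℂ) = -1 * -3 by norm_num, hχ.resChar.map_mul _ (O3.neg_mem O3.one_mem) _ m3, h1]
    norm_num
  refine ⟨hg.1, e4.trans e2, e3, ?_⟩
  rw [sum_res_eS3 ht h hχ.resChar, hg.2, e1, e2]
  linear_combination -ρ3 ^ (2 * m) * P ^ 2 * (starRingEnd ℂ) P * e3

end bridge

/-- **Theorem I.3.** Let `π ∈ ℤ[ρ]` be a primary prime with `p = π·π̄` and let `χ̃_π` be
the associated Hecke character of weight one. Then the root number
`C(χ̃_π) = −ρ·β⁻¹·Σ_{λ mod β} χ₁(λ)·e^{2πi·S(λ/β)}` satisfies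
`C(χ̃_π) = χ_π(3)·π̃⁻¹·π̃̄` if `p ≡ 7 (mod 18)` (with `β = 3π`, `χ₁ = χ_π·χ̄₀`);
`C(χ̃_π) = χ̄_π(3)·π̃⁻¹·π̃̄` if `p ≡ 13 (mod 18)` (with `β = √−3·π`, `χ₁ = χ_π·χ₀′`);
and `C(χ̃_π) = −χ_π(3)·π̃⁻¹·π̃̄` if `p ≡ 1 (mod 18)` (with `β = 3π`, `χ₁ = χ_π·χ₀`). -/
theorem stmt_2
    (p : ℕ) (hp : p.Prime) (hp3 : p % 3 = 1)
    (π : ℂ) (hπ : π ∈ O3) (hprimary : ECong π 1 3)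
    (hnorm : (p : ℂ) = π * (starRingEnd ℂ) π)
    (χ : ℂ → ℂ) (hχ : IsCubicChar π p χ)
    (χ₀ : ℂ → ℂ) (hχ₀ : IsChi0₃ χ₀)
    (χ₀' : ℂ → ℂ) (hχ₀' : IsChi0'₃ χ₀')
    (S : Finset ℂ) (hS : IsThirdSet π S)
    (γ : ℂ) (hγ : IsGamma3 π S γ)
    (πt : ℂ) (hπt : πt = γ⁻¹ * ∏ ν ∈ S, phi3 (ν / π)) :
    (p % 18 = 7 → ∀ T : Finset ℂ, IsCRS3 (3 * π) T →
      -ρ3 * (3 * π)⁻¹ * ∑ l ∈ T, (χ l * (starRingEnd ℂ) (χ₀ l)) * eS3 (l / (3 * π))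
        = χ 3 * πt⁻¹ * (starRingEnd ℂ) πt) ∧
    (p % 18 = 13 → ∀ T : Finset ℂ, IsCRS3 (sqrtm3 * π) T →
      -ρ3 * (sqrtm3 * π)⁻¹ * ∑ l ∈ T, (χ l * χ₀' l) * eS3 (l / (sqrtm3 * π))
        = (starRingEnd ℂ) (χ 3) * πt⁻¹ * (starRingEnd ℂ) πt) ∧
    (p % 18 = 1 → ∀ T : Finset ℂ, IsCRS3 (3 * π) T →
      -ρ3 * (3 * π)⁻¹ * ∑ l ∈ T, (χ l * χ₀ l) * eS3 (l / (3 * π))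
        = -(χ 3) * πt⁻¹ * (starRingEnd ℂ) πt) := by
  have : Fact p.Prime := ⟨hp⟩
  obtain ⟨d, hd, ed⟩ := hprimary
  have e : π = 1 + 3 * d := by linear_combination ed
  have h : PrimaryPrime p π := ⟨hp, hπ, ⟨d, hd, e⟩, hnorm.symm, hp3⟩
  have e' : π = 1 + sqrtm3 * (-sqrtm3 * d) := by linear_combination e + d * sqrtm3_sq
  have hd' : -sqrtm3 * d ∈ O3 := O3.mul_mem (O3.neg_mem sqrtm3_mem) hd
  obtain ⟨t, ht⟩ := h.exists_resHom
  obtain ⟨m, hm⟩ : ∃ m, p = 3 * m + 1 := ⟨p / 3, by omega⟩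
  obtain ⟨hP, h3, hc, hsum⟩ := sum_cubicChar_eq h hχ hS hγ hπt hm
  have hπ0 := h.ne_zero
  have hP0 : πt ≠ 0 := by
    rintro rfl
    exact hπ0 (by rw [← hP]; norm_num)
  have hl0 := sqrtm3_ne_zero
  have h30 : (3 : ℂ) ≠ 0 := three_ne_zero
  refine ⟨fun hp18 T hT => ?_, fun hp18 T hT => ?_, fun hp18 T hT => ?_⟩
  · obtain ⟨k, rfl⟩ : ∃ k, m = 3 * k + 2 := ⟨m / 3, by omega⟩
    rw [sum_crt ht h three_mem h30 hd e isResidueSystem_three hT hχ.resChar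
      (fun a ha b hb hab => by rw [hχ₀.1.periodic a ha b hb hab]), hsum, sum_conj_chi0 hχ₀, ← hP]
    rw [show 2 * (3 * k + 2) = 3 * (2 * k + 1) + 1 by ring, pow_add, pow_mul, rho3_cube, one_pow]
    field_simp
    linear_combination χ 3 * (starRingEnd ℂ) πt * rho3_cube
  · obtain ⟨k, rfl⟩ : ∃ k, m = 3 * k + 1 := ⟨m / 3, by omega⟩
    rw [sum_crt ht h sqrtm3_mem hl0 hd' e' isResidueSystem_sqrtm3 hT hχ.resChar
      hχ₀'.1.periodic, hsum, sum_chi0' hχ₀', ← hP]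
    have hconj : (starRingEnd ℂ) (χ 3) = χ sqrtm3 := by
      obtain ⟨n, hn⟩ := rho3_pow_of_cube hc
      rw [h3, hn, map_pow, map_pow, conj_rho3, ← pow_mul, ← pow_mul]
      rw [show 2 * (n * 2) = 3 * n + n by ring, pow_add, pow_mul, rho3_cube, one_pow, one_mul]
    rw [hconj, show 2 * (3 * k + 1) = 3 * (2 * k) + 2 by ring, pow_add, pow_mul, rho3_cube, one_pow]
    field_simp
    linear_combination χ sqrtm3 * (starRingEnd ℂ) πt * rho3_cube
  · obtain ⟨k, rfl⟩ : ∃ k, m = 3 * k := ⟨m / 3, by omega⟩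
    rw [sum_crt ht h three_mem h30 hd e isResidueSystem_three hT hχ.resChar
      hχ₀.1.periodic, hsum, sum_chi0 hχ₀, ← hP]
    rw [show 2 * (3 * k) = 3 * (2 * k) by ring, pow_mul, rho3_cube, one_pow]
    field_simp
    linear_combination -χ 3 * (starRingEnd ℂ) πt * rho3_cube

end
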